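/- For every finite simple graph H there exists an integer c_H such that the following holds: for every finite simple graph G not containing H as an odd minor, every set S of positive integers with 1 ∈ S, and every positive integer k, if every induced bipartite subgraph of G is properly S-achieved k-colorable, then G is properly S-achieved (k+c_H)-colorable. -/

import Mathlib

open SimpleGraph

universe u v

namespace CFPaper

variable {V : Type u} {W : Type v}

/-- A coloring is proper if adjacent vertices get distinct colors. -/
def Proper (G : SimpleGraph V) (φ : V → ℕ) : Prop :=
  ∀ ⦃u w : V⦄, G.Adj u w → φ u ≠ φ w

/-- A coloring is conflict-free if every non-isolated vertex has a color appearing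
exactly once in its open neighborhood. -/
def ConflictFree (G : SimpleGraph V) (φ : V → ℕ) : Prop :=
  ∀ v : V, (G.neighborSet v).Nonempty →
    ∃ c : ℕ, {u : V | G.Adj v u ∧ φ u = c}.ncard = 1

/-- `G` is conflict-free `k`-choosable (k a real number). -/
def CFChoosable (G : SimpleGraph V) (k : ℝ) : Prop :=
  ∀ L : V → Finset ℕ, (∀ v, k ≤ ((L v).card : ℝ)) →
    ∃ φ : V → ℕ, (∀ v, φ v ∈ L v) ∧ Proper G φ ∧ ConflictFree G φ

/-- A coloring is `S`-achieved if for every non-isolated vertex there are `s ∈ S`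
and a color appearing exactly `s` times in its open neighborhood. -/
def SAchieved (S : Set ℕ) (G : SimpleGraph V) (φ : V → ℕ) : Prop :=
  ∀ v : V, (G.neighborSet v).Nonempty →
    ∃ s ∈ S, ∃ c : ℕ, {u : V | G.Adj v u ∧ φ u = c}.ncard = s

/-- `G` is `S`-achieved `t`-choosable. -/
def SChoosable (S : Set ℕ) (G : SimpleGraph V) (t : ℕ) : Prop :=
  ∀ L : V → Finset ℕ, (∀ v, t ≤ (L v).card) →
    ∃ φ : V → ℕ, (∀ v, φ v ∈ L v) ∧ Proper G φ ∧ SAchieved S G φ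

/-- `G` is properly `S`-achieved `t`-colorable (colors from `{1,…,t}`). -/
def SColorable (S : Set ℕ) (G : SimpleGraph V) (t : ℕ) : Prop :=
  ∃ φ : V → ℕ, (∀ v, φ v ∈ Finset.Icc 1 t) ∧ Proper G φ ∧ SAchieved S G φ

/-- `G` has a proper conflict-free coloring with colors from `{1,…,t}`. -/
def PCFColorable (G : SimpleGraph V) (t : ℕ) : Prop :=
  ∃ φ : V → ℕ, (∀ v, φ v ∈ Finset.Icc 1 t) ∧ Proper G φ ∧ ConflictFree G φ

/-- The proper conflict-free chromatic number. -/
noncomputable def chiPCF (G : SimpleGraph V) : ℕ := sInf {t : ℕ | PCFColorable G t}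

/-- `(B x : x : ι)` is a tree-decomposition of `G` with underlying tree `T`. -/
structure IsTreeDecomp (G : SimpleGraph V) {ι : Type*} (T : SimpleGraph ι) (B : ι → Set V) :
    Prop where
  tree : T.IsTree
  bags_connected : ∀ vv : V, (T.induce {x : ι | vv ∈ B x}).Connected
  edge_in_bag : ∀ ⦃a b : V⦄, G.Adj a b → ∃ x : ι, a ∈ B x ∧ b ∈ B x

/-- The torso of a tree-decomposition at a node `x`. -/
def torso (G : SimpleGraph V) {ι : Type*} (T : SimpleGraph ι) (B : ι → Set V) (x : ι) :
    SimpleGraph (B x) :=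
  SimpleGraph.fromRel fun a b =>
    G.Adj a b ∨ ∃ y : ι, T.Adj x y ∧ (a : V) ∈ B y ∧ (b : V) ∈ B y

/-- The frame of a tree-decomposition at a node `x`. -/
def frame (G : SimpleGraph V) {ι : Type*} (T : SimpleGraph ι) (B : ι → Set V) (x : ι) :
    Set (Set (B x)) :=
  {s : Set (B x) | ∃ y : ι, T.Adj x y ∧ s = {a : B x | (a : V) ∈ B y}}

/-- A subgraph `H` of `G` is `C`-compatible: every edge of `H` has both ends in some member
of `C`. -/
def Compatible (C : Set (Set V)) (H : SimpleGraph V) : Prop :=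
  ∀ ⦃a b : V⦄, H.Adj a b → ∃ c ∈ C, a ∈ c ∧ b ∈ c

/-- `G` is `(S,C,L,t)`-extendable. -/
def Extendable (S : Set ℕ) (G : SimpleGraph V) (C : Set (Set V)) (L : V → Finset ℕ)
    (t : ℕ) : Prop :=
  ∀ (Wc : Set V), G.IsClique Wc → Wc.ncard ≤ t →
  ∀ (H : SimpleGraph V), H ≤ G → Compatible C H →
  ∀ (φW : V → ℕ), (∀ w ∈ Wc, φW w ∈ L w) →
    (∀ a ∈ Wc, ∀ b ∈ Wc, G.Adj a b → φW a ≠ φW b) →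
  ∀ (f : V → ℕ) (g : V → Bool),
  ∃ φ : V → ℕ, (∀ w, φ w ∈ L w) ∧ Proper G φ ∧ (∀ w ∈ Wc, φ w = φW w) ∧
    (∀ w ∈ Wc, g w = false → ∀ u : V, G.Adj w u → u ∉ Wc → φ u ≠ f w) ∧
    (∀ w : V, (w ∉ Wc ∨ (w ∈ Wc ∧ g w = true)) →
      (((G \ H).neighborSet w = ∅) ∨
        ∃ c : ℕ, {u : V | (G \ H).Adj w u ∧ φ u = c}.ncard ∈ S))

/-- `H` is a minor of `G` (branch-set definition). -/
def IsMinor (H : SimpleGraph W) (G : SimpleGraph V) : Prop :=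
  ∃ ρ : W → Set V,
    (∀ w : W, (G.induce (ρ w)).Connected) ∧
    (Pairwise fun a b => Disjoint (ρ a) (ρ b)) ∧
    ∀ ⦃a b : W⦄, H.Adj a b → ∃ x ∈ ρ a, ∃ y ∈ ρ b, G.Adj x y

/-- The spanning subgraph of `G` whose edges are those between `A` and its complement. -/
def crossGraph (G : SimpleGraph V) (A : Set V) : SimpleGraph V :=
  SimpleGraph.fromRel fun x y => G.Adj x y ∧ x ∈ A ∧ y ∉ A

/-- The odd contraction of `G` determined by the bipartition `{A, Aᶜ}`: contract each
connected component of the spanning bipartite subgraph between `A` and `Aᶜ`. -/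
def oddContract (G : SimpleGraph V) (A : Set V) :
    SimpleGraph ((crossGraph G A).ConnectedComponent) :=
  SimpleGraph.fromRel fun Ct Dt =>
    ∃ x y : V, (crossGraph G A).connectedComponentMk x = Ct ∧
      (crossGraph G A).connectedComponentMk y = Dt ∧ G.Adj x y

/-- `OddContractions G H`: `H` is obtained from `G` by repeatedly applying odd
contractions. -/
inductive OddContractions : ∀ {α : Type u}, SimpleGraph α → ∀ {β : Type u}, SimpleGraph β → Prop
  | refl {α : Type u} (G : SimpleGraph α) : OddContractions G G
  | step {α : Type u} (G : SimpleGraph α) (A : Set α) {β : Type u} {H : SimpleGraph β} :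
      OddContractions (oddContract G A) H → OddContractions G H

/-- `H` is an odd minor of `G`: `H` is isomorphic to a graph obtained from a subgraph of `G`
by repeatedly applying odd contractions. -/
def IsOddMinor (H : SimpleGraph W) (G : SimpleGraph V) : Prop :=
  ∃ (s : Set V) (G₀ : SimpleGraph s), G₀ ≤ G.induce s ∧
    ∃ (β : Type u) (K : SimpleGraph β), OddContractions G₀ K ∧ Nonempty (H ≃g K)

/-- The graph obtained from `H` by subdividing each edge `e` exactly `n e` times, where
`σ` chooses an orientation of each edge. -/
def subdivGraph (H : SimpleGraph W) (σ : H.edgeSet → W × W) (n : H.edgeSet → ℕ) :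
    SimpleGraph (W ⊕ (Σ e : H.edgeSet, Fin (n e))) :=
  SimpleGraph.fromRel fun a b =>
    (∃ (x y : W) (h : H.Adj x y),
        a = Sum.inl x ∧ b = Sum.inl y ∧ n ⟨s(x, y), H.mem_edgeSet.mpr h⟩ = 0) ∨
    (∃ (x : W) (p : Σ e : H.edgeSet, Fin (n e)), a = Sum.inl x ∧ b = Sum.inr p ∧
        ((x = (σ p.1).1 ∧ (p.2 : ℕ) = 0) ∨ (x = (σ p.1).2 ∧ (p.2 : ℕ) = n p.1 - 1))) ∨
    (∃ p q : Σ e : H.edgeSet, Fin (n e), a = Sum.inr p ∧ b = Sum.inr q ∧ p.1 = q.1 ∧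
        (p.2 : ℕ) + 1 = (q.2 : ℕ))

/-- `σ` is a valid orientation of the edges of `H`. -/
def ValidOrientation (H : SimpleGraph W) (σ : H.edgeSet → W × W) : Prop :=
  ∀ e : H.edgeSet, s((σ e).1, (σ e).2) = (e : Sym2 W)

/-- `G` contains a subdivision of `H` as a subgraph. -/
def ContainsSubdivision (H : SimpleGraph W) (G : SimpleGraph V) : Prop :=
  ∃ (σ : H.edgeSet → W × W) (n : H.edgeSet → ℕ), ValidOrientation H σ ∧
    ∃ f : subdivGraph H σ n →g G, Function.Injective f

/-- The strong product of two graphs. -/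
def strongProd {α : Type*} {β : Type*} (A : SimpleGraph α) (B : SimpleGraph β) :
    SimpleGraph (α × β) :=
  SimpleGraph.fromRel fun p q =>
    (A.Adj p.1 q.1 ∧ p.2 = q.2) ∨ (p.1 = q.1 ∧ B.Adj p.2 q.2) ∨
      (A.Adj p.1 q.1 ∧ B.Adj p.2 q.2)


/-- A layering of `G`. -/
def IsLayering (G : SimpleGraph V) (Vl : ℕ → Set V) : Prop :=
  (∀ vv : V, ∃ i : ℕ, vv ∈ Vl i) ∧ (Pairwise fun i j => Disjoint (Vl i) (Vl j)) ∧
  ∀ ⦃a b : V⦄, G.Adj a b → ∃ i : ℕ, a ∈ Vl i ∪ Vl (i + 1) ∧ b ∈ Vl i ∪ Vl (i + 1)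

theorem rtg_mono {α : Type*} {r s : α → α → Prop} (h : ∀ a b, r a b → s a b) {x y : α}
    (hxy : Relation.ReflTransGen r x y) : Relation.ReflTransGen s x y := by
  induction hxy with
  | refl => exact Relation.ReflTransGen.refl
  | tail _ hab ih => exact ih.tail (h _ _ hab)

theorem rtg_symm {α : Type*} {r : α → α → Prop} (h : ∀ a b, r a b → r b a) {x y : α}
    (hxy : Relation.ReflTransGen r x y) : Relation.ReflTransGen r y x := by
  induction hxy with
  | refl => exact Relation.ReflTransGen.refl
  | tail _ hab ih => exact Relation.ReflTransGen.head (h _ _ hab) ih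

/-- Connectedness of a vertex set with respect to a relation. -/
def Conn (r : V → V → Prop) (B : Set V) : Prop :=
  ∀ x ∈ B, ∀ y ∈ B, Relation.ReflTransGen (fun a b => r a b ∧ a ∈ B ∧ b ∈ B) x y

def crossR (G : SimpleGraph V) (σ : V → Bool) (a b : V) : Prop := G.Adj a b ∧ σ a ≠ σ b

def monoR (G : SimpleGraph V) (σ : V → Bool) (a b : V) : Prop := G.Adj a b ∧ σ a = σ b

/-- Clique models whose branch sets are `r`-connected and joined by `e`-edges. -/
structure SModel (r e : V → V → Prop) {ι : Type*} (B : ι → Set V) : Prop where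
  ne : ∀ i, (B i).Nonempty
  conn : ∀ i, Conn r (B i)
  disj : ∀ i j v, v ∈ B i → v ∈ B j → i = j
  adj : ∀ i j, i ≠ j → ∃ x ∈ B i, ∃ y ∈ B j, e x y

def OddModel (G : SimpleGraph V) (t : ℕ) : Prop :=
  ∃ (σ : V → Bool) (B : Fin t → Set V), SModel (crossR G σ) (monoR G σ) B

def BipModel (G : SimpleGraph V) (t : ℕ) : Prop :=
  ∃ (σ : V → Bool) (B : Fin t → Set V), SModel (crossR G σ) (crossR G σ) B

def CliqueModel (G : SimpleGraph V) (t : ℕ) : Prop :=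
  ∃ (B : Fin t → Set V), SModel G.Adj G.Adj B

theorem crossR.symm {G : SimpleGraph V} {σ : V → Bool} {a b : V} (h : crossR G σ a b) :
    crossR G σ b a := ⟨h.1.symm, h.2.symm⟩

theorem monoR.symm {G : SimpleGraph V} {σ : V → Bool} {a b : V} (h : monoR G σ a b) :
    monoR G σ b a := ⟨h.1.symm, h.2.symm⟩

theorem SModel.comp {r e : V → V → Prop} {ι κ : Type*} {B : ι → Set V} (h : SModel r e B)
    (f : κ → ι) (hf : Function.Injective f) : SModel r e (B ∘ f) where
  ne i := h.ne _
  conn i := h.conn _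
  disj i j v hi hj := hf (h.disj _ _ v hi hj)
  adj i j hij := h.adj _ _ (fun e => hij (hf e))

theorem SModel.mono {r e r' e' : V → V → Prop} {ι : Type*} {B : ι → Set V} (h : SModel r e B)
    (hr : ∀ a b, r a b → r' a b) (he : ∀ a b, e a b → e' a b) : SModel r' e' B where
  ne i := h.ne _
  conn i x hx y hy := rtg_mono (fun a b hab => ⟨hr _ _ hab.1, hab.2⟩) (h.conn i x hx y hy)
  disj := h.disj
  adj i j hij := by
    obtain ⟨x, hx, y, hy, hxy⟩ := h.adj i j hij
    exact ⟨x, hx, y, hy, he _ _ hxy⟩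

theorem isOddMinor_of_smodel {V : Type u} {WH : Type v} (H : SimpleGraph WH) (G : SimpleGraph V)
    (σ : V → Bool) (B : WH → Set V) (hB : SModel (crossR G σ) (monoR G σ) B) :
    IsOddMinor H G := by
  classical
  set s : Set V := {v | ∃ w, v ∈ B w} with hs
  have hidx : ∀ v : s, ∃ w, (v : V) ∈ B w := fun v => v.2
  choose idx hidx using hidx
  have huniq : ∀ (v : s) w, (v : V) ∈ B w → idx v = w := fun v w h => hB.disj _ _ _ (hidx v) h
  let G₀ : SimpleGraph s :=
    { Adj := fun a b => (idx a = idx b ∧ crossR G σ a b) ∨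
        (H.Adj (idx a) (idx b) ∧ monoR G σ a b)
      symm := ⟨fun a b h => by
        rcases h with h | h
        · exact Or.inl ⟨h.1.symm, h.2.symm⟩
        · exact Or.inr ⟨h.1.symm, h.2.symm⟩⟩
      loopless := ⟨fun a h => by
        rcases h with h | h
        · exact h.2.1.ne rfl
        · exact h.2.1.ne rfl⟩ }
  let A : Set s := {a | σ a = true}
  have hcross : ∀ a b, (crossGraph G₀ A).Adj a b ↔ idx a = idx b ∧ crossR G σ a b := by
    intro a b
    simp only [crossGraph, SimpleGraph.fromRel_adj, A, G₀, Set.mem_setOf_eq]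
    constructor
    · rintro ⟨hne, ⟨h, h1, h2⟩ | ⟨h, h1, h2⟩⟩
      · rcases h with h | h
        · exact h
        · exact absurd (h.2.2.symm.trans h1) h2
      · rcases h with h | h
        · exact ⟨h.1.symm, h.2.symm⟩
        · exact absurd (h.2.2.symm.trans h1) h2
    · rintro ⟨h1, h2⟩
      refine ⟨fun h => h2.1.ne (by rw [h]), ?_⟩
      have h3 := h2.2
      cases ha : σ a <;> cases hb : σ b <;> simp_all
      exact h2.symm
  have hreach1 : ∀ a b, (crossGraph G₀ A).Reachable a b → idx a = idx b := by
    intro a b h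
    rw [SimpleGraph.reachable_iff_reflTransGen] at h
    induction h with
    | refl => rfl
    | tail _ h ih => exact ih.trans ((hcross _ _).1 h).1
  have hreach2 : ∀ a b, idx a = idx b → (crossGraph G₀ A).Reachable a b := by
    intro a b h
    have h1 := hB.conn (idx a) a (hidx a) b (h ▸ hidx b)
    have key : ∀ y : V, Relation.ReflTransGen
        (fun x y => crossR G σ x y ∧ x ∈ B (idx a) ∧ y ∈ B (idx a)) (a : V) y →
        ∀ hy : y ∈ s, (crossGraph G₀ A).Reachable a ⟨y, hy⟩ := by
      intro y hy
      induction hy with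
      | refl => intro _; exact SimpleGraph.Reachable.refl _
      | tail _ h ih =>
        intro hy
        have := ih ⟨_, h.2.1⟩
        refine this.trans (SimpleGraph.Adj.reachable ?_)
        rw [hcross]
        exact ⟨(huniq _ _ h.2.1).trans (huniq _ _ h.2.2).symm, h.1⟩
    exact key b h1 b.2
  have hrep : ∀ w, ∃ v : s, idx v = w := fun w => by
    obtain ⟨v, hv⟩ := hB.ne w
    exact ⟨⟨v, w, hv⟩, huniq _ _ hv⟩
  choose rep hrep using hrep
  let f : WH → (crossGraph G₀ A).ConnectedComponent :=
    fun w => (crossGraph G₀ A).connectedComponentMk (rep w)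
  have hf : ∀ a w, (crossGraph G₀ A).connectedComponentMk a = f w ↔ idx a = w := by
    intro a w
    simp only [f, SimpleGraph.ConnectedComponent.eq]
    constructor
    · intro h; rw [hreach1 _ _ h, hrep]
    · intro h; exact hreach2 _ _ (by rw [hrep, h])
  have hbij : Function.Bijective f := by
    constructor
    · intro w w' h
      have := (hf (rep w) w').1 h
      rw [← this, hrep]
    · intro c
      induction c using SimpleGraph.ConnectedComponent.ind with
      | h a => exact ⟨idx a, ((hf a (idx a)).2 rfl).symm⟩
  refine ⟨s, G₀, ?_, _, oddContract G₀ A, OddContractions.step G₀ A (OddContractions.refl _), ⟨?_⟩⟩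
  · intro a b h
    rcases h with h | h
    · exact h.2.1
    · exact h.2.1
  · refine ⟨Equiv.ofBijective f hbij, ?_⟩
    intro w w'
    simp only [Equiv.ofBijective_apply, oddContract, SimpleGraph.fromRel_adj]
    constructor
    · rintro ⟨hne, ⟨x, y, hx, hy, h⟩ | ⟨x, y, hx, hy, h⟩⟩
      · rw [hf] at hx hy
        rcases h with h | h
        · exact absurd (congrArg f (hx.symm.trans (h.1.trans hy))) hne
        · rw [← hx, ← hy]; exact h.1
      · rw [hf] at hx hy
        rcases h with h | h
        · exact absurd (congrArg f (hx.symm.trans (h.1.trans hy))) hne.symm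
        · rw [← hx, ← hy]; exact h.1.symm
    · intro h
      refine ⟨fun e => h.ne (hbij.1 e), Or.inl ?_⟩
      obtain ⟨x, hx, y, hy, hxy⟩ := hB.adj w w' h.ne
      refine ⟨⟨x, w, hx⟩, ⟨y, w', hy⟩, ?_, ?_, Or.inr ⟨?_, hxy⟩⟩
      · rw [hf]; exact huniq _ _ hx
      · rw [hf]; exact huniq _ _ hy
      · rw [huniq ⟨x, w, hx⟩ _ hx, huniq ⟨y, w', hy⟩ _ hy]; exact h

theorem isOddMinor_of_oddModel {V : Type u} {WH : Type v} [Fintype WH] (H : SimpleGraph WH)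
    (G : SimpleGraph V) (h : OddModel G (Fintype.card WH)) : IsOddMinor H G := by
  obtain ⟨σ, B, hB⟩ := h
  exact isOddMinor_of_smodel H G σ _ (hB.comp (Fintype.equivFin WH) (Fintype.equivFin WH).injective)

theorem exists_levels (G : SimpleGraph V) : ∃ (root : V → V) (lev : V → ℕ),
    (∀ u v, G.Adj u v → root u = root v) ∧ (∀ u v, G.Adj u v → lev v ≤ lev u + 1) ∧
    (∀ v, lev v = 0 → root v = v) ∧
    (∀ v, lev v ≠ 0 → ∃ u, G.Adj u v ∧ lev v = lev u + 1) := by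
  classical
  let root : V → V := fun v => (G.connectedComponentMk v).out
  have hroot : ∀ v, G.Reachable (root v) v := fun v => by
    rw [← SimpleGraph.ConnectedComponent.eq]
    exact Quot.out_eq _
  have hadj : ∀ u v, G.Adj u v → root u = root v := by
    intro u v h
    have : G.connectedComponentMk u = G.connectedComponentMk v :=
      SimpleGraph.ConnectedComponent.eq.2 h.reachable
    simp only [root, this]
  refine ⟨root, fun v => G.dist (root v) v, hadj, ?_, ?_, ?_⟩
  · intro u v h
    obtain ⟨p, hp⟩ := (hroot u).exists_walk_length_eq_dist
    have h1 := SimpleGraph.dist_le (p.concat h)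
    rw [SimpleGraph.Walk.length_concat, hp] at h1
    show G.dist (root v) v ≤ G.dist (root u) u + 1
    rw [← hadj u v h]
    exact h1
  · intro v h
    exact (hroot v).dist_eq_zero_iff.1 h
  · intro v h
    obtain ⟨p, hp⟩ := (hroot v).symm.exists_walk_length_eq_dist
    generalize hr : root v = r at p hp
    cases hp' : p with
    | nil =>
      exfalso
      apply h
      show G.dist (root v) v = 0
      rw [hr, SimpleGraph.dist_self]
    | cons e q =>
      rename_i u
      subst hr
      refine ⟨u, e.symm, ?_⟩
      have h2 : G.dist v (root v) = q.length + 1 := by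
        rw [← hp, hp']; rfl
      have h1 := SimpleGraph.dist_le q.reverse
      rw [SimpleGraph.Walk.length_reverse] at h1
      have hru : root u = root v := hadj u v e.symm
      obtain ⟨p', hp'⟩ := (hroot u).exists_walk_length_eq_dist
      have h3 := SimpleGraph.dist_le (p'.concat e.symm)
      rw [SimpleGraph.Walk.length_concat, hp'] at h3
      have h4 : G.dist (root u) v = G.dist v (root v) := by rw [hru, SimpleGraph.dist_comm]
      have h5 : G.dist (root u) u ≤ q.length := by rw [hru]; exact h1
      show G.dist (root v) v = G.dist (root u) u + 1
      rw [SimpleGraph.dist_comm]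
      omega

theorem rtg_inv {α β : Type*} {r : α → α → Prop} (f : α → β) (h : ∀ a b, r a b → f a = f b)
    {x y : α} (hxy : Relation.ReflTransGen r x y) : f x = f y := by
  induction hxy with
  | refl => rfl
  | tail _ hab ih => exact ih.trans (h _ _ hab)

theorem SModel.inv {r e : V → V → Prop} {ι β : Type*} {B : ι → Set V} (h : SModel r e B)
    (f : V → β) (hr : ∀ a b, r a b → f a = f b) (he : ∀ a b, e a b → f a = f b)
    {i j : ι} {x y : V} (hx : x ∈ B i) (hy : y ∈ B j) : f x = f y := by
  have h1 : ∀ i x y, x ∈ B i → y ∈ B i → f x = f y := fun i x y hx hy =>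
    rtg_inv f (fun a b hab => hr a b hab.1) (h.conn i x hx y hy)
  by_cases hij : i = j
  · subst hij; exact h1 i x y hx hy
  · obtain ⟨a, ha, b, hb, hab⟩ := h.adj i j hij
    exact (h1 i x a hx ha).trans ((he a b hab).trans (h1 j b y hb hy))

theorem cliqueModel_one (G : SimpleGraph V) (v : V) : CliqueModel G 1 :=
  ⟨fun _ => {v}, ⟨fun _ => ⟨v, rfl⟩, fun _ x hx y hy => by
    rw [Set.mem_singleton_iff.1 hx, Set.mem_singleton_iff.1 hy], fun i j _ _ _ => Subsingleton.elim _ _,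
    fun i j h => absurd (Subsingleton.elim _ _) h⟩⟩

theorem cliqueModel_le {G : SimpleGraph V} {m n : ℕ} (h : m ≤ n) (hG : CliqueModel G n) :
    CliqueModel G m := by
  obtain ⟨B, hB⟩ := hG
  exact ⟨_, hB.comp (Fin.castLE h) (Fin.castLE_injective h)⟩

theorem cliqueModel_two (G : SimpleGraph V) (a b : V) (hab : G.Adj a b) : CliqueModel G 2 := by
  refine ⟨fun i => if i = 0 then {a} else {b}, ⟨?_, ?_, ?_, ?_⟩⟩
  · intro i; split_ifs <;> simp
  · intro i x hx y hy
    have : x = y := by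
      split_ifs at hx hy <;> simp_all
    rw [this]
  · intro i j v hi hj
    have := hab.ne
    split_ifs at hi hj with h1 h2 h2
    · rw [h1, h2]
    · simp_all
    · simp_all
    · omega
  · intro i j hij
    by_cases h1 : i = 0
    · have h2 : j ≠ 0 := fun h => hij (h1.trans h.symm)
      exact ⟨a, by simp [h1], b, by simp [h2], hab⟩
    · have h2 : j = 0 := by omega
      exact ⟨b, by simp [h1], a, by simp [h2], hab.symm⟩

theorem exists_colorable_bound (n : ℕ) : ∃ C : ℕ, ∀ (V : Type u) (G : SimpleGraph V),
    ¬ CliqueModel G (n + 1) → G.Colorable C := by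
  induction n with
  | zero =>
    refine ⟨0, fun V G h => ?_⟩
    have : IsEmpty V := ⟨fun v => h (cliqueModel_one G v)⟩
    exact ⟨SimpleGraph.Coloring.mk (fun v => isEmptyElim v) (fun {v} => isEmptyElim v)⟩
  | succ n ih =>
    rcases Nat.eq_zero_or_pos n with hn | hn
    · subst hn
      refine ⟨1, fun V G h => ⟨SimpleGraph.Coloring.mk (fun _ => 0) ?_⟩⟩
      intro a b hab
      exact absurd (cliqueModel_two G a b hab) h
    obtain ⟨C, hC⟩ := ih
    refine ⟨Fintype.card (Fin C × Bool), fun V G h => ?_⟩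
    obtain ⟨root, lev, h1, h2, h3, h4⟩ := exists_levels G
    let G' : SimpleGraph V :=
      { Adj := fun a b => G.Adj a b ∧ lev a = lev b
        symm := ⟨fun a b h => ⟨h.1.symm, h.2.symm⟩⟩
        loopless := ⟨fun a h => h.1.ne rfl⟩ }
    have hG' : ¬ CliqueModel G' (n + 1) := by
      rintro ⟨B, hB⟩
      apply h
      obtain ⟨x0, hx0⟩ := hB.ne 0
      have hlev : ∀ j y, y ∈ B j → lev y = lev x0 := fun j y hy =>
        (hB.inv lev (fun a b hab => hab.2) (fun a b hab => hab.2) hy hx0)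
      have hroot : ∀ j y, y ∈ B j → root y = root x0 := fun j y hy =>
        (hB.inv root (fun a b hab => h1 a b hab.1) (fun a b hab => h1 a b hab.1) hy hx0)
      have hl0 : lev x0 ≠ 0 := by
        intro hl
        obtain ⟨x1, hx1⟩ := hB.ne ⟨1, by omega⟩
        have e1 := h3 x0 hl
        have e2 := h3 x1 ((hlev _ _ hx1).trans hl)
        have : x0 = x1 := by rw [← e1, ← e2, hroot _ _ hx1]
        subst this
        have := hB.disj _ _ _ hx0 hx1
        simp [Fin.ext_iff] at this
      let E : Set V := {v | lev v < lev x0 ∧ root v = root x0}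
      have hE : ∀ l v, lev v = l → v ∈ E → Relation.ReflTransGen
          (fun a b => G.Adj a b ∧ a ∈ E ∧ b ∈ E) v (root x0) := by
        intro l
        induction l with
        | zero =>
          intro v hv hvE
          rw [← hvE.2, h3 v hv]
        | succ l ihl =>
          intro v hv hvE
          obtain ⟨u, hu, hlu⟩ := h4 v (by omega)
          have huE : u ∈ E := ⟨lt_trans (by omega) hvE.1, (h1 u v hu).trans hvE.2⟩
          exact Relation.ReflTransGen.head ⟨hu.symm, hvE, huE⟩ (ihl u (by omega) huE)
      have hEadj : ∀ j, ∃ x ∈ E, ∃ y ∈ B j, G.Adj x y := by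
        intro j
        obtain ⟨y, hy⟩ := hB.ne j
        obtain ⟨u, hu, hlu⟩ := h4 y (by rw [hlev j y hy]; exact hl0)
        have := hlev j y hy
        exact ⟨u, ⟨by omega, (h1 u y hu).trans (hroot j y hy)⟩, y, hy, hu⟩
      have hdisj : ∀ j v, v ∈ E → v ∈ B j → False := by
        intro j v hv hj
        have := hlev j v hj
        have := hv.1
        omega
      refine ⟨Fin.cons E B, ⟨?_, ?_, ?_, ?_⟩⟩
      · intro i
        induction i using Fin.cases with
        | zero => obtain ⟨x, hx, _⟩ := hEadj 0; exact ⟨x, hx⟩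
        | succ i => exact hB.ne i
      · intro i
        induction i using Fin.cases with
        | zero =>
          intro x hx y hy
          exact (hE _ x rfl hx).trans
            (rtg_symm (fun a b hab => ⟨hab.1.symm, hab.2.2, hab.2.1⟩) (hE _ y rfl hy))
        | succ i =>
          intro x hx y hy
          exact rtg_mono (fun a b hab => ⟨hab.1.1, hab.2⟩) (hB.conn i x hx y hy)
      · intro i j v hi hj
        induction i using Fin.cases with
        | zero =>
          induction j using Fin.cases with
          | zero => rfl
          | succ j => exact (hdisj j v hi hj).elim
        | succ i =>
          induction j using Fin.cases with
          | zero => exact (hdisj i v hj hi).elim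
          | succ j => exact congrArg _ (hB.disj i j v hi hj)
      · intro i j hij
        induction i using Fin.cases with
        | zero =>
          induction j using Fin.cases with
          | zero => exact absurd rfl hij
          | succ j => exact hEadj j
        | succ i =>
          induction j using Fin.cases with
          | zero =>
            obtain ⟨x, hx, y, hy, hxy⟩ := hEadj i
            exact ⟨y, hy, x, hx, hxy.symm⟩
          | succ j =>
            obtain ⟨x, hx, y, hy, hxy⟩ := hB.adj i j (fun e => hij (congrArg _ e))
            exact ⟨x, hx, y, hy, hxy.1⟩
    obtain ⟨χ⟩ := hC V G' hG'
    let φ : G.Coloring (Fin C × Bool) := SimpleGraph.Coloring.mk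
      (fun v => (χ v, decide (lev v % 2 = 0))) (by
        intro a b hab heq
        simp only [Prod.mk.injEq, decide_eq_decide] at heq
        have e1 := h2 a b hab
        have e2 := h2 b a hab.symm
        have : lev a = lev b := by omega
        exact χ.valid (v := a) (w := b) ⟨hab, this⟩ heq.1)
    exact φ.colorable

/-- contraction along a retraction -/
def contr (G : SimpleGraph V) (p : V → V) : SimpleGraph V where
  Adj a b := a ≠ b ∧ ∃ a' b', p a' = a ∧ p b' = b ∧ G.Adj a' b'
  symm := ⟨fun a b h => by
    obtain ⟨h1, a', b', ha, hb, h⟩ := h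
    exact ⟨h1.symm, b', a', hb, ha, h.symm⟩⟩
  loopless := ⟨fun a h => h.1 rfl⟩

theorem cliqueModel_of_contr (G : SimpleGraph V) (p : V → V) (hp : ∀ v, p (p v) = p v)
    (hadj : ∀ v, p v = v ∨ G.Adj v (p v)) (n : ℕ) (hn : 2 ≤ n)
    (h : CliqueModel (contr G p) n) : CliqueModel G n := by
  obtain ⟨B, hB⟩ := h
  have himg : ∀ j x, x ∈ B j → p x = x := by
    intro j x hx
    have : ∃ i, j ≠ i := by
      rcases Nat.eq_zero_or_pos j.1 with h0 | h0
      · exact ⟨⟨1, by omega⟩, fun h => by rw [Fin.ext_iff] at h; simp at h; omega⟩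
      · exact ⟨⟨0, by omega⟩, fun h => by rw [Fin.ext_iff] at h; simp at h; omega⟩
    obtain ⟨i, hi⟩ := this
    obtain ⟨a, ha, b, hb, _, a', b', ha', hb', _⟩ := hB.adj j i hi
    have haa : p a = a := by rw [← ha', hp]
    have := hB.conn j a ha x hx
    cases this with
    | refl => exact haa
    | tail _ h =>
      obtain ⟨⟨_, c', d', hc, hd, _⟩, _⟩ := h
      rw [← hd, hp]
  refine ⟨fun j => {v | p v ∈ B j}, ⟨?_, ?_, ?_, ?_⟩⟩
  · intro j
    obtain ⟨x, hx⟩ := hB.ne j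
    exact ⟨x, by simpa [himg j x hx] using hx⟩
  · intro j
    have hto : ∀ x, p x ∈ B j → Relation.ReflTransGen
        (fun a b => G.Adj a b ∧ a ∈ {v | p v ∈ B j} ∧ b ∈ {v | p v ∈ B j}) x (p x) := by
      intro x hx
      rcases hadj x with h | h
      · rw [h]
      · refine Relation.ReflTransGen.single ⟨h, hx, ?_⟩
        show p (p x) ∈ B j
        rw [hp]; exact hx
    have hsym := fun {x y : V} => rtg_symm (r := fun a b => G.Adj a b ∧ a ∈ {v | p v ∈ B j} ∧ b ∈ {v | p v ∈ B j})
      (fun a b hab => ⟨hab.1.symm, hab.2.2, hab.2.1⟩) (x := x) (y := y)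
    intro x hx y hy
    have key : Relation.ReflTransGen
        (fun a b => G.Adj a b ∧ a ∈ {v | p v ∈ B j} ∧ b ∈ {v | p v ∈ B j}) (p x) (p y) := by
      have := hB.conn j (p x) hx (p y) hy
      generalize p y = z at this
      induction this with
      | refl => exact Relation.ReflTransGen.refl
      | tail _ h ih =>
        obtain ⟨⟨_, c', d', hc, hd, hcd⟩, hb, hb'⟩ := h
        have e1 := hto c' (by rw [hc]; exact hb)
        have e2 := hto d' (by rw [hd]; exact hb')
        rw [hc] at e1
        rw [hd] at e2
        refine ih.trans ((hsym e1).trans (Relation.ReflTransGen.trans ?_ e2))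
        refine Relation.ReflTransGen.single ⟨hcd, ?_, ?_⟩
        · show p c' ∈ B j
          rw [hc]; exact hb
        · show p d' ∈ B j
          rw [hd]; exact hb'
    exact (hto x hx).trans (key.trans (hsym (hto y hy)))
  · intro i j v hi hj
    exact hB.disj i j _ hi hj
  · intro i j hij
    obtain ⟨a, ha, b, hb, _, a', b', ha', hb', h⟩ := hB.adj i j hij
    exact ⟨a', by rw [← ha'] at ha; exact ha, b', by rw [← hb'] at hb; exact hb, h⟩

theorem exists_pcf_bound (n : ℕ) : ∃ L : ℕ, ∀ (V : Type u) (G : SimpleGraph V),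
    ¬ CliqueModel G n → ∃ φ : V → ℕ, (∀ v, φ v < L) ∧ (∀ a b, G.Adj a b → φ a ≠ φ b) ∧
      ∀ v w₀, G.Adj v w₀ → ∃ w, G.Adj v w ∧ ∀ u, G.Adj v u → φ u = φ w → u = w := by
  classical
  obtain ⟨C, hC⟩ := exists_colorable_bound.{u} (n + 1)
  refine ⟨Fintype.card (Fin C × (Fin C → Fin C)), fun V G h => ?_⟩
  have h' : ¬ CliqueModel G (n + 1 + 1) := fun hh => h (cliqueModel_le (by omega) hh)
  obtain ⟨χ⟩ := hC V G h'
  have hw : ∀ u, ∃ w, (∃ w₀, G.Adj u w₀) → G.Adj u w := fun u => by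
    by_cases hu : ∃ w₀, G.Adj u w₀
    · exact ⟨hu.choose, fun _ => hu.choose_spec⟩
    · exact ⟨u, fun h => absurd h hu⟩
  choose w hw using hw
  let p : Fin C → V → V := fun i u => if χ u = i ∧ ∃ w₀, G.Adj u w₀ then w u else u
  have hp1 : ∀ i u, χ u ≠ i → p i u = u := fun i u hu => if_neg (fun h => hu h.1)
  have hp2 : ∀ i u, χ u = i → (∃ w₀, G.Adj u w₀) → p i u = w u := fun i u h1 h2 => if_pos ⟨h1, h2⟩
  have hp3 : ∀ i u, p i u = u ∨ (p i u = w u ∧ G.Adj u (w u) ∧ χ u = i) := by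
    intro i u
    by_cases hu : χ u = i ∧ ∃ w₀, G.Adj u w₀
    · exact Or.inr ⟨if_pos hu, hw u hu.2, hu.1⟩
    · exact Or.inl (if_neg hu)
  have hψ : ∀ i, (contr G (p i)).Colorable C := by
    intro i
    apply hC
    intro hh
    refine h' (cliqueModel_of_contr G (p i) ?_ ?_ _ (by omega) hh)
    · intro v
      rcases hp3 i v with h | ⟨h1, h2, h3⟩
      · rw [h, h]
      · rw [h1]
        exact hp1 i _ (fun e => χ.valid h2 (h3.trans e.symm))
    · intro v
      rcases hp3 i v with h | ⟨h1, h2, h3⟩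
      · exact Or.inl h
      · right; rw [h1]; exact h2
  let ψ : ∀ i, (contr G (p i)).Coloring (Fin C) := fun i => (hψ i).some
  let e := Fintype.equivFin (Fin C × (Fin C → Fin C))
  refine ⟨fun v => e (χ v, fun i => ψ i v), fun v => (e _).2, ?_, ?_⟩
  · intro a b hab heq
    have := e.injective (Fin.ext heq)
    simp only [Prod.mk.injEq] at this
    exact χ.valid hab this.1
  · intro v w₀ hv
    have hvw := hw v ⟨w₀, hv⟩
    refine ⟨w v, hvw, fun u hu heq => ?_⟩
    have := e.injective (Fin.ext heq)
    simp only [Prod.mk.injEq] at this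
    by_contra hne
    refine (ψ (χ v)).valid (v := u) (w := w v) ?_ (congrFun this.2 (χ v))
    refine ⟨hne, u, v, hp1 _ _ (fun e => χ.valid hu e.symm), hp2 _ _ rfl ⟨w₀, hv⟩, hu.symm⟩

/-- flipping the copy -/
def flp (x : V × Bool) : V × Bool := (x.1, !x.2)

@[simp] theorem flp_flp (x : V × Bool) : flp (flp x) = x := by simp [flp]
@[simp] theorem flp_fst (x : V × Bool) : (flp x).1 = x.1 := rfl
@[simp] theorem flp_snd (x : V × Bool) : (flp x).2 = !x.2 := rfl
theorem flp_ne (x : V × Bool) : flp x ≠ x := fun h => by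
  have := congrArg Prod.snd h
  simp at this
theorem eq_or_flp {x y : V × Bool} (h : x.1 = y.1) : x = y ∨ x = flp y := by
  by_cases h2 : x.2 = y.2
  · exact Or.inl (Prod.ext h h2)
  · right
    refine Prod.ext h ?_
    simp only [flp_snd]
    cases hx : x.2 <;> cases hy : y.2 <;> simp_all

/-- double cover relation: `E0` edges keep the copy, `E1` edges switch it -/
def cov (E0 E1 : V → V → Prop) (x y : V × Bool) : Prop :=
  (E0 x.1 y.1 ∧ x.2 = y.2) ∨ (E1 x.1 y.1 ∧ x.2 ≠ y.2)

theorem cov_flp {E0 E1 : V → V → Prop} {x y : V × Bool} (h : cov E0 E1 x y) :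
    cov E0 E1 (flp x) (flp y) := by
  rcases h with h | h
  · exact Or.inl ⟨h.1, by simp [h.2]⟩
  · exact Or.inr ⟨h.1, by simpa using h.2⟩

theorem cov_symm {E0 E1 : V → V → Prop} (h0 : ∀ a b, E0 a b → E0 b a)
    (h1 : ∀ a b, E1 a b → E1 b a) {x y : V × Bool} (h : cov E0 E1 x y) : cov E0 E1 y x := by
  rcases h with h | h
  · exact Or.inl ⟨h0 _ _ h.1, h.2.symm⟩
  · exact Or.inr ⟨h1 _ _ h.1, h.2.symm⟩

theorem flat_uniq {α β : Type*} (f : α → β) {Ps : List (List α)} (h : (Ps.flatten.map f).Nodup)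
    {p p' : List α} (hp : p ∈ Ps) (hp' : p' ∈ Ps) {x y : α} (hx : x ∈ p) (hy : y ∈ p')
    (hxy : f x = f y) : p = p' ∧ x = y := by
  have e : x = y := List.inj_on_of_nodup_map h (List.mem_flatten_of_mem hp hx)
    (List.mem_flatten_of_mem hp' hy) hxy
  subst e
  refine ⟨?_, rfl⟩
  have h2 := (List.nodup_flatten.1 h.of_map).2
  by_contra hne
  have h3 : ∀ (l : List (List α)), l.Pairwise List.Disjoint → p ∈ l → p' ∈ l → False := by
    intro l hl h1 h2
    rcases eq_or_ne p p' with h | h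
    · exact hne h
    · have hs : Std.Symm (List.Disjoint (α := α)) := ⟨fun _ _ h => h.symm⟩
      exact (hl.forall h1 h2 h) hx hy
  exact h3 Ps h2 hp hp'

structure ExPath (E0 E1 : V → V → Prop) (Ω : Finset (V × Bool)) (p : List (V × Bool)) : Prop where
  chain : p.IsChain (cov E0 E1)
  ne : p ≠ []
  head : ∀ h, p.head? = some h → h ∈ Ω ∧ flp h ∉ Ω
  last : ∀ l, p.getLast? = some l → flp l ∈ Ω ∧ l ∉ Ω
  mem : ∀ x ∈ p, x ∈ Ω ∨ flp x ∈ Ω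

theorem extraction [DecidableEq V] (E0 E1 : V → V → Prop) (h0 : ∀ a b, E0 a b → E0 b a)
    (h1 : ∀ a b, E1 a b → E1 b a) (i0 : ∀ a, ¬ E0 a a) (i1 : ∀ a, ¬ E1 a a)
    (μ : V × Bool → V × Bool) (n : ℕ) : ∀ Ω : Finset (V × Bool), Ω.card = n →
    (∀ x ∈ Ω, μ x ∈ Ω ∧ μ (μ x) = x ∧ (cov E0 E1 x (flp (μ x)) ∨ μ x = flp x)) →
    ∃ Ps : List (List (V × Bool)), (∀ p ∈ Ps, ExPath E0 E1 Ω p) ∧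
      (Ps.flatten.map Prod.fst).Nodup ∧
      ∀ x ∈ Ω, flp x ∉ Ω → ∃ p ∈ Ps, p.head? = some x ∨ p.getLast? = some (flp x) := by
  induction n using Nat.strong_induction_on with
  | _ n ih =>
  intro Ω hn hμ
  by_cases hR : ∃ x ∈ Ω, flp x ∉ Ω
  swap
  · push Not at hR
    exact ⟨[], by simp, by simp, fun x hx hx' => absurd (hR x hx) hx'⟩
  obtain ⟨x, hx, hfx⟩ := hR
  obtain ⟨hy, hyx, hxy⟩ := hμ x hx
  set y := μ x with hydef
  have hyf : y ≠ flp x := fun e => hfx (e ▸ hy)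
  have hcov : cov E0 E1 x (flp y) := hxy.resolve_right hyf
  have hfst : x.1 ≠ y.1 := by
    intro e
    rcases hcov with h | h
    · exact i0 x.1 (by have := h.1; rwa [flp_fst, ← e] at this)
    · exact i1 x.1 (by have := h.1; rwa [flp_fst, ← e] at this)
  have hne : y ≠ x := fun e => hfst (by rw [e])
  set Ω' := (Ω.erase x).erase y with hΩ'
  have hmem : ∀ z, z ∈ Ω' ↔ z ≠ y ∧ z ≠ x ∧ z ∈ Ω := by
    intro z; simp [hΩ']
  have hlt : Ω'.card < n := by
    rw [← hn]
    refine Finset.card_lt_card ⟨fun z hz => ((hmem z).1 hz).2.2, fun h => ?_⟩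
    exact ((hmem x).1 (h hx)).2.1 rfl
  obtain ⟨Ps, hPs, hnd, hcovr⟩ := ih _ hlt Ω' rfl (by
    intro z hz
    obtain ⟨h1, h2, h3⟩ := (hmem z).1 hz
    obtain ⟨e1, e2, e3⟩ := hμ z h3
    refine ⟨(hmem _).2 ⟨?_, ?_, e1⟩, e2, e3⟩
    · intro e; rw [e, hyx] at e2; exact h2 e2.symm
    · intro e; rw [e] at e2; exact h1 e2.symm)
  have hxnot : ∀ p ∈ Ps, ∀ z ∈ p, z.1 ≠ x.1 := by
    intro p hp z hz e
    have h1 : x ∉ Ω' := fun h => ((hmem x).1 h).2.1 rfl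
    have h2 : flp x ∉ Ω' := fun h => hfx ((hmem _).1 h).2.2
    rcases eq_or_flp e with e | e <;> subst e <;> rcases (hPs p hp).mem _ hz with h | h <;>
      simp_all
  have hcov' : cov E0 E1 y (flp x) := by
    have := cov_symm h0 h1 (cov_flp hcov)
    simpa using this
  by_cases hfy : flp y ∈ Ω
  swap
  · have hynot : ∀ p ∈ Ps, ∀ z ∈ p, z.1 ≠ y.1 := by
      intro p hp z hz e
      have h1 : y ∉ Ω' := fun h => ((hmem y).1 h).1 rfl
      have h2 : flp y ∉ Ω' := fun h => hfy ((hmem _).1 h).2.2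
      rcases eq_or_flp e with e | e <;> rw [e] at hz <;> rcases (hPs p hp).mem _ hz with h | h
      · exact h1 h
      · exact h2 h
      · exact h2 h
      · rw [flp_flp] at h; exact h1 h
    have hflip : ∀ z, z ∈ Ω → flp z ∉ Ω' → flp z ∉ Ω := by
      intro z hz hz' hz''
      apply hz'
      refine (hmem _).2 ⟨?_, ?_, hz''⟩
      · intro e; rw [← e, flp_flp] at hfy; exact hfy hz
      · intro e; rw [← e, flp_flp] at hfx; exact hfx hz
    refine ⟨[x, flp y] :: Ps, ?_, ?_, ?_⟩
    · intro p hp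
      rcases List.mem_cons.1 hp with hp | hp
      · subst hp
        refine ⟨by simpa using hcov, by simp, ?_, ?_, ?_⟩
        · intro h e; simp at e; subst e; exact ⟨hx, hfx⟩
        · intro h e; simp at e; subst e; exact ⟨by simpa using hy, hfy⟩
        · intro z hz
          simp at hz
          rcases hz with rfl | rfl
          · exact Or.inl hx
          · right; simpa using hy
      · have := hPs p hp
        refine ⟨this.chain, this.ne, ?_, ?_, ?_⟩
        · intro h e
          have := this.head h e
          have h1 := ((hmem _).1 this.1).2.2
          exact ⟨h1, hflip h h1 this.2⟩
        · intro h e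
          have := this.last h e
          have h1 := ((hmem _).1 this.1).2.2
          refine ⟨h1, ?_⟩
          have := hflip (flp h) h1 (by simpa using this.2)
          simpa using this
        · intro z hz
          rcases this.mem z hz with h | h
          · exact Or.inl ((hmem _).1 h).2.2
          · exact Or.inr ((hmem _).1 h).2.2
    · simp only [List.flatten_cons, List.map_append, List.map_cons, List.map_nil, flp_fst]
      rw [List.nodup_append]
      refine ⟨by simpa using hfst, hnd, ?_⟩
      intro a ha b hb e
      subst e
      obtain ⟨z, hz, hza⟩ := List.mem_map.1 hb
      obtain ⟨p, hp, hzp⟩ := List.mem_flatten.1 hz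
      simp at ha
      rcases ha with ha | ha
      · exact hxnot p hp z hzp (hza.trans ha)
      · exact hynot p hp z hzp (hza.trans ha)
    · intro z hz hfz
      by_cases hzx : z = x
      · exact ⟨_, List.mem_cons_self, Or.inl (by simp [hzx])⟩
      by_cases hzy : z = y
      · exact ⟨_, List.mem_cons_self, Or.inr (by simp [hzy])⟩
      obtain ⟨p, hp, h⟩ := hcovr z ((hmem z).2 ⟨hzy, hzx, hz⟩) (fun h => hfz ((hmem _).1 h).2.2)
      exact ⟨p, List.mem_cons_of_mem _ hp, h⟩
  · have hfy' : flp y ∈ Ω' := (hmem _).2 ⟨flp_ne y, fun e => hfst (by rw [← e]; rfl), hfy⟩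
    have hyn : y ∉ Ω' := fun h => ((hmem y).1 h).1 rfl
    obtain ⟨p, hp, hpy⟩ := hcovr (flp y) hfy' (by simpa using hyn)
    rw [flp_flp] at hpy
    have hflip : ∀ z, z ∈ Ω → z ≠ flp y → flp z ∉ Ω' → flp z ∉ Ω := by
      intro z hz hzy hz' hz''
      apply hz'
      refine (hmem _).2 ⟨?_, ?_, hz''⟩
      · intro e; apply hzy; rw [← e, flp_flp]
      · intro e; rw [← e, flp_flp] at hfx; exact hfx hz
    obtain ⟨A, B, hAB⟩ := List.append_of_mem hp
    have hperm : Ps.Perm (p :: (A ++ B)) := by rw [hAB]; exact List.perm_middle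
    have hmemPs : ∀ p', p' ∈ Ps ↔ p' = p ∨ p' ∈ A ++ B := fun p' => by
      rw [hperm.mem_iff]; simp
    have hnd' : ((p :: (A ++ B)).flatten.map Prod.fst).Nodup :=
      ((hperm.flatten.map Prod.fst).nodup_iff).1 hnd
    have hyp : ∃ z ∈ p, z.1 = y.1 := by
      rcases hpy with h | h
      · exact ⟨flp y, List.mem_of_mem_head? h, rfl⟩
      · exact ⟨y, List.mem_of_mem_getLast? h, rfl⟩
    have hother : ∀ p' ∈ A ++ B, ∀ z ∈ p', z.1 ≠ y.1 := by
      intro p' hp' z hz e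
      obtain ⟨z', hz', e'⟩ := hyp
      simp only [List.flatten_cons, List.map_append] at hnd'
      rw [List.nodup_append] at hnd'
      refine hnd'.2.2 z'.1 (List.mem_map_of_mem hz') z.1 ?_ (by rw [e, e'])
      exact List.mem_map_of_mem (List.mem_flatten_of_mem hp' hz)
    have hold : ∀ p' ∈ A ++ B, ExPath E0 E1 Ω p' := by
      intro p' hp'
      have := hPs p' ((hmemPs p').2 (Or.inr hp'))
      refine ⟨this.chain, this.ne, ?_, ?_, ?_⟩
      · intro h e
        have := this.head h e
        have h1 := ((hmem _).1 this.1).2.2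
        exact ⟨h1, hflip h h1 (fun e' => hother p' hp' h (List.mem_of_mem_head? e) (by rw [e']; rfl))
          this.2⟩
      · intro h e
        have := this.last h e
        have h1 := ((hmem _).1 this.1).2.2
        refine ⟨h1, ?_⟩
        have := hflip (flp h) h1 (fun e' => hother p' hp' h (List.mem_of_mem_getLast? e) (by
          have := congrArg Prod.fst e'
          simpa using this)) (by simpa using this.2)
        simpa using this
      · intro z hz
        rcases this.mem z hz with h | h
        · exact Or.inl ((hmem _).1 h).2.2
        · exact Or.inr ((hmem _).1 h).2.2
    have hpp := hPs p hp
    have hpinj : ∀ a ∈ p, ∀ b ∈ p, a.1 = b.1 → a = b := fun a ha b hb e =>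
      (flat_uniq Prod.fst hnd hp hp ha hb e).2
    have hmid : ((A ++ B).flatten.map Prod.fst).Nodup ∧ (p.map Prod.fst).Nodup ∧
        ∀ a ∈ p, ∀ p' ∈ A ++ B, ∀ b ∈ p', a.1 ≠ b.1 := by
      simp only [List.flatten_cons, List.map_append] at hnd'
      rw [List.nodup_append] at hnd'
      refine ⟨hnd'.2.1, hnd'.1, ?_⟩
      intro a ha p' hp' b hb
      refine hnd'.2.2 a.1 (List.mem_map_of_mem ha) b.1 ?_
      exact List.mem_map_of_mem (List.mem_flatten_of_mem hp' hb)
    have hxAB : ∀ p' ∈ A ++ B, ∀ z ∈ p', z.1 ≠ x.1 := fun p' hp' =>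
      hxnot p' ((hmemPs p').2 (Or.inr hp'))
    -- it suffices to give one new path
    suffices hnew : ∃ r : List (V × Bool), ExPath E0 E1 Ω r ∧ (r.map Prod.fst).Nodup ∧
        (∀ z ∈ r, z.1 = x.1 ∨ ∃ w ∈ p, z.1 = w.1) ∧ (r.head? = some x ∨ r.getLast? = some (flp x)) ∧
        (∀ z ∈ Ω, z ≠ x → flp z ∉ Ω → (p.head? = some z ∨ p.getLast? = some (flp z)) →
          (r.head? = some z ∨ r.getLast? = some (flp z))) by
      obtain ⟨r, hr, hrn, hrm, hrx, hrc⟩ := hnew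
      refine ⟨r :: (A ++ B), ?_, ?_, ?_⟩
      · intro p' hp'
        rcases List.mem_cons.1 hp' with h | h
        · rw [h]; exact hr
        · exact hold p' h
      · rw [List.flatten_cons, List.map_append, List.nodup_append]
        refine ⟨hrn, hmid.1, ?_⟩
        intro a ha b hb e
        obtain ⟨z, hz, rfl⟩ := List.mem_map.1 ha
        obtain ⟨w, hw, rfl⟩ := List.mem_map.1 hb
        obtain ⟨p', hp', hw'⟩ := List.mem_flatten.1 hw
        rcases hrm z hz with h | ⟨w', hw1, hw2⟩
        · exact hxAB p' hp' w hw' (e.symm.trans h)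
        · exact hmid.2.2 w' hw1 p' hp' w hw' (hw2.symm.trans e)
      · intro z hz hfz
        by_cases hzx : z = x
        · subst hzx; exact ⟨r, List.mem_cons_self, hrx⟩
        have hzy : z ≠ y := fun e => hfz (e ▸ hfy)
        obtain ⟨p', hp', h⟩ := hcovr z ((hmem z).2 ⟨hzy, hzx, hz⟩) (fun h => hfz ((hmem _).1 h).2.2)
        rcases (hmemPs p').1 hp' with e | e
        · subst e
          exact ⟨r, List.mem_cons_self, hrc z hz hzx hfz h⟩
        · exact ⟨p', List.mem_cons_of_mem _ e, h⟩
    have hpmem : ∀ z ∈ p, z ∈ Ω ∨ flp z ∈ Ω := by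
      intro z hz
      rcases hpp.mem z hz with h | h
      · exact Or.inl ((hmem _).1 h).2.2
      · exact Or.inr ((hmem _).1 h).2.2
    rcases hpy with hpy | hpy
    · obtain ⟨p1, rfl⟩ : ∃ p1, p = flp y :: p1 := by
        cases hpc : p with
        | nil => simp [hpc] at hpy
        | cons a l => rw [hpc] at hpy; simp at hpy; exact ⟨l, by rw [hpy]⟩
      refine ⟨x :: flp y :: p1, ⟨?_, by simp, ?_, ?_, ?_⟩, ?_, ?_, Or.inl rfl, ?_⟩
      · rw [List.isChain_cons_cons]; exact ⟨hcov, hpp.chain⟩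
      · intro h e; simp at e; subst e; exact ⟨hx, hfx⟩
      · intro l e
        rw [List.getLast?_cons_cons] at e
        have hl := hpp.last l e
        have h1 := ((hmem _).1 hl.1).2.2
        refine ⟨h1, ?_⟩
        have hly : flp l ≠ flp y := by
          intro e'
          have e2 : l = y := by rw [← flp_flp l, e', flp_flp]
          have := hpinj (flp y) (by simp) l (List.mem_of_mem_getLast? e) (by rw [e2]; rfl)
          rw [e2] at this
          exact flp_ne y this
        have := hflip (flp l) h1 hly (by simpa using hl.2)
        simpa using this
      · intro z hz
        rcases List.mem_cons.1 hz with h | h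
        · rw [h]; exact Or.inl hx
        · exact hpmem z h
      · rw [List.map_cons, List.nodup_cons]
        refine ⟨?_, hmid.2.1⟩
        intro h
        obtain ⟨z, hz, e⟩ := List.mem_map.1 h
        exact hxnot _ hp z hz e
      · intro z hz
        rcases List.mem_cons.1 hz with h | h
        · rw [h]; exact Or.inl rfl
        · exact Or.inr ⟨z, h, rfl⟩
      · intro z hz hzx hfz h
        rcases h with h | h
        · exfalso
          simp at h
          rw [← h, flp_flp] at hfz
          exact hfz hy
        · right; rw [List.getLast?_cons_cons]; exact h
    · refine ⟨p ++ [flp x], ⟨?_, by simp, ?_, ?_, ?_⟩, ?_, ?_, Or.inr (by simp), ?_⟩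
      · rw [List.isChain_append]
        refine ⟨hpp.chain, by simp, ?_⟩
        intro a ha b hb
        simp at hb
        have : a = y := by
          have h := ha
          rw [Option.mem_def, hpy] at h
          exact (Option.some.inj h).symm
        rw [this, ← hb]
        exact hcov'
      · intro h e
        have e' : p.head? = some h := by
          cases hpc : p with
          | nil => exact absurd hpc hpp.ne
          | cons a l => rw [hpc] at e; simpa using e
        have hl := hpp.head h e'
        have h1 := ((hmem _).1 hl.1).2.2
        refine ⟨h1, hflip h h1 ?_ hl.2⟩
        intro e2
        have := hpinj y (List.mem_of_mem_getLast? hpy) h (List.mem_of_mem_head? e') (by rw [e2]; rfl)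
        rw [← this] at e2
        exact flp_ne y e2.symm
      · intro l e
        simp at e
        subst e
        exact ⟨by simpa using hx, hfx⟩
      · intro z hz
        rcases List.mem_append.1 hz with h | h
        · exact hpmem z h
        · simp at h; subst h; right; simpa using hx
      · rw [List.map_append, List.nodup_append]
        refine ⟨hmid.2.1, by simp, ?_⟩
        intro a ha b hb e
        obtain ⟨z, hz, rfl⟩ := List.mem_map.1 ha
        simp at hb
        exact hxnot _ hp z hz (e.trans hb)
      · intro z hz
        rcases List.mem_append.1 hz with h | h
        · exact Or.inr ⟨z, h, rfl⟩
        · simp at h; subst h; exact Or.inl rfl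
      · intro z hz hzx hfz h
        rcases h with h | h
        · left
          cases hpc : p with
          | nil => exact absurd hpc hpp.ne
          | cons a l => rw [hpc] at h; simpa using h
        · exfalso
          rw [hpy] at h
          have := Option.some.inj h
          rw [← this] at hfz
          exact hfz hy

theorem tutte_sets {T : Type*} [Finite T] (G : SimpleGraph T) :
    (∃ m : T → T, (∀ t, G.Adj t (m t)) ∧ ∀ t, m (m t) = t) ∨
    ∃ (A : Set T) (O : Set (Set T)), A.ncard < O.ncard ∧
      (∀ C ∈ O, Odd C.ncard ∧ (∀ t ∈ C, t ∉ A) ∧ ∀ x y, x ∈ C → y ∉ A → G.Adj x y → y ∈ C) ∧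
      (∀ C ∈ O, ∀ D ∈ O, ∀ t, t ∈ C → t ∈ D → C = D) ∧
      (Odd O.ncard ↔ Odd (Nat.card T - A.ncard)) := by
  classical
  by_cases h : ∃ M : G.Subgraph, M.IsPerfectMatching
  · left
    obtain ⟨M, hM⟩ := h
    rw [SimpleGraph.Subgraph.isPerfectMatching_iff] at hM
    choose m hm hm' using hM
    refine ⟨m, fun t => (hm t).adj_sub, fun t => ?_⟩
    exact (hm' (m t) t (hm t).symm).symm
  · right
    rw [SimpleGraph.tutte] at h
    push Not at h
    obtain ⟨A, hA⟩ := h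
    let G' := ((⊤ : G.Subgraph).deleteVerts A).coe
    have hv : ∀ t, t ∈ ((⊤ : G.Subgraph).deleteVerts A).verts ↔ t ∉ A := by
      intro t; simp
    let f : G'.ConnectedComponent → Set T := fun c => Subtype.val '' c.supp
    have hfmem : ∀ c t (ht : t ∈ ((⊤ : G.Subgraph).deleteVerts A).verts), t ∈ f c ↔
        G'.connectedComponentMk ⟨t, ht⟩ = c := by
      intro c t ht
      constructor
      · rintro ⟨⟨x, hx⟩, hxc, rfl⟩
        exact hxc
      · intro h
        exact ⟨⟨t, ht⟩, h, rfl⟩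
    have hfout : ∀ c t, t ∈ f c → t ∈ ((⊤ : G.Subgraph).deleteVerts A).verts := by
      rintro c t ⟨⟨x, hx⟩, hxc, rfl⟩
      exact hx
    have huniq : ∀ c d t, t ∈ f c → t ∈ f d → c = d := by
      intro c d t hc hd
      have ht := hfout c t hc
      rw [hfmem c t ht] at hc
      rw [hfmem d t ht] at hd
      rw [← hc, ← hd]
    have hinj : Function.Injective f := by
      intro c d hcd
      obtain ⟨⟨x, hx⟩, hxc⟩ := c.nonempty_supp
      have h1 : x ∈ f c := ⟨_, hxc, rfl⟩
      exact huniq c d x h1 (hcd ▸ h1)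
    have hcard : (f '' G'.oddComponents).ncard = G'.oddComponents.ncard :=
      Set.ncard_image_of_injective _ hinj
    refine ⟨A, f '' G'.oddComponents, ?_, ?_, ?_, ?_⟩
    · rw [hcard]; exact hA
    · rintro C ⟨c, hc, rfl⟩
      refine ⟨?_, ?_, ?_⟩
      · show Odd (Subtype.val '' c.supp).ncard
        rw [Set.ncard_image_of_injective _ Subtype.val_injective]
        exact hc
      · intro t ht
        exact (hv t).1 (hfout c t ht)
      · intro x y hx hy hxy
        have hx' := hfout c x hx
        have hy' := (hv y).2 hy
        rw [hfmem c x hx'] at hx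
        rw [hfmem c y hy', ← hx]
        refine SimpleGraph.ConnectedComponent.eq.2 (SimpleGraph.Adj.reachable ?_)
        simp only [G', SimpleGraph.Subgraph.coe_adj, SimpleGraph.Subgraph.deleteVerts_adj]
        simp [hy, (hv x).1 hx', hxy.symm]
    · rintro C ⟨c, hc, rfl⟩ D ⟨d, hd, rfl⟩ t ht ht'
      rw [huniq c d t ht ht']
    · rw [hcard, SimpleGraph.odd_ncard_oddComponents]
      have : Nat.card ((⊤ : G.Subgraph).deleteVerts A).verts = Nat.card T - A.ncard := by
        have h1 : ((⊤ : G.Subgraph).deleteVerts A).verts = Aᶜ := by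
          ext t; simp
        rw [h1, Nat.card_coe_set_eq, Set.ncard_compl]
      rw [this]

theorem even_ncard_of_invol {T : Type*} [Finite T] (C : Set T) (f : T → T)
    (h1 : ∀ t ∈ C, f t ∈ C) (h2 : ∀ t ∈ C, f (f t) = t) (h3 : ∀ t ∈ C, f t ≠ t) :
    Even C.ncard := by
  classical
  have := Fintype.ofFinite T
  rw [Set.ncard_eq_toFinset_card']
  have : ∑ x ∈ C.toFinset, (1 : ZMod 2) = 0 := by
    refine Finset.sum_involution (fun a _ => f a) ?_ ?_ ?_ ?_
    · intro a ha; decide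
    · intro a ha _; exact h3 a (by simpa using ha)
    · intro a ha; simpa using h1 a (by simpa using ha)
    · intro a ha; exact h2 a (by simpa using ha)
  simp only [Finset.sum_const, nsmul_eq_mul, mul_one] at this
  rw [even_iff_two_dvd]
  exact (ZMod.natCast_eq_zero_iff _ 2).1 this

theorem len_toList_le {α β : Type*} (g : α → Option β) (Ps : List α) :
    (Ps.map (fun p => (g p).toList)).flatten.length ≤ Ps.length := by
  induction Ps with
  | nil => simp
  | cons a l ih =>
    have : ((g a).toList).length ≤ 1 := by cases g a <;> simp
    simp only [List.map_cons, List.flatten_cons, List.length_append, List.length_cons]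
    omega

structure OddPacking (E0 E1 : V → V → Prop) (S : Set V) (q : ℕ) (P : Fin q → List (V × Bool)) :
    Prop where
  chain : ∀ i, (P i).IsChain (cov E0 E1)
  nodup : ∀ i, ((P i).map Prod.fst).Nodup
  disj : ∀ i j x y, x ∈ P i → y ∈ P j → x.1 = y.1 → i = j
  head : ∀ i, ∃ s ∈ S, (P i).head? = some (s, false)
  last : ∀ i, ∃ s ∈ S, (P i).getLast? = some (s, true)
  internal : ∀ i x, x ∈ P i → x.1 ∈ S → (P i).head? = some x ∨ (P i).getLast? = some x

theorem packing_of_matching [Fintype V] [DecidableEq V] (E0 E1 : V → V → Prop)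
    (h0 : ∀ a b, E0 a b → E0 b a)
    (h1 : ∀ a b, E1 a b → E1 b a) (i0 : ∀ a, ¬ E0 a a) (i1 : ∀ a, ¬ E1 a a)
    (S : Finset V) (q : ℕ) (μ : V × Bool → V × Bool) (Ω : Finset (V × Bool))
    (hμ : ∀ x ∈ Ω, μ x ∈ Ω ∧ μ (μ x) = x ∧ (cov E0 E1 x (flp (μ x)) ∨ μ x = flp x))
    (hΩ1 : ∀ s ∈ S, (s, true) ∉ Ω)
    (hΩ2 : ∀ x, x.1 ∉ S → x ∈ Ω)
    (hcard : 2 * q ≤ (S.filter (fun s => (s, false) ∈ Ω)).card) :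
    ∃ P, OddPacking E0 E1 (S : Set V) q P := by
  obtain ⟨Ps, hPs, hnd, hcovr⟩ := extraction E0 E1 h0 h1 i0 i1 μ _ Ω rfl hμ
  have hRS : ∀ x ∈ Ω, flp x ∉ Ω → x.1 ∈ S ∧ x.2 = false := by
    intro x hx hfx
    have hxS : x.1 ∈ S := by
      by_contra h
      exact hfx (hΩ2 (flp x) h)
    refine ⟨hxS, ?_⟩
    by_contra h
    have : x = (x.1, true) := by
      refine Prod.ext rfl ?_
      simpa using h
    rw [this] at hx
    exact hΩ1 _ hxS hx
  have hlen : q ≤ Ps.length := by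
    let L : List V := (Ps.map (fun p => (p.head?.map Prod.fst).toList)).flatten ++
      (Ps.map (fun p => (p.getLast?.map Prod.fst).toList)).flatten
    have hL : L.length ≤ 2 * Ps.length := by
      have : ∀ g : List (V × Bool) → Option V,
          (Ps.map (fun p => (g p).toList)).flatten.length ≤ Ps.length := by
        exact fun g => len_toList_le g Ps
      have e1 := this (fun p => p.head?.map Prod.fst)
      have e2 := this (fun p => p.getLast?.map Prod.fst)
      simp only [L, List.length_append]
      omega
    have hsub : S.filter (fun s => (s, false) ∈ Ω) ⊆ L.toFinset := by
      intro s hs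
      rw [Finset.mem_filter] at hs
      rw [List.mem_toFinset]
      obtain ⟨p, hp, h⟩ := hcovr (s, false) hs.2 (hΩ1 s hs.1)
      rw [List.mem_append]
      rcases h with h | h
      · left
        exact List.mem_flatten_of_mem (List.mem_map_of_mem hp) (by simp [h])
      · right
        exact List.mem_flatten_of_mem (List.mem_map_of_mem hp) (by simp [h, flp])
    have := (Finset.card_le_card hsub).trans (L.toFinset_card_le)
    omega
  have hget : ∀ i : Fin q, i.1 < Ps.length := fun i => lt_of_lt_of_le i.2 hlen
  have hmem : ∀ i : Fin q, Ps[i.1]'(hget i) ∈ Ps := fun i => List.getElem_mem _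
  have hpne : ∀ p ∈ Ps, p ≠ [] := fun p hp => (hPs p hp).ne
  have hPsnd : Ps.Nodup := by
    have h2 := (List.nodup_flatten.1 hnd.of_map).2
    refine List.Pairwise.imp_of_mem ?_ h2
    intro a b ha hb hab e
    subst e
    obtain ⟨x, hx⟩ := List.exists_mem_of_ne_nil a (hpne a ha)
    exact hab hx hx
  refine ⟨fun i => Ps[i.1]'(hget i), ⟨?_, ?_, ?_, ?_, ?_, ?_⟩⟩
  · intro i; exact (hPs _ (hmem i)).chain
  · intro i
    refine List.Nodup.sublist ?_ hnd
    exact (List.sublist_flatten_of_mem (hmem i)).map _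
  · intro i j x y hx hy hxy
    have := (flat_uniq Prod.fst hnd (hmem i) (hmem j) hx hy hxy).1
    exact Fin.ext ((hPsnd.getElem_inj_iff).1 this)
  · intro i
    have hp := hPs _ (hmem i)
    obtain ⟨x, hx⟩ : ∃ x, (Ps[i.1]'(hget i)).head? = some x := by
      rw [← Option.isSome_iff_exists, List.isSome_head?]; exact hp.ne
    have h3 := hp.head x hx
    have h4 := hRS x h3.1 h3.2
    exact ⟨x.1, h4.1, by rw [hx]; congr 1; exact Prod.ext rfl h4.2⟩
  · intro i
    have hp := hPs _ (hmem i)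
    obtain ⟨x, hx⟩ : ∃ x, (Ps[i.1]'(hget i)).getLast? = some x := by
      exact ⟨_, List.getLast?_eq_some_getLast hp.ne⟩
    have h3 := hp.last x hx
    have h4 := hRS (flp x) h3.1 (by simpa using h3.2)
    refine ⟨x.1, h4.1, by rw [hx]; congr 1; exact Prod.ext rfl (by simpa using h4.2)⟩
  · intro i x hx hxS
    have hp := hPs _ (hmem i)
    have hxx : ∃ z ∈ Ω, flp z ∉ Ω ∧ z.1 = x.1 := by
      rcases hp.mem x hx with h | h
      · refine ⟨x, h, ?_, rfl⟩
        have : x.2 = false := by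
          by_contra h'
          apply hΩ1 x.1 hxS
          have : x = (x.1, true) := Prod.ext rfl (by simpa using h')
          rw [← this]; exact h
        have e : flp x = (x.1, true) := Prod.ext rfl (by simp [this])
        rw [e]; exact hΩ1 _ hxS
      · refine ⟨flp x, h, ?_, rfl⟩
        have : (flp x).2 = false := by
          by_contra h'
          apply hΩ1 x.1 hxS
          have : flp x = (x.1, true) := Prod.ext rfl (by simpa using h')
          rw [← this]; exact h
        have e : flp (flp x) = (x.1, true) := by
          rw [flp_flp]; exact Prod.ext rfl (by simpa using this)
        rw [e]; exact hΩ1 _ hxS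
    obtain ⟨z, hz, hfz, hzx⟩ := hxx
    obtain ⟨p', hp', h⟩ := hcovr z hz hfz
    rcases h with h | h
    · obtain ⟨e1, e2⟩ := flat_uniq Prod.fst hnd hp' (hmem i) (List.mem_of_mem_head? h) hx hzx
      left; rw [← e1, h, e2]
    · obtain ⟨e1, e2⟩ := flat_uniq Prod.fst hnd hp' (hmem i) (List.mem_of_mem_getLast? h) hx
        (by simpa using hzx)
      right; rw [← e1, h, e2]

abbrev TT (S : Finset V) (d : ℕ) := {x : V × Bool // x.1 ∈ S → x.2 = false} ⊕ Fin d

def tgAdj (E0 E1 : V → V → Prop) (S : Finset V) (d : ℕ) : TT S d → TT S d → Prop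
  | Sum.inl x, Sum.inl y => cov E0 E1 x.1 (flp y.1) ∨ y.1 = flp x.1
  | Sum.inl x, Sum.inr _ => x.1.1 ∈ S
  | Sum.inr _, Sum.inl y => y.1.1 ∈ S
  | Sum.inr _, Sum.inr _ => False

theorem ep_matching [Fintype V] [DecidableEq V] (E0 E1 : V → V → Prop)
    (h0 : ∀ a b, E0 a b → E0 b a)
    (h1 : ∀ a b, E1 a b → E1 b a) (i0 : ∀ a, ¬ E0 a a) (i1 : ∀ a, ¬ E1 a a)
    (S : Finset V) (q : ℕ) (hq : 2 * q ≤ S.card) (m : TT S (S.card - 2 * q) → TT S (S.card - 2 * q))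
    (hm : ∀ t, tgAdj E0 E1 S _ t (m t)) (hmm : ∀ t, m (m t) = t) :
    ∃ P, OddPacking E0 E1 (S : Set V) q P := by
  classical
  let Ω : Finset (V × Bool) := Finset.univ.filter
    (fun x => ∃ hx : x.1 ∈ S → x.2 = false, ∃ y, m (Sum.inl ⟨x, hx⟩) = Sum.inl y)
  let μ : V × Bool → V × Bool := fun x =>
    if hx : x.1 ∈ S → x.2 = false then (Sum.elim (fun y => y.1) (fun _ => x) (m (Sum.inl ⟨x, hx⟩)))
    else x
  have hΩ : ∀ x, x ∈ Ω ↔ ∃ hx : x.1 ∈ S → x.2 = false, ∃ y, m (Sum.inl ⟨x, hx⟩) = Sum.inl y := by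
    intro x; simp only [Ω, Finset.mem_filter, Finset.mem_univ, true_and]
  have hμ : ∀ x (hx : x.1 ∈ S → x.2 = false) y, m (Sum.inl ⟨x, hx⟩) = Sum.inl y → μ x = y.1 := by
    intro x hx y h
    simp only [μ]
    rw [dif_pos hx, h]; rfl
  refine packing_of_matching E0 E1 h0 h1 i0 i1 S q μ Ω ?_ ?_ ?_ ?_
  · intro x hx
    obtain ⟨hx, y, hy⟩ := (hΩ x).1 hx
    have e1 := hμ x hx y hy
    have hy' : m (Sum.inl y) = Sum.inl ⟨x, hx⟩ := by rw [← hy, hmm]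
    have e2 := hμ y.1 y.2 ⟨x, hx⟩ hy'
    rw [e1]
    refine ⟨(hΩ _).2 ⟨y.2, _, hy'⟩, e2, ?_⟩
    have := hm (Sum.inl ⟨x, hx⟩)
    rw [hy] at this
    exact this
  · intro s hs h
    obtain ⟨hx, _⟩ := (hΩ _).1 h
    have := hx hs
    simp at this
  · intro x hx
    rw [hΩ]
    refine ⟨fun h => absurd h hx, ?_⟩
    have := hm (Sum.inl ⟨x, fun h => absurd h hx⟩)
    cases h : m (Sum.inl ⟨x, fun h => absurd h hx⟩) with
    | inl y => exact ⟨y, rfl⟩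
    | inr i => rw [h] at this; exact absurd this hx
  · have hsplit := Finset.card_filter_add_card_filter_not (s := S) (fun s => (s, false) ∈ Ω)
    have hbound : (S.filter (fun s => ¬ (s, false) ∈ Ω)).card ≤ S.card - 2 * q := by
      have hh : ∀ s, s ∈ S.filter (fun s => ¬ (s, false) ∈ Ω) → ∃ i : Fin (S.card - 2 * q),
          m (Sum.inr i) = Sum.inl ⟨(s, false), fun _ => rfl⟩ := by
        intro s hs
        rw [Finset.mem_filter, hΩ] at hs
        cases h : m (Sum.inl ⟨(s, false), fun _ => rfl⟩) with
        | inl y => exact absurd ⟨fun _ => rfl, y, h⟩ hs.2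
        | inr i => exact ⟨i, by rw [← h, hmm]⟩
      rcases (S.filter (fun s => ¬ (s, false) ∈ Ω)).eq_empty_or_nonempty with h0 | ⟨s0, hs0⟩
      · simp [h0]
      haveI : Nonempty (Fin (S.card - 2 * q)) := ⟨(hh s0 hs0).choose⟩
      choose! g hg using hh
      have := Finset.card_le_card_of_injOn g (t := Finset.univ) (fun _ _ => Finset.mem_univ _) (by
        intro s hs s' hs' e
        have e1 := hg s hs
        have e2 := hg s' hs'
        rw [e, e2] at e1
        have := Sum.inl.inj e1
        have := congrArg (fun z => z.1.1) this
        exact this.symm)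
      simpa using this
    omega

/-- The structural outcome of the Erdős–Pósa type lemma. -/
structure EPOut (E0 E1 : V → V → Prop) (S : Finset V) (X U : Finset V) (ρ : V → V) (τ : V → Bool) :
    Prop where
  disj : ∀ v, v ∈ X → v ∈ U → False
  cover : ∀ s ∈ S, s ∈ X ∨ s ∈ U
  rho_mem : ∀ v, v ∉ X → ρ v ∈ U
  rho_fix : ∀ u ∈ U, ρ u = u
  rho_adj : ∀ x y, x ∉ X → y ∉ X → (E0 x y ∨ E1 x y) → ρ x = ρ y ∨ (x ∈ U ∧ y ∈ U)
  tau0 : ∀ x ∈ U, ∀ y ∈ U, E0 x y → τ x = τ y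
  tau1 : ∀ x ∈ U, ∀ y ∈ U, E1 x y → τ x ≠ τ y
  tauS : ∀ s ∈ S, s ∉ X → τ s = false

theorem boolflip (a b : Bool) (h : ¬ a = b) : a = !b := by
  cases a <;> cases b <;> simp_all

set_option maxHeartbeats 2000000 in
theorem ep_violator [Fintype V] [DecidableEq V] (E0 E1 : V → V → Prop)
    (h0 : ∀ a b, E0 a b → E0 b a)
    (h1 : ∀ a b, E1 a b → E1 b a) (i0 : ∀ a, ¬ E0 a a) (i1 : ∀ a, ¬ E1 a a)
    (S : Finset V) (q : ℕ) (hq : 2 * q ≤ S.card)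
    (A : Set (TT S (S.card - 2 * q))) (O : Set (Set (TT S (S.card - 2 * q))))
    (hAO : A.ncard < O.ncard)
    (hodd : ∀ C ∈ O, Odd C.ncard)
    (hout : ∀ C ∈ O, ∀ t ∈ C, t ∉ A)
    (hcl : ∀ C ∈ O, ∀ x y, x ∈ C → y ∉ A → tgAdj E0 E1 S _ x y → y ∈ C)
    (hdis : ∀ C ∈ O, ∀ D ∈ O, ∀ t, t ∈ C → t ∈ D → C = D)
    (hpar : Odd O.ncard ↔ Odd (Nat.card (TT S (S.card - 2 * q)) - A.ncard)) :
    ∃ (X U : Finset V) (ρ : V → V) (τ : V → Bool), X.card ≤ 2 * q ∧ EPOut E0 E1 S X U ρ τ := by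
  classical
  -- ports
  have hport : ∀ C ∈ O, (∀ i, Sum.inr i ∉ C) → ∃ x, Sum.inl x ∈ C ∧
      (x.1.1 ∈ S ∨ (x.1.1 ∉ S ∧ ∃ hy, Sum.inl ⟨flp x.1, hy⟩ ∈ A)) := by
    intro C hC hd
    by_contra hno
    push Not at hno
    apply Nat.not_even_iff_odd.2 (hodd C hC)
    let f : TT S (S.card - 2 * q) → TT S (S.card - 2 * q) := Sum.elim (fun x =>
      if h : (flp x.1).1 ∈ S → (flp x.1).2 = false then Sum.inl ⟨flp x.1, h⟩ else Sum.inl x) Sum.inr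
    have hf : ∀ x, Sum.inl x ∈ C → ∃ hx, f (Sum.inl x) = Sum.inl ⟨flp x.1, hx⟩ := by
      intro x hx
      have hv : (flp x.1).1 ∈ S → (flp x.1).2 = false := fun h => absurd h (hno x hx).1
      exact ⟨hv, dif_pos hv⟩
    refine even_ncard_of_invol C f ?_ ?_ ?_
    · rintro (x | i) ht
      · obtain ⟨hx, e⟩ := hf x ht
        rw [e]
        exact hcl C hC _ _ ht ((hno x ht).2 (hno x ht).1 hx) (Or.inr rfl)
      · exact absurd ht (hd i)
    · rintro (x | i) ht
      · obtain ⟨hx, e⟩ := hf x ht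
        rw [e]
        have h2 := hcl C hC _ _ ht ((hno x ht).2 (hno x ht).1 hx) (Or.inr rfl)
        obtain ⟨hx', e'⟩ := hf _ h2
        rw [e']
        simp
      · exact absurd ht (hd i)
    · rintro (x | i) ht
      · obtain ⟨hx, e⟩ := hf x ht
        rw [e]
        intro e2
        have := congrArg Subtype.val (Sum.inl.inj e2)
        exact flp_ne _ this
      · exact absurd ht (hd i)
  have hOfin : O.Finite := Set.toFinite _
  by_cases hdum : ∃ i, Sum.inr i ∉ A
  · exfalso
    obtain ⟨i0', hi0⟩ := hdum
    by_cases hter : ∃ x, x.1.1 ∈ S ∧ Sum.inl x ∉ A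
    · obtain ⟨x0, hx0S, hx0⟩ := hter
      have hin : ∀ C ∈ O, Sum.inr i0' ∉ C → (∀ i, Sum.inr i ∉ C) ∧ ∀ x, Sum.inl x ∈ C → x.1.1 ∉ S := by
        intro C hC hi
        have hx : ∀ x, Sum.inl x ∈ C → x.1.1 ∉ S := by
          intro x hx hxS
          exact hi (hcl C hC _ _ hx hi0 hxS)
        refine ⟨fun i hiC => ?_, hx⟩
        exact hx x0 (hcl C hC _ _ hiC hx0 hx0S) hx0S
      have hg : ∀ C, C ∈ O \ {C | Sum.inr i0' ∈ C} → ∃ t, t ∈ A ∧ ∃ x hy, Sum.inl x ∈ C ∧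
          t = Sum.inl ⟨flp x.1, hy⟩ := by
        rintro C ⟨hC, hCi⟩
        obtain ⟨h2, h3⟩ := hin C hC hCi
        obtain ⟨x, hx, h4⟩ := hport C hC h2
        obtain ⟨h5, hy, h6⟩ := h4.resolve_left (h3 x hx)
        exact ⟨_, h6, x, hy, hx, rfl⟩
      haveI : Nonempty (TT S (S.card - 2 * q)) := ⟨Sum.inr i0'⟩
      choose! g hgA hg using hg
      have hle : (O \ {C | Sum.inr i0' ∈ C}).ncard ≤ A.ncard := by
        refine Set.ncard_le_ncard_of_injOn g hgA ?_ (Set.toFinite _)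
        intro C hC D hD e
        obtain ⟨x, hy, hxC, e1⟩ := hg C hC
        obtain ⟨x', hy', hxD, e2⟩ := hg D hD
        rw [e1, e2] at e
        have := congrArg (fun z => flp z.1) (Sum.inl.inj e)
        simp only [flp_flp] at this
        have hxx : x = x' := Subtype.ext this
        subst hxx
        exact hdis C hC.1 D hD.1 _ hxC hxD
      have hle1 : (O ∩ {C | Sum.inr i0' ∈ C}).ncard ≤ 1 := by
        rw [Set.ncard_le_one (Set.toFinite _)]
        rintro C ⟨hC, hCi⟩ D ⟨hD, hDi⟩
        exact hdis C hC D hD _ hCi hDi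
      have hsum := Set.ncard_inter_add_ncard_diff_eq_ncard O {C | Sum.inr i0' ∈ C} hOfin
      have hTcard : Even (Nat.card (TT S (S.card - 2 * q))) := by
        rw [Nat.card_sum, Nat.card_eq_fintype_card, Nat.card_eq_fintype_card, Fintype.card_fin,
          Fintype.card_subtype]
        have e1 := Finset.card_filter_add_card_filter_not (s := (Finset.univ : Finset (V × Bool)))
          (fun x => x.1 ∈ S → x.2 = false)
        have e2 : (Finset.univ.filter (fun x : V × Bool => ¬ (x.1 ∈ S → x.2 = false))).card = S.card := by
          refine Finset.card_nbij' (fun x => x.1) (fun s => (s, true)) ?_ ?_ ?_ ?_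
          · intro x hx; simp at hx; exact hx.1
          · intro s hs; simpa using hs
          · intro x hx; simp at hx; exact Prod.ext rfl (by simp [hx.2])
          · intro s hs; rfl
        rw [e2, Finset.card_univ, Fintype.card_prod, Fintype.card_bool] at e1
        rw [Nat.even_iff]
        omega
      have hAle : A.ncard ≤ Nat.card (TT S (S.card - 2 * q)) := by
        rw [← Set.ncard_univ]; exact Set.ncard_le_ncard (Set.subset_univ _)
      rw [Nat.odd_iff, Nat.odd_iff] at hpar
      rw [Nat.even_iff] at hTcard
      omega
    · push Not at hter
      obtain ⟨ι⟩ : Nonempty (Fin (S.card - 2 * q) ↪ S) := by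
        apply Function.Embedding.nonempty_of_card_le
        simp
      have hg : ∀ C, C ∈ O → ∃ t, t ∈ A ∧ ((∃ x hy, Sum.inl x ∈ C ∧ x.1.1 ∉ S ∧
          t = Sum.inl ⟨flp x.1, hy⟩) ∨ ∃ i, Sum.inr i ∈ C ∧
            t = Sum.inl ⟨((ι i : V), false), fun _ => rfl⟩) := by
        intro C hC
        by_cases hd : ∃ i, Sum.inr i ∈ C
        · obtain ⟨i, hi⟩ := hd
          exact ⟨Sum.inl ⟨((ι i : V), false), fun _ => rfl⟩, hter _ (ι i).2, Or.inr ⟨i, hi, rfl⟩⟩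
        · push Not at hd
          obtain ⟨x, hx, h4⟩ := hport C hC hd
          have hxS : x.1.1 ∉ S := fun h => hout C hC _ hx (hter x h)
          obtain ⟨h5, hy, h6⟩ := h4.resolve_left hxS
          exact ⟨_, h6, Or.inl ⟨x, hy, hx, hxS, rfl⟩⟩
      haveI : Nonempty (TT S (S.card - 2 * q)) := by
        exact ⟨Sum.inr i0'⟩
      choose! g hgA hg using hg
      have hle : O.ncard ≤ A.ncard := by
        refine Set.ncard_le_ncard_of_injOn g hgA ?_ (Set.toFinite _)
        intro C hC D hD e
        rcases hg C hC with ⟨x, hy, hxC, hxS, e1⟩ | ⟨i, hi, e1⟩ <;>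
        rcases hg D hD with ⟨x', hy', hxD, hxS', e2⟩ | ⟨i', hi', e2⟩ <;>
        rw [e1, e2] at e
        · have := congrArg (fun z => flp z.1) (Sum.inl.inj e)
          simp only [flp_flp] at this
          have hxx : x = x' := Subtype.ext this
          subst hxx
          exact hdis C hC D hD _ hxC hxD
        · exfalso
          have := congrArg (fun z => z.1.1) (Sum.inl.inj e)
          simp only [flp_fst] at this
          rw [this] at hxS
          exact hxS (ι i').2
        · exfalso
          have := congrArg (fun z => z.1.1) (Sum.inl.inj e)
          simp only [flp_fst] at this
          rw [← this] at hxS'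
          exact hxS' (ι i).2
        · have := congrArg (fun z => z.1.1) (Sum.inl.inj e)
          simp only at this
          have := ι.injective (Subtype.ext this)
          subst this
          exact hdis C hC D hD _ hi hi'
      omega
  push Not at hdum
  have hport' : ∀ C, C ∈ O → ∃ x, Sum.inl x ∈ C ∧
      (x.1.1 ∈ S ∨ (x.1.1 ∉ S ∧ ∃ hy, Sum.inl ⟨flp x.1, hy⟩ ∈ A)) := fun C hC =>
    hport C hC (fun i hi => hout C hC _ hi (hdum i))
  obtain ⟨C0, hC0⟩ : O.Nonempty := by
    rw [← Set.ncard_pos hOfin]; omega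
  have : Nonempty {x : V × Bool // x.1 ∈ S → x.2 = false} := ⟨(hport' C0 hC0).choose⟩
  choose! r hrC hr using hport'
  let U : Finset V := Finset.univ.filter (fun v => ∃ C ∈ O, (r C).1.1 = v)
  have hU : ∀ v, v ∈ U ↔ ∃ C ∈ O, (r C).1.1 = v := by intro v; simp [U]
  have hrA : ∀ C ∈ O, Sum.inl (r C) ∉ A := fun C hC => hout C hC _ (hrC C hC)
  have hrinj : ∀ C ∈ O, ∀ D ∈ O, (r C).1.1 = (r D).1.1 → C = D := by
    intro C hC D hD e
    have heq : r C = r D → C = D := fun e' => hdis C hC D hD _ (hrC C hC) (e' ▸ hrC D hD)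
    apply heq
    rcases eq_or_flp e with e2 | e2
    · exact Subtype.ext e2
    · exfalso
      rcases hr D hD with h | ⟨h, hy, h2⟩
      · have a1 := (r D).2 h
        have a2 := (r C).2 (e ▸ h)
        rw [e2] at a2
        simp [a1] at a2
      · apply hrA C hC
        convert h2
  have hUcard : U.card = O.ncard := by
    rw [← Set.ncard_coe_finset]
    have : (U : Set V) = (fun C => (r C).1.1) '' O := by
      ext v; simp [hU]
    rw [this, Set.ncard_image_of_injOn (fun C hC D hD e => hrinj C hC D hD e)]
  let A1 : Finset V := Finset.univ.filter (fun v => ∃ x : {x : V × Bool // x.1 ∈ S → x.2 = false},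
    x.1.1 = v ∧ Sum.inl x ∈ A)
  have hA1 : ∀ v, v ∈ A1 ↔ ∃ x : {x : V × Bool // x.1 ∈ S → x.2 = false},
    x.1.1 = v ∧ Sum.inl x ∈ A := by intro v; simp [A1]
  have hA1card : A1.card + (S.card - 2 * q) ≤ A.ncard := by
    have hx : ∀ v, v ∈ A1 → ∃ x : {x : V × Bool // x.1 ∈ S → x.2 = false},
      x.1.1 = v ∧ Sum.inl x ∈ A := fun v h => (hA1 v).1 h
    choose! gx hgx1 hgx2 using hx
    have hsub : (Finset.image (fun v => (Sum.inl (gx v) : TT S (S.card - 2 * q))) A1 ∪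
        Finset.image Sum.inr (Finset.univ : Finset (Fin (S.card - 2 * q)))).card ≤ A.ncard := by
      rw [← Set.ncard_coe_finset]
      apply Set.ncard_le_ncard _ (Set.toFinite _)
      intro t ht
      simp only [Finset.coe_union, Set.mem_union, Finset.coe_image, Set.mem_image, Finset.mem_coe] at ht
      rcases ht with ⟨v, hv, rfl⟩ | ⟨i, _, rfl⟩
      · exact hgx2 v hv
      · exact hdum i
    rw [Finset.card_union_of_disjoint, Finset.card_image_of_injOn, Finset.card_image_of_injective,
      Finset.card_univ, Fintype.card_fin] at hsub
    · exact hsub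
    · exact Sum.inr_injective
    · intro v hv w hw e
      have := Sum.inl.inj e
      rw [← hgx1 v hv, ← hgx1 w hw, this]
    · rw [Finset.disjoint_left]
      intro t ht ht'
      simp only [Finset.mem_image] at ht ht'
      obtain ⟨v, _, rfl⟩ := ht
      obtain ⟨i, _, h⟩ := ht'
      exact Sum.inr_ne_inl h
  have hUsub : U ⊆ S ∪ A1 := by
    intro v hv
    obtain ⟨C, hC, rfl⟩ := (hU v).1 hv
    rw [Finset.mem_union]
    rcases hr C hC with h | ⟨h, hy, h2⟩
    · exact Or.inl h
    · exact Or.inr ((hA1 _).2 ⟨⟨flp (r C).1, hy⟩, rfl, h2⟩)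
  obtain ⟨u0, hu0⟩ : ∃ u0, u0 ∈ U := ⟨_, (hU _).2 ⟨C0, hC0, rfl⟩⟩
  let f : TT S (S.card - 2 * q) → V := fun t =>
    if h : ∃ C ∈ O, t ∈ C then (r h.choose).1.1 else u0
  have hf1 : ∀ C ∈ O, ∀ t ∈ C, f t = (r C).1.1 := by
    intro C hC t ht
    have h : ∃ C ∈ O, t ∈ C := ⟨C, hC, ht⟩
    have e : h.choose = C := hdis _ h.choose_spec.1 _ hC t h.choose_spec.2 ht
    simp only [f]
    rw [dif_pos h, e]
  have hfU : ∀ t, f t ∈ U := by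
    intro t
    by_cases h : ∃ C ∈ O, t ∈ C
    · obtain ⟨C, hC, ht⟩ := h
      rw [hf1 C hC t ht]; exact (hU _).2 ⟨C, hC, rfl⟩
    · simp only [f]; rw [dif_neg h]; exact hu0
  have hsymm : ∀ x y, tgAdj E0 E1 S (S.card - 2 * q) x y → tgAdj E0 E1 S (S.card - 2 * q) y x := by
    rintro (x | i) (y | j) h
    · rcases h with h | h
      · left
        have := cov_symm h0 h1 (cov_flp h)
        simpa using this
      · right; rw [h, flp_flp]
    · exact h
    · exact h
    · exact h
  have hfadj : ∀ x y, x ∉ A → y ∉ A → tgAdj E0 E1 S (S.card - 2 * q) x y → f x = f y := by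
    intro x y hx hy hxy
    by_cases h : ∃ C ∈ O, x ∈ C
    · obtain ⟨C, hC, ht⟩ := h
      rw [hf1 C hC x ht, hf1 C hC y (hcl C hC x y ht hy hxy)]
    · have h' : ¬ ∃ C ∈ O, y ∈ C := by
        rintro ⟨C, hC, ht⟩
        exact h ⟨C, hC, hcl C hC y x ht hx (hsymm _ _ hxy)⟩
      simp only [f]; rw [dif_neg h, dif_neg h']
  let c0 : V → TT S (S.card - 2 * q) := fun v => Sum.inl ⟨(v, false), fun _ => rfl⟩
  let ρ : V → V := fun v => if c0 v ∉ A then f (c0 v) else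
    if h : v ∉ S then f (Sum.inl ⟨(v, true), fun h' => absurd h' h⟩) else u0
  have hkey : ∀ (x : {x : V × Bool // x.1 ∈ S → x.2 = false}), Sum.inl x ∉ A →
      f (Sum.inl x) = ρ x.1.1 := by
    rintro ⟨⟨v, b⟩, hx⟩ hxA
    by_cases hc : c0 v ∉ A
    · have e : ρ v = f (c0 v) := if_pos hc
      show _ = ρ v
      rw [e]
      cases b
      · rfl
      · exact hfadj _ _ hxA hc (Or.inr rfl)
    · cases b
      · exact absurd hxA hc
      · have hv : v ∉ S := fun h => by simpa using hx h
        show _ = ρ v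
        simp only [ρ]
        rw [if_neg hc, dif_pos hv]
  have hXU : ∀ v, v ∉ (S ∪ A1) \ U → v ∉ U → v ∉ S ∧ ∀ b (hb : v ∈ S → b = false),
      (Sum.inl ⟨(v, b), hb⟩ : TT S (S.card - 2 * q)) ∉ A := by
    intro v hv hvU
    have : v ∉ S ∪ A1 := fun h => hv (Finset.mem_sdiff.2 ⟨h, hvU⟩)
    rw [Finset.mem_union, not_or] at this
    exact ⟨this.1, fun b hb h => this.2 ((hA1 v).2 ⟨_, rfl, h⟩)⟩
  have hτ : ∀ C ∈ O, decide (c0 (r C).1.1 ∈ A) = (r C).1.2 := by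
    intro C hC
    have hrA' := hrA C hC
    rcases hh : r C with ⟨⟨v, b⟩, hb⟩
    rw [hh] at hrA'
    cases b
    · simpa using hrA'
    · have hv : v ∉ S := fun h => by simpa using hb h
      rcases hr C hC with h | ⟨h, hy, h2⟩
      · rw [hh] at h; exact absurd h hv
      · have : c0 v ∈ A := by
          convert h2 using 3
          rw [hh]; rfl
        simpa using this
  have hhalf : ∀ x y, x ∉ (S ∪ A1) \ U → y ∉ (S ∪ A1) \ U → y ∉ U → (E0 x y ∨ E1 x y) →
      ρ x = ρ y := by
    intro x y hx hy hyU hxy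
    have hyy := hXU y hy hyU
    obtain ⟨a, ha, haA⟩ : ∃ a, ∃ ha : x ∈ S → a = false,
        (Sum.inl ⟨(x, a), ha⟩ : TT S (S.card - 2 * q)) ∉ A := by
      by_cases hxU : x ∈ U
      · obtain ⟨C, hC, e⟩ := (hU x).1 hxU
        have := hrA C hC
        rcases hh : r C with ⟨⟨v, b⟩, hb⟩
        rw [hh] at this e
        simp only at e
        subst e
        exact ⟨b, hb, this⟩
      · exact ⟨false, fun _ => rfl, (hXU x hx hxU).2 _ _⟩
    have e1 := hkey _ haA
    rcases hxy with h | h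
    · have e2 := hkey ⟨(y, !a), fun h => absurd h hyy.1⟩ (hyy.2 _ _)
      rw [← e1, ← e2]
      exact hfadj _ _ haA (hyy.2 _ _) (Or.inl (Or.inl ⟨h, by simp⟩))
    · have e2 := hkey ⟨(y, a), fun h => absurd h hyy.1⟩ (hyy.2 _ _)
      rw [← e1, ← e2]
      exact hfadj _ _ haA (hyy.2 _ _) (Or.inl (Or.inr ⟨h, by simp⟩))
  have hnoadj : ∀ C ∈ O, ∀ D ∈ O, tgAdj E0 E1 S (S.card - 2 * q) (Sum.inl (r C)) (Sum.inl (r D)) →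
      (r C).1.1 = (r D).1.1 := by
    intro C hC D hD h
    have := hcl C hC _ _ (hrC C hC) (hrA D hD) h
    rw [hdis C hC D hD _ this (hrC D hD)]
  refine ⟨(S ∪ A1) \ U, U, ρ, fun v => decide (c0 v ∈ A), ?_, ⟨?_, ?_, ?_, ?_, ?_, ?_, ?_, ?_⟩⟩
  · have e1 := Finset.card_sdiff_add_card_eq_card hUsub
    have e2 := Finset.card_union_le S A1
    omega
  · intro v hv hvU
    exact (Finset.mem_sdiff.1 hv).2 hvU
  · intro s hs
    by_cases h : s ∈ U
    · exact Or.inr h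
    · exact Or.inl (Finset.mem_sdiff.2 ⟨Finset.mem_union_left _ hs, h⟩)
  · intro v _
    simp only [ρ]
    split_ifs
    all_goals first | exact hu0 | exact hfU _
  · intro u hu
    obtain ⟨C, hC, rfl⟩ := (hU u).1 hu
    rw [← hkey _ (hrA C hC), hf1 C hC _ (hrC C hC)]
  · intro x y hx hy hxy
    by_cases hyU : y ∈ U
    · by_cases hxU : x ∈ U
      · exact Or.inr ⟨hxU, hyU⟩
      · left
        exact (hhalf y x hy hx hxU (hxy.imp (h0 _ _) (h1 _ _))).symm
    · exact Or.inl (hhalf x y hx hy hyU hxy)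
  · intro x hx y hy hxy
    obtain ⟨C, hC, rfl⟩ := (hU x).1 hx
    obtain ⟨D, hD, rfl⟩ := (hU y).1 hy
    show decide (c0 (r C).1.1 ∈ A) = decide (c0 (r D).1.1 ∈ A)
    rw [hτ C hC, hτ D hD]
    by_contra hne
    have := hnoadj C hC D hD (Or.inl (Or.inl ⟨hxy, by
      exact boolflip _ _ hne⟩))
    rw [this] at hxy
    exact i0 _ hxy
  · intro x hx y hy hxy
    obtain ⟨C, hC, rfl⟩ := (hU x).1 hx
    obtain ⟨D, hD, rfl⟩ := (hU y).1 hy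
    show decide (c0 (r C).1.1 ∈ A) ≠ decide (c0 (r D).1.1 ∈ A)
    rw [hτ C hC, hτ D hD]
    intro hne
    have := hnoadj C hC D hD (Or.inl (Or.inr ⟨hxy, by
      simp only [flp_snd]; rw [hne]; simp⟩))
    rw [this] at hxy
    exact i1 _ hxy
  · intro s hs hsX
    have hsU : s ∈ U := by
      by_contra h
      exact hsX (Finset.mem_sdiff.2 ⟨Finset.mem_union_left _ hs, h⟩)
    obtain ⟨C, hC, rfl⟩ := (hU s).1 hsU
    show decide (c0 (r C).1.1 ∈ A) = false
    rw [hτ C hC]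
    exact (r C).2 hs

theorem ep_signed [Fintype V] (E0 E1 : V → V → Prop)
    (h0 : ∀ a b, E0 a b → E0 b a)
    (h1 : ∀ a b, E1 a b → E1 b a) (i0 : ∀ a, ¬ E0 a a) (i1 : ∀ a, ¬ E1 a a)
    (S : Finset V) (q : ℕ) (hq : 2 * q ≤ S.card) :
    (∃ P, OddPacking E0 E1 (S : Set V) q P) ∨
    ∃ (X U : Finset V) (ρ : V → V) (τ : V → Bool), X.card ≤ 2 * q ∧ EPOut E0 E1 S X U ρ τ := by
  classical
  let TG : SimpleGraph (TT S (S.card - 2 * q)) :=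
    { Adj := tgAdj E0 E1 S _
      symm := ⟨by
        rintro (x | i) (y | j) h
        · rcases h with h | h
          · left
            have := cov_symm h0 h1 (cov_flp h)
            simpa using this
          · right; rw [h, flp_flp]
        · exact h
        · exact h
        · exact h⟩
      loopless := ⟨by
        rintro (x | i) h
        · rcases h with (h | h) | h
          · exact i0 _ h.1
          · exact i1 _ h.1
          · exact flp_ne _ h.symm
        · exact h⟩ }
  rcases tutte_sets TG with ⟨m, hm, hmm⟩ | ⟨A, O, hAO, hO, hdis, hpar⟩
  · exact Or.inl (ep_matching E0 E1 h0 h1 i0 i1 S q hq m hm hmm)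
  · exact Or.inr (ep_violator E0 E1 h0 h1 i0 i1 S q hq A O hAO (fun C hC => (hO C hC).1)
      (fun C hC => (hO C hC).2.1) (fun C hC => (hO C hC).2.2) hdis hpar)

theorem ramsey (a b : ℕ) : ∃ n : ℕ, ∀ {α : Type} (r : α → α → Prop), (∀ x y, r x y → r y x) →
    ∀ s : Finset α, n ≤ s.card →
    (∃ u ⊆ s, u.card = a ∧ ∀ x ∈ u, ∀ y ∈ u, x ≠ y → r x y) ∨
    (∃ u ⊆ s, u.card = b ∧ ∀ x ∈ u, ∀ y ∈ u, x ≠ y → ¬ r x y) := by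
  classical
  induction a generalizing b with
  | zero => exact ⟨0, fun r _ s _ => Or.inl ⟨∅, by simp, by simp, by simp⟩⟩
  | succ a iha =>
    induction b with
    | zero => exact ⟨0, fun r _ s _ => Or.inr ⟨∅, by simp, by simp, by simp⟩⟩
    | succ b ihb =>
      obtain ⟨n1, h1⟩ := iha (b + 1)
      obtain ⟨n2, h2⟩ := ihb
      refine ⟨n1 + n2 + 1, fun {α} r hr s hs => ?_⟩
      obtain ⟨v, hv⟩ : s.Nonempty := by rw [← Finset.card_pos]; omega
      have e := Finset.card_filter_add_card_filter_not (s := s.erase v) (fun x => r v x)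
      rw [Finset.card_erase_of_mem hv] at e
      have hsub : ∀ (p : α → Prop) [DecidablePred p], (s.erase v).filter p ⊆ s := fun p _ =>
        (Finset.filter_subset _ _).trans (Finset.erase_subset _ _)
      by_cases hc : n1 ≤ ((s.erase v).filter (fun x => r v x)).card
      · rcases h1 r hr _ hc with ⟨u, hu, hcard, hp⟩ | ⟨u, hu, hcard, hp⟩
        · left
          have hvu : v ∉ u := fun h => by simpa using hu h
          refine ⟨insert v u, ?_, by rw [Finset.card_insert_of_notMem hvu, hcard], ?_⟩
          · intro x hx
            rcases Finset.mem_insert.1 hx with rfl | hx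
            · exact hv
            · exact hsub _ (hu hx)
          · intro x hx y hy hxy
            rcases Finset.mem_insert.1 hx with rfl | hx' <;> rcases Finset.mem_insert.1 hy with rfl | hy'
            · exact absurd rfl hxy
            · exact (Finset.mem_filter.1 (hu hy')).2
            · exact hr _ _ (Finset.mem_filter.1 (hu hx')).2
            · exact hp x hx' y hy' hxy
        · exact Or.inr ⟨u, hu.trans (hsub _), hcard, hp⟩
      · have hc2 : n2 ≤ ((s.erase v).filter (fun x => ¬ r v x)).card := by omega
        rcases h2 r hr _ hc2 with ⟨u, hu, hcard, hp⟩ | ⟨u, hu, hcard, hp⟩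
        · exact Or.inl ⟨u, hu.trans (hsub _), hcard, hp⟩
        · right
          have hvu : v ∉ u := fun h => by simpa using hu h
          refine ⟨insert v u, ?_, by rw [Finset.card_insert_of_notMem hvu, hcard], ?_⟩
          · intro x hx
            rcases Finset.mem_insert.1 hx with rfl | hx
            · exact hv
            · exact hsub _ (hu hx)
          · intro x hx y hy hxy
            rcases Finset.mem_insert.1 hx with rfl | hx' <;> rcases Finset.mem_insert.1 hy with rfl | hy'
            · exact absurd rfl hxy
            · exact (Finset.mem_filter.1 (hu hy')).2
            · exact fun h => (Finset.mem_filter.1 (hu hx')).2 (hr _ _ h)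
            · exact hp x hx' y hy' hxy

theorem clique_to_bip (t m : ℕ) : ∃ n : ℕ, ∀ (V : Type u) (G : SimpleGraph V), CliqueModel G n →
    OddModel G t ∨ BipModel G m := by
  classical
  obtain ⟨n, hn⟩ := ramsey m t
  refine ⟨n, fun V G ⟨B, hB⟩ => ?_⟩
  let G' : SimpleGraph V :=
    { Adj := fun a b => G.Adj a b ∧ ∃ j, a ∈ B j ∧ b ∈ B j
      symm := ⟨fun a b ⟨h, j, h1, h2⟩ => ⟨h.symm, j, h2, h1⟩⟩
      loopless := ⟨fun a h => h.1.ne rfl⟩ }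
  obtain ⟨root, lev, l1, l2, l3, l4⟩ := exists_levels G'
  let σ : V → Bool := fun v => decide (lev v % 2 = 1)
  have hstep : ∀ j v, v ∈ B j → ∀ k, lev v = k → Relation.ReflTransGen
      (fun a b => crossR G σ a b ∧ a ∈ B j ∧ b ∈ B j) (root v) v := by
    intro j v hv k
    induction k generalizing v with
    | zero => intro h; rw [l3 v h]
    | succ k ih =>
      intro h
      obtain ⟨u, ⟨hu, j', hj1, hj2⟩, hlu⟩ := l4 v (by omega)
      have e := hB.disj _ _ _ hj2 hv
      subst e
      rw [← l1 u v ⟨hu, _, hj1, hj2⟩]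
      refine (ih u hj1 (by omega)).tail ⟨⟨hu, ?_⟩, hj1, hj2⟩
      simp only [σ, hlu, ne_eq, decide_eq_decide]
      omega
  have hconn : ∀ j, Conn (crossR G σ) (B j) := by
    intro j x hx y hy
    have e : root x = root y := rtg_inv root (fun a b hab => l1 a b ⟨hab.1, j, hab.2⟩)
      (hB.conn j x hx y hy)
    have h1 := rtg_symm (fun a b (h : crossR G σ a b ∧ a ∈ B j ∧ b ∈ B j) =>
      (⟨h.1.symm, h.2.2, h.2.1⟩ : crossR G σ b a ∧ b ∈ B j ∧ a ∈ B j)) (hstep j x hx _ rfl)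
    have h2 := hstep j y hy _ rfl
    rw [← e] at h2
    exact h1.trans h2
  have key := hn (fun i j => ∃ x ∈ B i, ∃ y ∈ B j, crossR G σ x y)
    (fun i j ⟨x, hx, y, hy, h⟩ => ⟨y, hy, x, hx, h.symm⟩) Finset.univ (by simp)
  rcases key with ⟨u, _, hc, hu⟩ | ⟨u, _, hc, hu⟩
  · right
    let f := u.orderEmbOfFin hc
    refine ⟨σ, B ∘ f, ⟨fun i => hB.ne _, fun i => hconn _, fun i j v hi hj =>
      f.injective (hB.disj _ _ v hi hj), fun i j hij => ?_⟩⟩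
    exact hu _ (u.orderEmbOfFin_mem hc i) _ (u.orderEmbOfFin_mem hc j) (fun e => hij (f.injective e))
  · left
    let f := u.orderEmbOfFin hc
    refine ⟨σ, B ∘ f, ⟨fun i => hB.ne _, fun i => hconn _, fun i j v hi hj =>
      f.injective (hB.disj _ _ v hi hj), fun i j hij => ?_⟩⟩
    have hne : f i ≠ f j := (fun e => hij (f.injective e))
    obtain ⟨x, hx, y, hy, hxy⟩ := hB.adj (f i) (f j) hne
    refine ⟨x, hx, y, hy, hxy, ?_⟩
    by_contra hh
    exact hu _ (u.orderEmbOfFin_mem hc i) _ (u.orderEmbOfFin_mem hc j) hne ⟨x, hx, y, hy, hxy, hh⟩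

/-- Adjacency inside `B` avoiding `y`. -/
def avR (r : V → V → Prop) (B : Set V) (y a b : V) : Prop :=
  r a b ∧ a ∈ B ∧ b ∈ B ∧ a ≠ y ∧ b ≠ y

theorem centroid [Fintype V] (r : V → V → Prop) (hr : ∀ a b, r a b → r b a) (B : Set V)
    (hne : B.Nonempty) (hB : Conn r B) {ι : Type*} [Fintype ι] (x : ι → V) (hx : ∀ i, x i ∈ B) :
    ∃ s ∈ B, ∀ y, y ≠ s → Fintype.card ι ≤
      2 * {i | Relation.ReflTransGen (avR r B y) s (x i)}.ncard := by
  classical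
  by_contra hcon
  push Not at hcon
  have hbad : ∀ s ∈ B, ∃ y ∈ B, y ≠ s ∧
      2 * {i | Relation.ReflTransGen (avR r B y) s (x i)}.ncard < Fintype.card ι := by
    intro s hs
    obtain ⟨y, hys, hy⟩ := hcon s hs
    refine ⟨y, ?_, hys, hy⟩
    by_contra hyB
    have : {i | Relation.ReflTransGen (avR r B y) s (x i)} = Set.univ := by
      ext i
      simp only [Set.mem_setOf_eq, Set.mem_univ, iff_true]
      exact rtg_mono (fun a b h => ⟨h.1, h.2.1, h.2.2, fun e => hyB (e ▸ h.2.1),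
        fun e => hyB (e ▸ h.2.2)⟩) (hB s hs (x i) (hx i))
    rw [this, Set.ncard_univ, Nat.card_eq_fintype_card] at hy
    omega
  let K : V → V → Set V := fun s y => {v | Relation.ReflTransGen (avR r B y) s v}
  obtain ⟨s0, hs0⟩ := hne
  let PP : Finset (V × V) := Finset.univ.filter (fun p => p.1 ∈ B ∧ p.2 ∈ B ∧ p.2 ≠ p.1 ∧
    2 * {i | x i ∈ K p.1 p.2}.ncard < Fintype.card ι)
  have hPP : PP.Nonempty := by
    obtain ⟨y, h1, h2, h3⟩ := hbad s0 hs0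
    exact ⟨(s0, y), Finset.mem_filter.2 ⟨Finset.mem_univ _, hs0, h1, h2, h3⟩⟩
  obtain ⟨⟨s, y⟩, hsy, hmax⟩ := Finset.exists_max_image PP (fun p => (K p.1 p.2).ncard) hPP
  obtain ⟨_, hs, hy, hys, hw⟩ := Finset.mem_filter.1 hsy
  dsimp only at hs hy hys hw hmax
  obtain ⟨y', hy', hyy', hw'⟩ := hbad y hy
  have hKB : ∀ v ∈ K s y, v ∈ B ∧ v ≠ y := by
    intro v hv
    have hv' : Relation.ReflTransGen (avR r B y) s v := hv
    cases hv' with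
    | refl => exact ⟨hs, hys.symm⟩
    | tail _ h => exact ⟨h.2.2.1, h.2.2.2.2⟩
  have hstep : ∀ a ∈ K s y, ∀ b ∈ B, r a b → b ≠ y → b ∈ K s y := by
    intro a ha b hb hab hby
    exact Relation.ReflTransGen.tail ha ⟨hab, (hKB a ha).1, hb, (hKB a ha).2, hby⟩
  by_cases hin : y' ∈ K s y
  · have hcov : ∀ v ∈ B, v ∈ K s y ∨ v ∈ K y y' := by
      intro v hv
      have := hB y hy v hv
      induction this with
      | refl => exact Or.inr Relation.ReflTransGen.refl
      | @tail a b _ hab ih =>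
        obtain ⟨hab, ha, hb⟩ := hab
        rcases ih ha with h | h
        · by_cases hby : b = y
          · subst hby; exact Or.inr Relation.ReflTransGen.refl
          · exact Or.inl (hstep a h b hb hab hby)
        · by_cases hby : b = y'
          · subst hby; exact Or.inl hin
          · refine Or.inr (Relation.ReflTransGen.tail h ⟨hab, ha, hb, ?_, hby⟩)
            have h' : Relation.ReflTransGen (avR r B y') y a := h
            cases h' with
            | refl => exact hyy'.symm
            | tail _ h => exact h.2.2.2.2
    have hsub : (Set.univ : Set ι) ⊆ {i | x i ∈ K s y} ∪ {i | x i ∈ K y y'} :=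
      fun i _ => hcov _ (hx i)
    have h1 := Set.ncard_le_ncard hsub
    have h2 := Set.ncard_union_le {i | x i ∈ K s y} {i | x i ∈ K y y'}
    rw [Set.ncard_univ, Nat.card_eq_fintype_card] at h1
    have hw'' : 2 * {i | x i ∈ K y y'}.ncard < Fintype.card ι := hw'
    omega
  · have hk : ∃ k ∈ K s y, r k y := by
      have : ∀ v, Relation.ReflTransGen (fun a b => r a b ∧ a ∈ B ∧ b ∈ B) s v →
          v ∈ K s y ∨ ∃ k ∈ K s y, r k y := by
        intro v hv
        induction hv with
        | refl => exact Or.inl Relation.ReflTransGen.refl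
        | @tail a b _ hab ih =>
          rcases ih with h | h
          · by_cases hby : b = y
            · subst hby; exact Or.inr ⟨a, h, hab.1⟩
            · exact Or.inl (hstep a h b hab.2.2 hab.1 hby)
          · exact Or.inr h
      rcases this y (hB s hs y hy) with h | h
      · exact absurd rfl (hKB _ h).2
      · exact h
    obtain ⟨k, hk, hky⟩ := hk
    have hin2 : ∀ v, v ∈ K s y → Relation.ReflTransGen (avR r B y') s v := by
      intro v hv
      have hv' : Relation.ReflTransGen (avR r B y) s v := hv
      induction hv' with
      | refl => exact Relation.ReflTransGen.refl
      | @tail a b hsa hab ih =>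
        refine (ih hsa).tail ⟨hab.1, hab.2.1, hab.2.2.1, ?_, ?_⟩
        · rintro rfl; exact hin hsa
        · rintro rfl; exact hin hv
    have hsymm : ∀ a b, avR r B y' a b → avR r B y' b a := fun a b h =>
      ⟨hr _ _ h.1, h.2.2.1, h.2.1, h.2.2.2.2, h.2.2.2.1⟩
    have hsub : insert y (K s y) ⊆ K y y' := by
      intro v hv
      rcases hv with rfl | hv
      · exact Relation.ReflTransGen.refl
      · have h1 : avR r B y' y k := ⟨hr _ _ hky, hy, (hKB k hk).1, hyy'.symm,
          fun e => hin (e ▸ hk)⟩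
        exact Relation.ReflTransGen.head h1 ((rtg_symm hsymm (hin2 k hk)).trans (hin2 v hv))
    have h1 := Set.ncard_le_ncard hsub
    rw [Set.ncard_insert_of_notMem (fun h => (hKB _ h).2 rfl)] at h1
    have := hmax (y, y') (Finset.mem_filter.2 ⟨Finset.mem_univ _, hy, hy', hyy', hw'⟩)
    dsimp only at this
    omega

theorem exists_path_to {α : Type*} {r : α → α → Prop} {Q : α → Prop} {x y : α}
    (h : Relation.ReflTransGen r x y) (hx : ¬ Q x) (hy : Q y) :
    ∃ L : List α, L.head? = some x ∧ L.IsChain r ∧ L.Nodup ∧ (∀ a ∈ L, ¬ Q a) ∧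
      ∃ w z, L.getLast? = some w ∧ r w z ∧ Q z := by
  classical
  induction h using Relation.ReflTransGen.head_induction_on with
  | refl => exact absurd hy hx
  | @head a c hac hcy ih =>
    by_cases hc : Q c
    · exact ⟨[a], rfl, by simp, by simp, by simpa using hx, a, c, rfl, hac, hc⟩
    · obtain ⟨L, hL, hch, hnd, hQ, w, z, hw, hwz, hz⟩ := ih hc
      by_cases haL : a ∈ L
      · obtain ⟨l1, l2, rfl⟩ := List.append_of_mem haL
        refine ⟨a :: l2, rfl, (List.isChain_append.1 hch).2.1, (List.nodup_append.1 hnd).2.1,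
          fun b hb => hQ b (List.mem_append_right _ hb), w, z, ?_, hwz, hz⟩
        rw [List.getLast?_append_of_ne_nil] at hw
        · exact hw
        · simp
      · obtain ⟨l, rfl⟩ : ∃ l, L = c :: l := by
          cases L with
          | nil => simp at hL
          | cons b l => simp at hL; exact ⟨l, by rw [hL]⟩
        refine ⟨a :: c :: l, rfl, by rw [List.isChain_cons_cons]; exact ⟨hac, hch⟩,
          List.nodup_cons.2 ⟨haL, hnd⟩, ?_, w, z, by simpa using hw, hwz, hz⟩
        intro b hb
        rcases List.mem_cons.1 hb with rfl | hb
        · exact hx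
        · exact hQ b hb

structure OddPath (E0 E1 : V → V → Prop) (S : Set V) (p : List (V × Bool)) : Prop where
  chain : p.IsChain (cov E0 E1)
  nodup : (p.map Prod.fst).Nodup
  head : ∃ s ∈ S, p.head? = some (s, false)
  last : ∃ s ∈ S, p.getLast? = some (s, true)
  internal : ∀ x ∈ p, x.1 ∈ S → p.head? = some x ∨ p.getLast? = some x

theorem OddPacking.path {E0 E1 : V → V → Prop} {S : Set V} {q : ℕ} {P : Fin q → List (V × Bool)}
    (h : OddPacking E0 E1 S q P) (i : Fin q) : OddPath E0 E1 S (P i) :=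
  ⟨h.chain i, h.nodup i, h.head i, h.last i, h.internal i⟩

theorem OddPacking.ofPath {E0 E1 : V → V → Prop} {S : Set V} {q : ℕ} {P : Fin q → List (V × Bool)}
    (h : ∀ i, OddPath E0 E1 S (P i))
    (hd : ∀ i j x y, x ∈ P i → y ∈ P j → x.1 = y.1 → i = j) : OddPacking E0 E1 S q P :=
  ⟨fun i => (h i).chain, fun i => (h i).nodup, hd, fun i => (h i).head, fun i => (h i).last,
    fun i => (h i).internal⟩

theorem OddPath.rev {E0 E1 : V → V → Prop} (h0 : ∀ a b, E0 a b → E0 b a)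
    (h1 : ∀ a b, E1 a b → E1 b a) {S : Set V} {p : List (V × Bool)} (h : OddPath E0 E1 S p) :
    OddPath E0 E1 S (p.reverse.map flp) where
  chain := by
    rw [List.isChain_map, List.isChain_reverse]
    refine List.IsChain.imp (fun a b hab => ?_) h.chain
    exact cov_flp (cov_symm h0 h1 hab)
  nodup := by
    have e : (p.reverse.map flp).map Prod.fst = (p.map Prod.fst).reverse := by
      simp [Function.comp_def]
    rw [e, List.nodup_reverse]
    exact h.nodup
  head := by
    obtain ⟨s, hs, e⟩ := h.last
    exact ⟨s, hs, by rw [List.head?_map, List.head?_reverse, e]; rfl⟩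
  last := by
    obtain ⟨s, hs, e⟩ := h.head
    exact ⟨s, hs, by rw [List.getLast?_map, List.getLast?_reverse, e]; rfl⟩
  internal := by
    intro x hx hxS
    obtain ⟨y, hy, rfl⟩ := List.mem_map.1 hx
    rw [List.head?_map, List.head?_reverse, List.getLast?_map, List.getLast?_reverse]
    rcases h.internal y (List.mem_reverse.1 hy) hxS with e | e
    · right; rw [e]; rfl
    · left; rw [e]; rfl

open Classical in
noncomputable def cst (same : V → V → Prop) : List (V × Bool) → ℕ
  | [] => 0
  | [_] => 0
  | a :: b :: l => (if same a.1 b.1 then 0 else 1) + cst same (b :: l)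

theorem cst_append (same : V → V → Prop) (l1 : List (V × Bool)) (x : V × Bool)
    (l2 : List (V × Bool)) :
    cst same (l1 ++ x :: l2) = cst same (l1 ++ [x]) + cst same (x :: l2) := by
  induction l1 with
  | nil => simp [cst]
  | cons a l ih =>
    cases l with
    | nil => simp [cst]
    | cons b l => 
      simp only [List.cons_append, cst] at ih ⊢
      rw [ih, add_assoc]

theorem cst_rev (same : V → V → Prop) (hs : ∀ a b, same a b → same b a) (l : List (V × Bool)) :
    cst same (l.reverse.map flp) = cst same l := by
  induction l with
  | nil => rfl
  | cons a l ih =>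
    cases l with
    | nil => rfl
    | cons b l =>
      have e : ((a :: b :: l).reverse.map flp) = l.reverse.map flp ++ flp b :: [flp a] := by simp
      have e' : ((b :: l).reverse.map flp) = l.reverse.map flp ++ [flp b] := by simp
      rw [e, cst_append, ← e', ih]
      simp only [cst, flp_fst]
      have : same b.1 a.1 ↔ same a.1 b.1 := ⟨hs _ _, hs _ _⟩
      by_cases hh : same a.1 b.1
      · simp [hh, this.2 hh]
      · have hh' : ¬ same b.1 a.1 := fun h => hh (this.1 h)
        simp [hh, hh']
        omega

theorem cst_zero (same : V → V → Prop) (C : Set V) (hC : ∀ a b, a ∈ C → same a b → b ∈ C)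
    (x : V × Bool) (l : List (V × Bool)) (hx : x.1 ∈ C) (h : cst same (x :: l) = 0) :
    ∀ y ∈ l, y.1 ∈ C := by
  induction l generalizing x with
  | nil => simp
  | cons b l ih =>
    simp only [cst] at h
    have h1 : same x.1 b.1 := by
      by_contra hn
      rw [if_neg hn] at h; omega
    have hb := hC _ _ hx h1
    intro y hy
    rcases List.mem_cons.1 hy with rfl | hy
    · exact hb
    · exact ih b hb (by omega) y hy

theorem cst_eq_zero (same : V → V → Prop) (l : List (V × Bool))
    (h : ∀ a ∈ l, ∀ b ∈ l, same a.1 b.1) : cst same l = 0 := by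
  induction l with
  | nil => rfl
  | cons a l ih =>
    cases l with
    | nil => rfl
    | cons b l =>
      simp only [cst]
      rw [if_pos (h a (by simp) b (by simp)), ih (fun a ha b hb => h a (by simp [ha]) b (by simp [hb]))]

theorem reroute {E0 E1 : V → V → Prop} (h0 : ∀ a b, E0 a b → E0 b a)
    {S : Set V} {l1 l2 : List (V × Bool)} {v : V} (hp : OddPath E0 E1 S (l1 ++ (v, true) :: l2))
    (hv : v ∉ S) (T : List V) (hT : T.IsChain E0) (hnd : T.Nodup)
    (hTp : ∀ a ∈ T, ∀ x ∈ l1 ++ (v, true) :: l2, x.1 ≠ a) (s : V) (hs : s ∈ S)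
    (hhead : T.head? = some s) (hTS : ∀ a ∈ T, a ∈ S → a = s) (w : V) (hw : T.getLast? = some w)
    (hwv : E0 w v) : OddPath E0 E1 S (l1 ++ (v, true) :: T.reverse.map (fun a => (a, true))) where
  chain := by
    have h := hp.chain
    rw [List.isChain_append] at h ⊢
    refine ⟨h.1, ?_, ?_⟩
    · rw [List.isChain_cons]
      constructor
      · intro y hy
        rw [List.head?_map, List.head?_reverse, hw] at hy
        obtain rfl : (w, true) = y := by simpa using hy
        exact Or.inl ⟨h0 _ _ hwv, rfl⟩
      · rw [List.isChain_map, List.isChain_reverse]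
        exact List.IsChain.imp (fun a b hab => Or.inl ⟨h0 _ _ hab, rfl⟩) hT
    · intro x hx y hy
      exact h.2.2 x hx y (by simpa using hy)
  nodup := by
    have h := hp.nodup
    simp only [List.map_append, List.map_cons] at h ⊢
    rw [List.nodup_append] at h ⊢
    have e : (List.map Prod.fst (List.map (fun a => (a, true)) T.reverse)) = T.reverse := by
      simp [Function.comp_def]
    rw [e]
    refine ⟨h.1, ?_, ?_⟩
    · rw [List.nodup_cons]
      refine ⟨fun hm => ?_, List.nodup_reverse.2 hnd⟩
      exact hTp v (List.mem_reverse.1 hm) (v, true) (by simp) rfl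
    · intro a ha b hb
      rcases List.mem_cons.1 hb with rfl | hb
      · exact h.2.2 a ha _ (by simp)
      · obtain ⟨x, hx, rfl⟩ := List.mem_map.1 ha
        exact hTp b (List.mem_reverse.1 hb) x (by simp [hx])
  head := by
    obtain ⟨a, ha, e⟩ := hp.head
    refine ⟨a, ha, ?_⟩
    cases l1 with
    | nil => simp at e
    | cons b l => simpa using e
  last := by
    refine ⟨s, hs, ?_⟩
    cases T with
    | nil => simp at hhead
    | cons b l =>
      simp at hhead; simp [hhead]
      rw [← List.cons_append, List.getLast?_append]; rfl
  internal := by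
    intro x hx hxS
    have hT0 : T ≠ [] := by rintro rfl; simp at hhead
    rcases List.mem_append.1 hx with hx1 | hx1
    · have hne : l1 ≠ [] := by rintro rfl; simp at hx1
      rcases hp.internal x (List.mem_append_left _ hx1) hxS with e | e
      · left
        rw [List.head?_append_of_ne_nil _ hne] at e ⊢
        exact e
      · exfalso
        rw [List.getLast?_append_of_ne_nil] at e
        · have hm := List.mem_of_getLast? e
          have h := hp.nodup
          rw [List.map_append, List.nodup_append] at h
          exact h.2.2 x.1 (List.mem_map_of_mem hx1) x.1 (List.mem_map_of_mem hm) rfl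
        · simp
    · rcases List.mem_cons.1 hx1 with rfl | hx2
      · exact absurd hxS hv
      · obtain ⟨a, ha, rfl⟩ := List.mem_map.1 hx2
        have := hTS a (List.mem_reverse.1 ha) hxS
        subst this
        right
        cases T with
        | nil => simp at hhead
        | cons b l =>
          simp at hhead; simp [hhead]
          rw [← List.cons_append, List.getLast?_append]; rfl

theorem good_packing {E0 E1 : V → V → Prop} (h0 : ∀ a b, E0 a b → E0 b a)
    (h1 : ∀ a b, E1 a b → E1 b a) {m q : ℕ} (B : Fin m → Set V) (hconn : ∀ j, Conn E0 (B j))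
    (hdisj : ∀ i j v, v ∈ B i → v ∈ B j → i = j) (s : Fin m → V) (hs : ∀ j, s j ∈ B j)
    (hP : ∃ P, OddPacking E0 E1 (Set.range s) q P) :
    ∃ P, OddPacking E0 E1 (Set.range s) q P ∧
      ∀ j, (∀ i x, x ∈ P i → x.1 ≠ s j) → ∀ i x, x ∈ P i → x.1 ∉ B j := by
  classical
  let same : V → V → Prop := fun a b => ∃ j, a ∈ B j ∧ b ∈ B j
  have hsame : ∀ a b, same a b → same b a := fun a b ⟨j, h, h'⟩ => ⟨j, h', h⟩
  let cost : (Fin q → List (V × Bool)) → ℕ := fun P => ∑ i, cst same (P i)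
  have hex : ∃ n, ∃ P, OddPacking E0 E1 (Set.range s) q P ∧ cost P = n := by
    obtain ⟨P, hP⟩ := hP
    exact ⟨_, P, hP, rfl⟩
  obtain ⟨P, hP, hPn⟩ := Nat.find_spec hex
  have hmin : ∀ P', OddPacking E0 E1 (Set.range s) q P' → cost P ≤ cost P' := by
    intro P' h'
    rw [hPn]
    exact Nat.find_min' hex ⟨P', h', rfl⟩
  refine ⟨P, hP, ?_⟩
  intro j hj i0 x0 hx0 hx0B
  let Q : V → Prop := fun v => ∃ i, ∃ x ∈ P i, x.1 = v
  obtain ⟨T, hThead, hTch, hTnd, hTQ, w, z, hTw, hwz, i, x, hxi, hxz⟩ :=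
    exists_path_to (Q := Q) (hconn j (s j) (hs j) x0.1 hx0B)
      (fun ⟨i, x, hx, e⟩ => hj i x hx e) ⟨i0, x0, hx0, rfl⟩
  have hTB : ∀ a ∈ T, a ∈ B j := by
    have hb : ∀ (T : List V) a0, T.head? = some a0 → a0 ∈ B j →
        T.IsChain (fun a b => E0 a b ∧ a ∈ B j ∧ b ∈ B j) → ∀ a ∈ T, a ∈ B j := by
      intro T
      induction T with
      | nil => simp
      | cons b l ih =>
        intro a0 e ha0 hc a ha
        obtain rfl : b = a0 := by simpa using e
        rcases List.mem_cons.1 ha with rfl | ha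
        · exact ha0
        · cases l with
          | nil => simp at ha
          | cons c l =>
            rw [List.isChain_cons_cons] at hc
            exact ih c rfl hc.1.2.2 hc.2 a ha
    exact hb T _ hThead (hs j) hTch
  have hTch' : T.IsChain E0 := List.IsChain.imp (fun a b h => h.1) hTch
  have hTS : ∀ a ∈ T, a ∈ Set.range s → a = s j := by
    rintro a ha ⟨j', rfl⟩
    rw [hdisj _ _ _ (hs j') (hTB _ ha)]
  have key : ∀ p : List (V × Bool), OddPath E0 E1 (Set.range s) p →
      (∀ y ∈ p, ∃ x' ∈ P i, x'.1 = y.1) → (z, true) ∈ p → cst same p = cst same (P i) → False := by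
    intro p hp hpi hzp hcost
    obtain ⟨l1, l2, rfl⟩ := List.append_of_mem hzp
    have hzS : z ∉ Set.range s := by
      rintro ⟨j', rfl⟩
      have := hdisj _ _ _ (hs j') hwz.2.2
      subst this
      exact hj i x hxi hxz
    have hnew := reroute h0 hp hzS T hTch' hTnd (by
      intro a ha y hy e
      obtain ⟨x', hx', e'⟩ := hpi y hy
      exact hTQ a ha ⟨i, x', hx', e'.trans e⟩) (s j) ⟨j, rfl⟩ hThead hTS w hTw hwz.1
    have hmem : ∀ y ∈ l1 ++ (z, true) :: T.reverse.map (fun a => (a, true)),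
        (∃ x' ∈ P i, x'.1 = y.1) ∨ y.1 ∈ T := by
      intro y hy
      rcases List.mem_append.1 hy with hy | hy
      · exact Or.inl (hpi y (by simp [hy]))
      · rcases List.mem_cons.1 hy with rfl | hy
        · exact Or.inl (hpi _ (by simp))
        · right
          obtain ⟨a, ha, rfl⟩ := List.mem_map.1 hy
          exact List.mem_reverse.1 ha
    have hlt : cst same (l1 ++ (z, true) :: T.reverse.map (fun a => (a, true))) <
        cst same (P i) := by
      rw [← hcost, cst_append, cst_append same l1 (z, true) l2]
      have e1 : cst same ((z, true) :: T.reverse.map (fun a => (a, true))) = 0 := by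
        apply cst_eq_zero
        have : ∀ a ∈ ((z, true) :: T.reverse.map (fun a => (a, true))), a.1 ∈ B j := by
          intro a ha
          rcases List.mem_cons.1 ha with rfl | ha
          · exact hwz.2.2
          · obtain ⟨b, hb, rfl⟩ := List.mem_map.1 ha
            exact hTB b (List.mem_reverse.1 hb)
        intro a ha b hb
        exact ⟨j, this a ha, this b hb⟩
      have e2 : cst same ((z, true) :: l2) ≠ 0 := by
        intro e
        have hz := cst_zero same (B j) (fun a b ha ⟨j', h, h'⟩ => by
          rw [hdisj _ _ _ ha h]; exact h') (z, true) l2 hwz.2.2 e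
        obtain ⟨_, ⟨b, rfl⟩, hb⟩ := hp.last
        rw [List.getLast?_append_of_ne_nil _ (by simp)] at hb
        have hm := List.mem_of_getLast? hb
        have hBj : s b ∈ B j := by
          rcases List.mem_cons.1 hm with e | hm
          · have : s b = z := congrArg Prod.fst e
            rw [this]; exact hwz.2.2
          · exact hz _ hm
        have := hdisj _ _ _ (hs b) hBj
        subst this
        obtain ⟨x', hx', e'⟩ := hpi (s b, true) (List.mem_append_right _ hm)
        exact hj i x' hx' e'
      omega
    have hpack : OddPacking E0 E1 (Set.range s) q
        (Function.update P i (l1 ++ (z, true) :: T.reverse.map (fun a => (a, true)))) := by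
      apply OddPacking.ofPath
      · intro i'
        by_cases e : i' = i
        · subst e; rw [Function.update_self]; exact hnew
        · rw [Function.update_of_ne e]; exact hP.path i'
      · have haux : ∀ i' a b, i' ≠ i → a ∈ l1 ++ (z, true) :: T.reverse.map (fun a => (a, true)) →
            b ∈ P i' → a.1 ≠ b.1 := by
          intro i' a b hi' ha hb e
          rcases hmem a ha with ⟨x', hx', e'⟩ | h
          · exact hi' (hP.disj i' i b x' hb hx' (e.symm.trans e'.symm))
          · exact hTQ _ h ⟨i', b, hb, e.symm⟩
        intro a b x y hx hy hxy
        by_cases ea : a = i <;> by_cases eb : b = i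
        · rw [ea, eb]
        · subst ea
          rw [Function.update_self] at hx
          rw [Function.update_of_ne eb] at hy
          exact absurd hxy (haux _ _ _ eb hx hy)
        · subst eb
          rw [Function.update_self] at hy
          rw [Function.update_of_ne ea] at hx
          exact absurd hxy.symm (haux _ _ _ ea hy hx)
        · rw [Function.update_of_ne ea] at hx
          rw [Function.update_of_ne eb] at hy
          exact hP.disj _ _ _ _ hx hy hxy
    have := hmin _ hpack
    have hlt2 : cost (Function.update P i (l1 ++ (z, true) :: T.reverse.map (fun a => (a, true))))
        < cost P := by
      apply Finset.sum_lt_sum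
      · intro i' _
        by_cases e : i' = i
        · subst e; rw [Function.update_self]; exact hlt.le
        · rw [Function.update_of_ne e]
      · exact ⟨i, Finset.mem_univ _, by rw [Function.update_self]; exact hlt⟩
    omega
  rcases x with ⟨v, κ⟩
  dsimp only at hxz
  subst hxz
  cases κ with
  | true => exact key (P i) (hP.path i) (fun y hy => ⟨y, hy, rfl⟩) hxi rfl
  | false =>
    refine key _ ((hP.path i).rev h0 h1) ?_ ?_ (cst_rev same hsame _)
    · intro y hy
      obtain ⟨x', hx', rfl⟩ := List.mem_map.1 hy
      exact ⟨x', List.mem_reverse.1 hx', rfl⟩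
    · exact List.mem_map.2 ⟨(v, false), List.mem_reverse.2 hxi, rfl⟩

def liftR {α : Type*} (C : α → Set V) (r : V → V → Prop) (p p' : α) : Prop :=
  p ≠ p' ∧ ∃ a ∈ C p, ∃ b ∈ C p', r a b

theorem liftR.symm {α : Type*} {C : α → Set V} {r : V → V → Prop} (hr : ∀ a b, r a b → r b a)
    (p p' : α) (h : liftR C r p p') : liftR C r p' p := by
  obtain ⟨h, a, ha, b, hb, hab⟩ := h
  exact ⟨h.symm, b, hb, a, ha, hr _ _ hab⟩

theorem conn_union {r : V → V → Prop} (hr : ∀ a b, r a b → r b a) {A B : Set V} (hA : Conn r A)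
    (hB : Conn r B) {a b : V} (ha : a ∈ A) (hb : b ∈ B) (hab : r a b) : Conn r (A ∪ B) := by
  have hs : ∀ x y, (r x y ∧ x ∈ A ∪ B ∧ y ∈ A ∪ B) → (r y x ∧ y ∈ A ∪ B ∧ x ∈ A ∪ B) :=
    fun x y h => ⟨hr _ _ h.1, h.2.2, h.2.1⟩
  have h1 : ∀ x ∈ A ∪ B, Relation.ReflTransGen (fun x y => r x y ∧ x ∈ A ∪ B ∧ y ∈ A ∪ B) a x := by
    intro x hx
    rcases hx with hx | hx
    · exact rtg_mono (fun x y h => ⟨h.1, Or.inl h.2.1, Or.inl h.2.2⟩) (hA a ha x hx)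
    · exact Relation.ReflTransGen.head ⟨hab, Or.inl ha, Or.inr hb⟩
        (rtg_mono (fun x y h => ⟨h.1, Or.inr h.2.1, Or.inr h.2.2⟩) (hB b hb x hx))
  intro x hx y hy
  exact (rtg_symm hs (h1 x hx)).trans (h1 y hy)

theorem conn_list {α : Type*} {r : V → V → Prop} (hr : ∀ a b, r a b → r b a) (D : α → Set V)
    (l : List α) (hch : l.IsChain (fun x y => ∃ a ∈ D x, ∃ b ∈ D y, r a b))
    (hD : ∀ x ∈ l, Conn r (D x)) : Conn r {v | ∃ x ∈ l, v ∈ D x} := by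
  induction l with
  | nil => intro x hx; simp at hx
  | cons x l ih =>
    cases l with
    | nil => simpa using hD x (by simp)
    | cons y l =>
      rw [List.isChain_cons_cons] at hch
      obtain ⟨⟨a, ha, b, hb, hab⟩, hch⟩ := hch
      have := conn_union hr (hD x (by simp)) (ih hch (fun z hz => hD z (List.mem_cons_of_mem _ hz)))
        ha ⟨y, by simp, hb⟩ hab
      have e : {v | ∃ z ∈ x :: y :: l, v ∈ D z} = D x ∪ {v | ∃ z ∈ y :: l, v ∈ D z} := by
        ext v
        constructor
        · rintro ⟨z, hz, hv⟩
          rcases List.mem_cons.1 hz with rfl | hz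
          · exact Or.inl hv
          · exact Or.inr ⟨z, hz, hv⟩
        · rintro (hv | ⟨z, hz, hv⟩)
          · exact ⟨x, by simp, hv⟩
          · exact ⟨z, List.mem_cons_of_mem _ hz, hv⟩
      rw [e]; exact this

theorem isChain_imp_mem {α : Type*} {r s : α → α → Prop} (l : List α)
    (h : ∀ x ∈ l, ∀ y ∈ l, r x y → s x y) (hl : l.IsChain r) : l.IsChain s := by
  induction l with
  | nil => simp
  | cons x l ih =>
    cases l with
    | nil => simp
    | cons y l =>
      rw [List.isChain_cons_cons] at hl ⊢
      exact ⟨h x (by simp) y (by simp) hl.1,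
        ih (fun a ha b hb => h a (List.mem_cons_of_mem _ ha) b (List.mem_cons_of_mem _ hb)) hl.2⟩

theorem oddModel_of_packing {α : Type*} (G : SimpleGraph V) (σ : V → Bool) (C : α → Set V)
    (hdisj : ∀ p p' v, v ∈ C p → v ∈ C p' → p = p') (hconn : ∀ p, Conn (crossR G σ) (C p))
    (S' : Set α) (hSne : ∀ p ∈ S', (C p).Nonempty)
    (hS : ∀ p ∈ S', ∀ p' ∈ S', p ≠ p' → ∃ a ∈ C p, ∃ b ∈ C p', crossR G σ a b)
    (t : ℕ) (Q : Fin t → List (α × Bool))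
    (hQ : OddPacking (liftR C (crossR G σ)) (liftR C (monoR G σ)) S' t Q) : OddModel G t := by
  classical
  let lab : V → Bool := fun v => decide (∃ l, ∃ x ∈ Q l, v ∈ C x.1 ∧ x.2 = true)
  have huniq : ∀ l x l' y v, x ∈ Q l → y ∈ Q l' → v ∈ C x.1 → v ∈ C y.1 → l = l' ∧ x = y := by
    intro l x l' y v hx hy hvx hvy
    have e := hdisj _ _ _ hvx hvy
    have hl := hQ.disj _ _ _ _ hx hy e
    subst hl
    exact ⟨rfl, List.inj_on_of_nodup_map (hQ.nodup l) hx hy e⟩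
  have hlab : ∀ l x v, x ∈ Q l → v ∈ C x.1 → lab v = x.2 := by
    intro l x v hx hv
    cases hb : x.2 with
    | true => exact decide_eq_true ⟨l, x, hx, hv, hb⟩
    | false =>
      apply decide_eq_false
      rintro ⟨l', y, hy, hvy, h2⟩
      obtain ⟨_, rfl⟩ := huniq _ _ _ _ _ hx hy hv hvy
      rw [hb] at h2; exact Bool.noConfusion h2
  let σ' : V → Bool := fun v => xor (σ v) (lab v)
  have hcr : ∀ a b, crossR G σ a b → lab a = lab b → crossR G σ' a b := by
    intro a b h e
    refine ⟨h.1, ?_⟩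
    simp only [σ', e]
    intro h'
    exact h.2 (Bool.xor_left_inj.1 h')
  have hmn : ∀ a b, monoR G σ a b → lab a ≠ lab b → crossR G σ' a b := by
    intro a b h e
    refine ⟨h.1, ?_⟩
    simp only [σ', h.2]
    intro h'
    exact e (Bool.xor_right_inj.1 h')
  have hcm : ∀ a b, crossR G σ a b → lab a = false → lab b = true → monoR G σ' a b := by
    intro a b h e e'
    refine ⟨h.1, ?_⟩
    have := h.2
    simp only [σ', e, e']
    revert this
    generalize σ a = x
    generalize σ b = y
    cases x <;> cases y <;> simp
  refine ⟨σ', fun l => {v | ∃ x ∈ Q l, v ∈ C x.1}, ⟨?_, ?_, ?_, ?_⟩⟩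
  · intro l
    obtain ⟨s, hs, e⟩ := hQ.head l
    obtain ⟨v, hv⟩ := hSne s hs
    exact ⟨v, (s, false), List.mem_of_head? e, hv⟩
  · intro l
    refine conn_list (fun a b h => h.symm) (fun x : α × Bool => C x.1) (Q l) ?_ ?_
    · refine isChain_imp_mem (Q l) ?_ (hQ.chain l)
      rintro x hx y hy (⟨⟨_, a, ha, b, hb, hab⟩, e⟩ | ⟨⟨_, a, ha, b, hb, hab⟩, e⟩)
      · exact ⟨a, ha, b, hb, hcr a b hab (by rw [hlab l x a hx ha, hlab l y b hy hb, e])⟩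
      · exact ⟨a, ha, b, hb, hmn a b hab (by rw [hlab l x a hx ha, hlab l y b hy hb]; exact e)⟩
    · intro x hx a ha b hb
      refine rtg_mono ?_ (hconn x.1 a ha b hb)
      rintro c d ⟨h, hc, hd⟩
      exact ⟨hcr c d h (by rw [hlab l x c hx hc, hlab l x d hx hd]), hc, hd⟩
  · rintro l l' v ⟨x, hx, hvx⟩ ⟨y, hy, hvy⟩
    exact (huniq _ _ _ _ _ hx hy hvx hvy).1
  · intro l l' hll
    obtain ⟨s, hs, e⟩ := hQ.head l
    obtain ⟨s', hs', e'⟩ := hQ.last l'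
    have hne : s ≠ s' := by
      intro h
      exact hll (hQ.disj _ _ _ _ (List.mem_of_head? e) (List.mem_of_getLast? e') h)
    obtain ⟨a, ha, b, hb, hab⟩ := hS s hs s' hs' hne
    have h1 := List.mem_of_head? e
    have h2 := List.mem_of_getLast? e'
    exact ⟨a, ⟨_, h1, ha⟩, b, ⟨_, h2, hb⟩, hcm a b hab (hlab l _ a h1 ha) (hlab l' _ b h2 hb)⟩

theorem EPOut.escape {E0 E1 : V → V → Prop} {S X U : Finset V} {ρ : V → V} {τ : V → Bool}
    (h : EPOut E0 E1 S X U ρ τ) (u : V) (hu : u ∈ U) (l : List (V × Bool)) (w z : V × Bool)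
    (hch : (w :: l).IsChain (cov E0 E1))
    (hX : ∀ x ∈ w :: l, x.1 ∉ X) (hw : w.1 ∉ U) (hρ : ρ w.1 = u) (hul : ∀ x ∈ l, x.1 ≠ u)
    (hz : (w :: l).getLast? = some z) : z.1 ∉ U := by
  induction l generalizing w with
  | nil =>
    obtain rfl : w = z := by simpa using hz
    exact hw
  | cons y l ih =>
    rw [List.isChain_cons_cons] at hch
    have hE : E0 w.1 y.1 ∨ E1 w.1 y.1 := hch.1.imp (fun h => h.1) (fun h => h.1)
    have e : ρ w.1 = ρ y.1 := by
      rcases h.rho_adj _ _ (hX w (by simp)) (hX y (by simp)) hE with h' | h'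
      · exact h'
      · exact absurd h'.1 hw
    refine ih y hch.2 (fun x hx => hX x (List.mem_cons_of_mem _ hx)) ?_ (e ▸ hρ)
      (fun x hx => hul x (List.mem_cons_of_mem _ hx)) (by simpa using hz)
    intro hy
    rw [h.rho_fix _ hy] at e
    exact hul y (by simp) (e.symm.trans hρ)

theorem EPOut.parity {E0 E1 : V → V → Prop} {S X U : Finset V} {ρ : V → V} {τ : V → Bool}
    (h : EPOut E0 E1 S X U ρ τ) (l : List (V × Bool)) (w z : V × Bool)
    (hch : (w :: l).IsChain (cov E0 E1)) (hnd : ((w :: l).map Prod.fst).Nodup)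
    (hX : ∀ x ∈ w :: l, x.1 ∉ X) (hw : w.1 ∈ U)
    (hz : (w :: l).getLast? = some z) (hzU : z.1 ∈ U) :
    xor (τ w.1) w.2 = xor (τ z.1) z.2 := by
  induction l generalizing w with
  | nil =>
    obtain rfl : w = z := by simpa using hz
    rfl
  | cons y l ih =>
    rw [List.isChain_cons_cons] at hch
    have hE : E0 w.1 y.1 ∨ E1 w.1 y.1 := hch.1.imp (fun h => h.1) (fun h => h.1)
    rw [List.map_cons, List.nodup_cons] at hnd
    have hX' : ∀ x ∈ y :: l, x.1 ∉ X := fun x hx => hX x (List.mem_cons_of_mem _ hx)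
    have hz' : (y :: l).getLast? = some z := by simpa using hz
    by_cases hy : y.1 ∈ U
    · rw [← ih y hch.2 hnd.2 hX' hy hz']
      rcases hch.1 with ⟨h1, h2⟩ | ⟨h1, h2⟩
      · rw [h.tau0 _ hw _ hy h1, h2]
      · have := h.tau1 _ hw _ hy h1
        revert this h2
        generalize τ w.1 = a
        generalize τ y.1 = b
        generalize w.2 = c
        generalize y.2 = d
        cases a <;> cases b <;> cases c <;> cases d <;> simp
    · exfalso
      have e : ρ w.1 = ρ y.1 := by
        rcases h.rho_adj _ _ (hX w (by simp)) (hX y (by simp)) hE with h' | h'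
        · exact h'
        · exact absurd h'.2 hy
      rw [h.rho_fix _ hw] at e
      refine h.escape w.1 hw l y z hch.2 hX' hy e.symm ?_ hz' hzU
      intro x hx hxw
      exact hnd.1 (List.mem_map.2 ⟨x, List.mem_cons_of_mem _ hx, hxw⟩)

theorem EPOut.const {E0 E1 : V → V → Prop} {S X U : Finset V} {ρ : V → V} {τ : V → Bool}
    (h : EPOut E0 E1 S X U ρ τ) {a b : V} (ha : a ∉ X) (hb : b ∉ X) (hab : E0 a b) :
    τ (ρ a) = τ (ρ b) := by
  rcases h.rho_adj a b ha hb (Or.inl hab) with e | ⟨e1, e2⟩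
  · rw [e]
  · rw [h.rho_fix _ e1, h.rho_fix _ e2, h.tau0 _ e1 _ e2 hab]

theorem exists_centroids [Fintype V] (G : SimpleGraph V) (σ : V → Bool) {m : ℕ} (B : Fin m → Set V)
    (hB : SModel (crossR G σ) (crossR G σ) B) : ∃ s : Fin m → V, (∀ j, s j ∈ B j) ∧
    ∀ j y, y ≠ s j → m - 1 ≤ 2 * {i | ∃ v, v ∈ B j ∧
      Relation.ReflTransGen (avR (crossR G σ) (B j) y) (s j) v ∧
      ∃ w ∈ B i, crossR G σ v w}.ncard := by
  classical
  have : ∀ j, ∃ s ∈ B j, ∀ y, y ≠ s → m - 1 ≤ 2 * {i | ∃ v, v ∈ B j ∧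
      Relation.ReflTransGen (avR (crossR G σ) (B j) y) s v ∧
      ∃ w ∈ B i, crossR G σ v w}.ncard := by
    intro j
    have hx : ∀ i : {i // i ≠ j}, ∃ v, v ∈ B j ∧ ∃ w ∈ B i.1, crossR G σ v w := fun i =>
      hB.adj j i.1 (fun e => i.2 e.symm)
    choose x hxB hxw using hx
    obtain ⟨s, hs, h⟩ := centroid (crossR G σ) (fun a b h => h.symm) (B j) (hB.ne j) (hB.conn j) x hxB
    refine ⟨s, hs, fun y hy => ?_⟩
    have h1 := h y hy
    have hc : Fintype.card {i // i ≠ j} = m - 1 := by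
      rw [Fintype.card_subtype_compl]; simp
    rw [hc] at h1
    refine h1.trans (Nat.mul_le_mul_left _ ?_)
    refine Set.ncard_le_ncard_of_injOn (fun i => i.1) ?_ ?_ (Set.toFinite _)
    · intro i hi
      exact ⟨x i, hxB i, hi, hxw i⟩
    · intro a _ b _ e
      exact Subtype.ext e
  choose s hs h using this
  exact ⟨s, hs, h⟩

set_option maxHeartbeats 1000000 in
theorem T_core [Fintype V] (G : SimpleGraph V) (σ : V → Bool) (t : ℕ) {m : ℕ} (B : Fin m → Set V)
    (hB : SModel (crossR G σ) (crossR G σ) B) (hno : ¬ OddModel G t) (hm : 20 * t + 20 ≤ m) :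
    ∃ s : Fin m → V, (∀ j, s j ∈ B j) ∧ ∃ (X U : Finset V) (ρ : V → V) (τ : V → Bool) (S : Finset V),
      (∀ v, v ∈ S ↔ ∃ j, s j = v) ∧
      X.card ≤ 2 * (4 * t + 1) ∧ EPOut (crossR G σ) (monoR G σ) S X U ρ τ := by
  classical
  obtain ⟨s, hsB, hcen⟩ := exists_centroids G σ B hB
  refine ⟨s, hsB, ?_⟩
  have hsinj : Function.Injective s := fun a b e => hB.disj _ _ _ (hsB a) (e ▸ hsB b)
  have hcard : (Finset.univ.image s).card = m := by
    rw [Finset.card_image_of_injective _ hsinj]; simp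
  rcases ep_signed (crossR G σ) (monoR G σ) (fun _ _ h => h.symm) (fun _ _ h => h.symm)
    (fun a h => h.1.ne rfl) (fun a h => h.1.ne rfl) (Finset.univ.image s) (4 * t + 1)
    (by omega) with hP | ⟨X, U, ρ, τ, hX, h⟩
  swap
  · exact ⟨X, U, ρ, τ, _, by simp, hX, h⟩
  exfalso
  have hrange : ((Finset.univ.image s : Finset V) : Set V) = Set.range s := by simp
  rw [hrange] at hP
  obtain ⟨P, hP, hgood⟩ := good_packing (fun _ _ h => h.symm) (fun _ _ h => h.symm) B hB.conn hB.disj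
    s hsB hP
  have hha : ∀ i, ∃ a, (P i).head? = some (s a, false) := fun i => by
    obtain ⟨_, ⟨a, rfl⟩, e⟩ := hP.head i
    exact ⟨a, e⟩
  have hhb : ∀ i, ∃ a, (P i).getLast? = some (s a, true) := fun i => by
    obtain ⟨_, ⟨a, rfl⟩, e⟩ := hP.last i
    exact ⟨a, e⟩
  choose ha hha using hha
  choose hb hhb using hhb
  -- unused indices
  let J : Finset (Fin m) := Finset.univ.filter (fun j => ∀ i x, x ∈ P i → x.1 ≠ s j)
  have hJ : ∀ j, j ∈ J ↔ ∀ i x, x ∈ P i → x.1 ≠ s j := by simp [J]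
  have hJc : Jᶜ ⊆ Finset.univ.image ha ∪ Finset.univ.image hb := by
    intro j hj
    rw [Finset.mem_compl, hJ] at hj
    push Not at hj
    obtain ⟨i, x, hx, e⟩ := hj
    rw [Finset.mem_union]
    rcases hP.internal i x hx ⟨j, e.symm⟩ with h | h
    · left
      rw [hha] at h
      have : s (ha i) = x.1 := congrArg Prod.fst (Option.some.inj h)
      exact Finset.mem_image.2 ⟨i, Finset.mem_univ _, hsinj (this.trans e)⟩
    · right
      rw [hhb] at h
      have : s (hb i) = x.1 := congrArg Prod.fst (Option.some.inj h)
      exact Finset.mem_image.2 ⟨i, Finset.mem_univ _, hsinj (this.trans e)⟩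
  have hJcard : Jᶜ.card ≤ 2 * (4 * t + 1) := by
    have h1 := Finset.card_le_card hJc
    have h2 := Finset.card_union_le (Finset.univ.image ha) (Finset.univ.image hb)
    have h3 := Finset.card_image_le (s := Finset.univ) (f := ha)
    have h4 := Finset.card_image_le (s := Finset.univ) (f := hb)
    rw [Finset.card_univ, Fintype.card_fin] at h3 h4
    omega
  have hJcard2 : J.card + Jᶜ.card = m := by
    rw [Finset.card_add_card_compl, Fintype.card_fin]
  have haJ : ∀ i, ha i ∉ J := fun i h => (hJ _).1 h i _ (List.mem_of_head? (hha i)) rfl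
  have hbJ : ∀ i, hb i ∉ J := fun i h => (hJ _).1 h i _ (List.mem_of_getLast? (hhb i)) rfl
  let Wt : Set V := {v | (∃ i, ∃ x ∈ P i, x.1 = v) ∨ ∃ b, b ∉ J ∧ v ∈ B b}
  have hWJ : ∀ v ∈ Wt, ∀ j ∈ J, v ∉ B j := by
    rintro v (⟨i, x, hx, rfl⟩ | ⟨b, hb, hv⟩) j hj hvj
    · exact hgood j ((hJ j).1 hj) i x hx hvj
    · rw [hB.disj _ _ _ hv hvj] at hb; exact hb hj
  let C : V ⊕ Fin m → Set V := Sum.elim (fun v => {u | u = v ∧ v ∈ Wt}) (fun j => {u | u ∈ B j ∧ j ∈ J})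
  have hCdisj : ∀ p p' v, v ∈ C p → v ∈ C p' → p = p' := by
    rintro (v | j) (w | k) u h1 h2
    · rw [← h1.1, ← h2.1]
    · exact absurd h2.1 (hWJ _ (h1.1 ▸ h1.2) _ h2.2)
    · exact absurd h1.1 (hWJ _ (h2.1 ▸ h2.2) _ h1.2)
    · rw [hB.disj _ _ _ h1.1 h2.1]
  have hCconn : ∀ p, Conn (crossR G σ) (C p) := by
    rintro (v | j) a ha b hb
    · rw [ha.1, hb.1]
    · refine rtg_mono ?_ (hB.conn j a ha.1 b hb.1)
      intro x y h
      exact ⟨h.1, ⟨h.2.1, ha.2⟩, ⟨h.2.2, ha.2⟩⟩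
  let S' : Finset (V ⊕ Fin m) := J.image Sum.inr
  have hS'mem : ∀ p, p ∈ S' ↔ ∃ j ∈ J, Sum.inr j = p := by simp [S']
  have hS'card : S'.card = J.card := Finset.card_image_of_injective _ Sum.inr_injective
  rcases ep_signed (liftR C (crossR G σ)) (liftR C (monoR G σ))
    (liftR.symm (fun _ _ h => h.symm)) (liftR.symm (fun _ _ h => h.symm))
    (fun a h => h.1 rfl) (fun a h => h.1 rfl) S' t (by omega) with ⟨Q, hQ⟩ | ⟨X, U, ρ, τ, hX, h⟩
  · apply hno
    refine oddModel_of_packing G σ C hCdisj hCconn (S' : Set _) ?_ ?_ t Q hQ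
    · intro p hp
      obtain ⟨j, hj, rfl⟩ := (hS'mem p).1 hp
      obtain ⟨v, hv⟩ := hB.ne j
      exact ⟨v, hv, hj⟩
    · intro p hp p' hp' hpp
      obtain ⟨j, hj, rfl⟩ := (hS'mem p).1 hp
      obtain ⟨k, hk, rfl⟩ := (hS'mem p').1 hp'
      obtain ⟨a, ha, b, hb, hab⟩ := hB.adj j k (fun e => hpp (by rw [e]))
      exact ⟨a, ⟨ha, hj⟩, b, ⟨hb, hk⟩, hab⟩
  -- find a clean line
  have hE0 : ∀ a b, a ∈ Wt → b ∈ Wt → crossR G σ a b → liftR C (crossR G σ) (Sum.inl a) (Sum.inl b) :=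
    fun a b ha hb hab => ⟨fun e => hab.1.ne (Sum.inl.inj e), a, ⟨rfl, ha⟩, b, ⟨rfl, hb⟩, hab⟩
  have hE1 : ∀ a b, a ∈ Wt → b ∈ Wt → monoR G σ a b → liftR C (monoR G σ) (Sum.inl a) (Sum.inl b) :=
    fun a b ha hb hab => ⟨fun e => hab.1.ne (Sum.inl.inj e), a, ⟨rfl, ha⟩, b, ⟨rfl, hb⟩, hab⟩
  have hclean : ∃ i, (∀ x ∈ P i, Sum.inl x.1 ∉ X) ∧ (∀ v ∈ B (ha i), Sum.inl v ∉ X) ∧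
      (∀ v ∈ B (hb i), Sum.inl v ∉ X) := by
    by_contra hc
    push Not at hc
    have hbad : ∀ i, ∃ z : (V ⊕ Fin m) × Bool, z.1 ∈ X ∧ ∃ v, z.1 = Sum.inl v ∧
        ((z.2 = true ∧ ∃ x ∈ P i, x.1 = v) ∨ (z.2 = false ∧ (v ∈ B (ha i) ∨ v ∈ B (hb i)))) := by
      intro i
      by_cases h1 : ∀ x ∈ P i, Sum.inl x.1 ∉ X
      · by_cases h2 : ∀ v ∈ B (ha i), Sum.inl v ∉ X
        · obtain ⟨v, hv, hvX⟩ := hc i h1 h2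
          exact ⟨(Sum.inl v, false), hvX, v, rfl, Or.inr ⟨rfl, Or.inr hv⟩⟩
        · push Not at h2
          obtain ⟨v, hv, hvX⟩ := h2
          exact ⟨(Sum.inl v, false), hvX, v, rfl, Or.inr ⟨rfl, Or.inl hv⟩⟩
      · push Not at h1
        obtain ⟨x, hx, hxX⟩ := h1
        exact ⟨(Sum.inl x.1, true), hxX, x.1, rfl, Or.inl ⟨rfl, x, hx, rfl⟩⟩
    choose z hzX v hzv hz using hbad
    have hinj : Function.Injective z := by
      intro i i' e
      have ev : v i = v i' := by
        have := hzv i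
        rw [e, hzv i'] at this
        exact (Sum.inl.inj this).symm
      have hend : ∀ c, (c = ha i ∨ c = hb i) → (c = ha i' ∨ c = hb i') → i = i' := by
        intro c h1 h2
        have m1 : ∃ x ∈ P i, x.1 = s c := by
          rcases h1 with rfl | rfl
          · exact ⟨_, List.mem_of_head? (hha i), rfl⟩
          · exact ⟨_, List.mem_of_getLast? (hhb i), rfl⟩
        have m2 : ∃ x ∈ P i', x.1 = s c := by
          rcases h2 with rfl | rfl
          · exact ⟨_, List.mem_of_head? (hha i'), rfl⟩
          · exact ⟨_, List.mem_of_getLast? (hhb i'), rfl⟩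
        obtain ⟨x, hx, ex⟩ := m1
        obtain ⟨y, hy, ey⟩ := m2
        exact hP.disj _ _ _ _ hx hy (ex.trans ey.symm)
      rcases hz i with ⟨e1, x, hx, ex⟩ | ⟨e1, h1⟩ <;> rcases hz i' with ⟨e2, y, hy, ey⟩ | ⟨e2, h2⟩
      · exact hP.disj _ _ _ _ hx hy (by rw [ex, ey, ev])
      · rw [e, e2] at e1; exact absurd e1 (by simp)
      · rw [e, e2] at e1; exact absurd e1 (by simp)
      · rw [← ev] at h2
        rcases h1 with h1 | h1 <;> rcases h2 with h2 | h2
        · exact hend _ (Or.inl rfl) (Or.inl (hB.disj _ _ _ h1 h2))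
        · exact hend _ (Or.inl rfl) (Or.inr (hB.disj _ _ _ h1 h2))
        · exact hend _ (Or.inr rfl) (Or.inl (hB.disj _ _ _ h1 h2))
        · exact hend _ (Or.inr rfl) (Or.inr (hB.disj _ _ _ h1 h2))
    have hle := Finset.card_le_card_of_injOn (s := Finset.univ) (t := X ×ˢ (Finset.univ : Finset Bool)) z
      (fun i _ => by
        rw [Finset.mem_coe, Finset.mem_product]; exact ⟨hzX i, Finset.mem_univ _⟩) hinj.injOn
    rw [Finset.card_product, Finset.card_univ, Fintype.card_fin, Finset.card_univ, Fintype.card_bool] at hle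
    omega
  obtain ⟨i, hPi, hBa, hBb⟩ := hclean
  -- exits
  have hexit : ∀ c y (y0 : V ⊕ Fin m), y ≠ s c → ∃ j ∈ J, Sum.inr j ∉ X ∧ Sum.inr j ≠ y0 ∧ ∃ v ∈ B c,
      Relation.ReflTransGen (avR (crossR G σ) (B c) y) (s c) v ∧ ∃ w ∈ B j, crossR G σ v w := by
    intro c y y0 hy
    by_contra hc
    push Not at hc
    have h1 := hcen c y hy
    set E := {i | ∃ v, v ∈ B c ∧
      Relation.ReflTransGen (avR (crossR G σ) (B c) y) (s c) v ∧
      ∃ w ∈ B i, crossR G σ v w} with hE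
    have hsub : E ⊆ ((Jᶜ ∪ (X.preimage Sum.inr Sum.inr_injective.injOn ∪
        Finset.univ.filter (fun j => Sum.inr j = y0)) : Finset (Fin m)) : Set (Fin m)) := by
      intro j hj
      obtain ⟨v, hv, hr, w, hw, hvw⟩ := hj
      simp only [Finset.coe_union, Set.mem_union, Finset.mem_coe, Finset.mem_compl,
        Finset.mem_preimage, Finset.mem_filter, Finset.mem_univ, true_and]
      by_contra hn
      push Not at hn
      exact hc j hn.1 hn.2.1 hn.2.2 v hv hr w hw hvw
    have h2 := Set.ncard_le_ncard hsub (Set.toFinite _)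
    rw [Set.ncard_coe_finset] at h2
    have h3 := Finset.card_union_le Jᶜ (X.preimage Sum.inr Sum.inr_injective.injOn ∪
        Finset.univ.filter (fun j => Sum.inr j = y0))
    have h4 := Finset.card_union_le (X.preimage Sum.inr Sum.inr_injective.injOn)
        (Finset.univ.filter (fun j : Fin m => Sum.inr j = y0))
    have h5 : (X.preimage Sum.inr (Sum.inr_injective (α := V) (β := Fin m)).injOn).card ≤ X.card :=
      Finset.card_le_card_of_injOn Sum.inr (fun a ha => by simpa using ha) Sum.inr_injective.injOn
    have h6 : (Finset.univ.filter (fun j : Fin m => Sum.inr j = y0)).card ≤ 1 := by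
      rw [Finset.card_le_one]
      intro a ha b hb
      have e1 := (Finset.mem_filter.1 ha).2
      have e2 := (Finset.mem_filter.1 hb).2
      exact Sum.inr.inj (e1.trans e2.symm)
    omega
  have hout : ∃ y, ∀ c : Fin m, c = ha i ∨ c = hb i → y ∉ B c := by
    have : ∃ j, j ∈ J := by
      have : 0 < J.card := by omega
      exact Finset.card_pos.1 this
    obtain ⟨j, hj⟩ := this
    refine ⟨s j, ?_⟩
    rintro c (rfl | rfl) hc
    · rw [hB.disj _ _ _ (hsB j) hc] at hj; exact haJ _ hj
    · rw [hB.disj _ _ _ (hsB j) hc] at hj; exact hbJ _ hj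
  obtain ⟨yo, hyo⟩ := hout
  have hinrU : ∀ j ∈ J, Sum.inr j ∉ X → Sum.inr j ∈ U := by
    intro j hj hjX
    exact (h.cover _ ((hS'mem _).2 ⟨j, hj, rfl⟩)).resolve_left hjX
  have hclaim : ∀ c, c = ha i ∨ c = hb i → (∀ v ∈ B c, Sum.inl v ∉ X) →
      Sum.inl (s c) ∈ U ∧ τ (Sum.inl (s c)) = false := by
    intro c hc hcX
    have hcJ : c ∉ J := by
      rcases hc with rfl | rfl
      · exact haJ _
      · exact hbJ _
    have hBW : ∀ v ∈ B c, v ∈ Wt := fun v hv => Or.inr ⟨c, hcJ, hv⟩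
    have hlast : ∀ v ∈ B c, ∀ j ∈ J, ∀ w ∈ B j, crossR G σ v w →
        liftR C (crossR G σ) (Sum.inl v) (Sum.inr j) := fun v hv j hj w hw hvw =>
      ⟨by simp, v, ⟨rfl, hBW v hv⟩, w, ⟨hw, hj⟩, hvw⟩
    have hscU : Sum.inl (s c) ∈ U := by
      by_contra hsU
      set y := ρ (Sum.inl (s c)) with hy
      have hyU : y ∈ U := h.rho_mem _ (hcX _ (hsB c))
      have hys : y ≠ Sum.inl (s c) := fun e => hsU (e ▸ hyU)
      obtain ⟨y', hy's, hy'⟩ : ∃ y', y' ≠ s c ∧ ∀ v ∈ B c, v ≠ y' → Sum.inl v ≠ y := by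
        rcases hyy : y with y' | j
        · refine ⟨y', fun e => hys (by rw [hyy, e]), fun v hv hne e => hne (Sum.inl.inj e)⟩
        · refine ⟨yo, fun e => hyo c hc (e ▸ hsB c), fun v hv hne e => by simp at e⟩
      obtain ⟨j, hj, hjX, hjy, v, hv, hr, w, hw, hvw⟩ := hexit c y' y hy's
      have hinv : Sum.inl v ∉ U ∧ ρ (Sum.inl v) = y := by
        clear hvw hw hv
        induction hr with
        | refl => exact ⟨hsU, rfl⟩
        | @tail a b _ hab ih =>
          obtain ⟨hab, haB, hbB, hay, hby⟩ := hab
          have e : ρ (Sum.inl b) = y := by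
            rcases h.rho_adj _ _ (hcX a haB) (hcX b hbB) (Or.inl (hE0 a b (hBW a haB) (hBW b hbB) hab))
              with e | e
            · rw [← e]; exact ih.2
            · exact absurd e.1 ih.1
          refine ⟨fun hbU => ?_, e⟩
          rw [h.rho_fix _ hbU] at e
          exact hy' b hbB hby e
      rcases h.rho_adj _ _ (hcX v hv) hjX (Or.inl (hlast v hv j hj w hw hvw)) with e | e
      · rw [hinv.2, h.rho_fix _ (hinrU j hj hjX)] at e
        exact hjy e.symm
      · exact hinv.1 e.1
    refine ⟨hscU, ?_⟩
    obtain ⟨j, hj, hjX, hjy, v, hv, hr, w, hw, hvw⟩ := hexit c yo (Sum.inl yo)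
      (fun e => hyo c hc (e ▸ hsB c))
    have hinv : τ (ρ (Sum.inl v)) = τ (Sum.inl (s c)) := by
      clear hvw hw hv
      induction hr with
      | refl => rw [h.rho_fix _ hscU]
      | @tail a b _ hab ih =>
        obtain ⟨hab, haB, hbB, hay, hby⟩ := hab
        rw [← ih, h.const (hcX a haB) (hcX b hbB) (hE0 a b (hBW a haB) (hBW b hbB) hab)]
    rw [← hinv, h.const (hcX v hv) hjX (hlast v hv j hj w hw hvw), h.rho_fix _ (hinrU j hj hjX)]
    exact h.tauS _ ((hS'mem _).2 ⟨j, hj, rfl⟩) hjX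
  obtain ⟨hUa, hτa⟩ := hclaim (ha i) (Or.inl rfl) hBa
  obtain ⟨hUb, hτb⟩ := hclaim (hb i) (Or.inr rfl) hBb
  obtain ⟨l, hl⟩ : ∃ l, P i = (s (ha i), false) :: l := by
    have := hha i
    cases hh : P i with
    | nil => rw [hh] at this; simp at this
    | cons b l => rw [hh] at this; simp at this; exact ⟨l, by rw [this]⟩
  let F : V × Bool → (V ⊕ Fin m) × Bool := fun x => (Sum.inl x.1, x.2)
  have hpar := h.parity (l.map F) (F (s (ha i), false)) (F (s (hb i), true)) (by
      rw [← List.map_cons, ← hl, List.isChain_map]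
      refine isChain_imp_mem (P i) ?_ (hP.chain i)
      rintro x hx y hy (⟨h1, h2⟩ | ⟨h1, h2⟩)
      · exact Or.inl ⟨hE0 _ _ (Or.inl ⟨i, x, hx, rfl⟩) (Or.inl ⟨i, y, hy, rfl⟩) h1, h2⟩
      · exact Or.inr ⟨hE1 _ _ (Or.inl ⟨i, x, hx, rfl⟩) (Or.inl ⟨i, y, hy, rfl⟩) h1, h2⟩)
    (by
      rw [← List.map_cons, ← hl]
      have e : ((P i).map F).map Prod.fst = ((P i).map Prod.fst).map Sum.inl := by
        simp [F, Function.comp_def]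
      rw [e]
      exact (hP.nodup i).map Sum.inl_injective)
    (by
      rw [← List.map_cons, ← hl]
      intro x hx
      obtain ⟨y, hy, rfl⟩ := List.mem_map.1 hx
      exact hPi y hy) hUa (by rw [← List.map_cons, ← hl, List.getLast?_map, hhb]; rfl) hUb
  simp only [F, hτa, hτb] at hpar
  exact absurd hpar (by simp)

/-- Structure theorem. -/
theorem structure_T (t N : ℕ) : ∃ n : ℕ, ∀ (V : Type u) [Fintype V] (G : SimpleGraph V),
    CliqueModel G n → ¬ OddModel G t →
    ∃ (X U : Finset V) (ρ : V → V) (c : V → Bool), X.card ≤ 2 * (4 * t + 1) ∧ (∃ U' ⊆ U, N ≤ U'.card ∧ ∀ u ∈ U', ∃ w, G.Adj u w) ∧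
      (∀ v, v ∈ X → v ∈ U → False) ∧ (∀ v, v ∉ X → ρ v ∈ U) ∧ (∀ u ∈ U, ρ u = u) ∧
      (∀ x y, x ∉ X → y ∉ X → G.Adj x y → ρ x = ρ y ∨ (x ∈ U ∧ y ∈ U)) ∧
      (∀ x ∈ U, ∀ y ∈ U, G.Adj x y → c x ≠ c y) := by
  classical
  obtain ⟨n, hn⟩ := clique_to_bip t (20 * t + 20 + N)
  refine ⟨n, fun V _ G hG hno => ?_⟩
  rcases hn V G hG with h | ⟨σ, B, hB⟩
  · exact absurd h hno
  obtain ⟨s, hsB, X, U, ρ, τ, S, hS, hX, h⟩ := T_core G σ t B hB hno (by omega)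
  refine ⟨X, U, ρ, fun v => xor (τ v) (σ v), hX, ?_, h.disj, h.rho_mem, h.rho_fix, ?_, ?_⟩
  · have hsinj : Function.Injective s := fun a b e => hB.disj _ _ _ (hsB a) (e ▸ hsB b)
    have e : S = Finset.univ.image s := by ext v; simp [hS]
    have hcard : S.card = 20 * t + 20 + N := by
      rw [e, Finset.card_image_of_injective _ hsinj]; simp
    refine ⟨S \ X, ?_, ?_, ?_⟩
    · intro v hv
      rw [Finset.mem_sdiff] at hv
      exact (h.cover v hv.1).resolve_left hv.2
    · have := Finset.le_card_sdiff X S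
      omega
    · intro v hv
      obtain ⟨j, rfl⟩ := (hS v).1 (Finset.mem_sdiff.1 hv).1
      obtain ⟨k, hk⟩ : ∃ k, j ≠ k := by
        by_cases e0 : j = ⟨0, by omega⟩
        · exact ⟨⟨1, by omega⟩, by rw [e0]; simp⟩
        · exact ⟨_, e0⟩
      obtain ⟨x, hx, y, hy, hxy⟩ := hB.adj j k hk
      have hr := hB.conn j (s j) (hsB j) x hx
      rcases Relation.ReflTransGen.cases_head hr with e | ⟨w, hw, _⟩
      · exact ⟨y, e ▸ hxy.1⟩
      · exact ⟨w, hw.1.1⟩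
  · intro x y hx hy hxy
    apply h.rho_adj x y hx hy
    by_cases e : σ x = σ y
    · exact Or.inr ⟨hxy, e⟩
    · exact Or.inl ⟨hxy, e⟩
  · intro x hx y hy hxy
    show xor (τ x) (σ x) ≠ xor (τ y) (σ y)
    by_cases e : σ x = σ y
    · have := h.tau1 x hx y hy ⟨hxy, e⟩
      rw [e]
      intro h'
      exact this (Bool.xor_left_inj.1 h')
    · have := h.tau0 x hx y hy ⟨hxy, e⟩
      rw [this]
      intro h'
      exact e (Bool.xor_right_inj.1 h')

/-- `G` restricted to the edges inside `R`. -/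
def restr (G : SimpleGraph V) (R : Finset V) : SimpleGraph V where
  Adj a b := G.Adj a b ∧ a ∈ R ∧ b ∈ R
  symm := ⟨fun a b h => ⟨h.1.symm, h.2.2, h.2.1⟩⟩
  loopless := ⟨fun a h => h.1.ne rfl⟩

structure Struct (G : SimpleGraph V) (R X U : Finset V) (ρ : V → V) (c : V → Bool) : Prop where
  XR : X ⊆ R
  UR : U ⊆ R
  disj : ∀ v, v ∈ X → v ∈ U → False
  rho_mem : ∀ v ∈ R, v ∉ X → ρ v ∈ U
  rho_fix : ∀ u ∈ U, ρ u = u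
  rho_adj : ∀ x y, x ∈ R → y ∈ R → x ∉ X → y ∉ X → G.Adj x y → ρ x = ρ y ∨ (x ∈ U ∧ y ∈ U)
  col : ∀ x ∈ U, ∀ y ∈ U, G.Adj x y → c x ≠ c y

theorem structure_R (t N : ℕ) (hN : 0 < N) : ∃ n : ℕ, ∀ (V : Type u) [Fintype V] (G : SimpleGraph V)
    (R : Finset V), CliqueModel (restr G R) n → ¬ OddModel G t →
    ∃ (X U : Finset V) (ρ : V → V) (c : V → Bool), X.card ≤ 2 * (4 * t + 1) ∧ N ≤ U.card ∧
      Struct G R X U ρ c := by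
  classical
  obtain ⟨n, hn⟩ := structure_T t N
  refine ⟨n, fun V _ G R hG hno => ?_⟩
  have hno' : ¬ OddModel (restr G R) t := by
    rintro ⟨σ, B, hB⟩
    exact hno ⟨σ, B, hB.mono (fun a b h => ⟨h.1.1, h.2⟩) (fun a b h => ⟨h.1.1, h.2⟩)⟩
  obtain ⟨X, U, ρ, c, hX, ⟨U', hU', hcard, hadj⟩, h1, h2, h3, h4, h5⟩ := hn V (restr G R) hG hno'
  have hU'R : U' ⊆ U ∩ R := by
    intro u hu
    obtain ⟨w, hw⟩ := hadj u hu
    exact Finset.mem_inter.2 ⟨hU' hu, hw.2.1⟩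
  obtain ⟨u0, hu0⟩ : ∃ u0, u0 ∈ U ∩ R := by
    have : 0 < U'.card := by omega
    obtain ⟨u, hu⟩ := Finset.card_pos.1 this
    exact ⟨u, hU'R hu⟩
  refine ⟨X ∩ R, U ∩ R, fun v => if ρ v ∈ U ∩ R then ρ v else u0, c,
    (Finset.card_le_card Finset.inter_subset_left).trans hX,
    hcard.trans (Finset.card_le_card hU'R), ⟨Finset.inter_subset_right, Finset.inter_subset_right,
    ?_, ?_, ?_, ?_, ?_⟩⟩
  · intro v hv hv'
    exact h1 v (Finset.mem_inter.1 hv).1 (Finset.mem_inter.1 hv').1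
  · intro v _ _
    split_ifs with h
    · exact h
    · exact hu0
  · intro u hu
    rw [h3 u (Finset.mem_inter.1 hu).1, if_pos hu]
  · intro x y hx hy hxX hyX hxy
    rcases h4 x y (fun h => hxX (Finset.mem_inter.2 ⟨h, hx⟩)) (fun h => hyX (Finset.mem_inter.2 ⟨h, hy⟩))
      ⟨hxy, hx, hy⟩ with e | e
    · left; rw [e]
    · exact Or.inr ⟨Finset.mem_inter.2 ⟨e.1, hx⟩, Finset.mem_inter.2 ⟨e.2, hy⟩⟩
  · intro x hx y hy hxy
    exact h5 x (Finset.mem_inter.1 hx).1 y (Finset.mem_inter.1 hy).1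
      ⟨hxy, (Finset.mem_inter.1 hx).2, (Finset.mem_inter.1 hy).2⟩

open Classical in
/-- The number of neighbours of `v` in `A` with color `c` lies in `S`. -/
def Ach (G : SimpleGraph V) (S : Set ℕ) (φ : V → ℕ) (A : Finset V) (v : V) (c : ℕ) : Prop :=
  (A.filter (fun u => G.Adj v u ∧ φ u = c)).card ∈ S

theorem Ach.congr {G : SimpleGraph V} {S : Set ℕ} {φ φ' : V → ℕ} {A A' : Finset V} {v v' : V} {c c' : ℕ}
    (h : Ach G S φ A v c)
    (e : ∀ u, (u ∈ A ∧ G.Adj v u ∧ φ u = c) ↔ (u ∈ A' ∧ G.Adj v' u ∧ φ' u = c')) :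
    Ach G S φ' A' v' c' := by
  classical
  unfold Ach at *
  convert h using 2
  ext u
  simp only [Finset.mem_filter]
  exact (e u).symm

theorem Ach.single {G : SimpleGraph V} {S : Set ℕ} (h1 : 1 ∈ S) {φ : V → ℕ} {A : Finset V} {v w : V}
    (hw : w ∈ A) (hv : G.Adj v w) (hu : ∀ u ∈ A, G.Adj v u → φ u = φ w → u = w) :
    Ach G S φ A v (φ w) := by
  classical
  unfold Ach
  have : (A.filter (fun u => G.Adj v u ∧ φ u = φ w)) = {w} := by
    ext u
    simp only [Finset.mem_filter, Finset.mem_singleton]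
    constructor
    · rintro ⟨a, b, c⟩
      exact hu u a b c
    · rintro rfl
      exact ⟨hw, hv, rfl⟩
  convert h1
  rw [Finset.card_eq_one]
  exact ⟨w, by convert this⟩

/-- `φ` extends the precoloring `ζ` of `Z` to `R` with the required conditions. -/
structure ExtOut (G : SimpleGraph V) (S : Set ℕ) (T : ℕ) (R Z : Finset V) (ζ : V → ℕ)
    (D : V → Finset ℕ) (g : V → Bool) (φ : V → ℕ) : Prop where
  col : ∀ v ∈ R, 1 ≤ φ v ∧ φ v ≤ T
  ext : ∀ z ∈ Z, φ z = ζ z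
  prop : ∀ a ∈ R, ∀ b ∈ R, G.Adj a b → φ a ≠ φ b
  fa : ∀ z ∈ Z, g z = false → ∀ u ∈ R, u ∉ Z → G.Adj z u → φ u ∉ D z
  tr : ∀ z ∈ Z, g z = true → (∃ u ∈ R, u ∉ Z ∧ G.Adj z u) →
    ∃ c, c ∉ D z ∧ ∃ A : Finset V, (∀ u, u ∈ A ↔ u ∈ R ∧ u ∉ Z) ∧ Ach G S φ A z c
  out : ∀ v ∈ R, v ∉ Z → (∃ u ∈ R, u ∉ Z ∧ G.Adj v u) → ∃ c, Ach G S φ R v c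

def Ext (G : SimpleGraph V) (S : Set ℕ) (T M : ℕ) (R : Finset V) : Prop :=
  ∀ (Z : Finset V) (ζ : V → ℕ) (D : V → Finset ℕ) (g : V → Bool), Z ⊆ R → Z.card ≤ M →
    (∀ z ∈ Z, 1 ≤ ζ z ∧ ζ z ≤ T) → (∀ a ∈ Z, ∀ b ∈ Z, G.Adj a b → ζ a ≠ ζ b) →
    (∀ z ∈ Z, (D z).card ≤ M) → ∃ φ, ExtOut G S T R Z ζ D g φ

/-- Local compatibility of a mode `(d, b)` at a vertex `w`. -/
structure Loc (G : SimpleGraph V) (S : Set ℕ) (R Z Y : Finset V) (β : V → ℕ)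
    (D : V → Finset ℕ) (g : V → Bool) (w : V) (d : Finset ℕ) (b : Bool) : Prop where
  zf : w ∈ Z → g w = false → b = false ∧ D w ⊆ d ∧ ∀ u ∈ Y, u ∉ Z → G.Adj w u → β u ∉ D w
  zt : w ∈ Z → g w = true → (∃ u ∈ R, u ∉ Z ∧ G.Adj w u) →
    (b = false ∧ ∃ c ∈ d, c ∉ D w ∧ ∃ A : Finset V, (∀ u, u ∈ A ↔ u ∈ Y ∧ u ∉ Z) ∧ Ach G S β A w c) ∨
    (b = true ∧ D w ⊆ d ∧ ∀ u ∈ Y, G.Adj w u → u ∈ Z)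
  y : w ∉ Z → (∃ u ∈ R, u ∉ Z ∧ G.Adj w u) →
    (b = false ∧ ∃ c ∈ d, Ach G S β Y w c) ∨
    (b = true ∧ ∀ u ∈ Y, G.Adj w u → u ∈ Z ∧ β u ∈ d)

theorem transfer {G : SimpleGraph V} {S : Set ℕ} {T : ℕ} {R Z Y : Finset V} {ζ β φ : V → ℕ}
    {D D' : V → Finset ℕ} {g g' : V → Bool}
    (hZY : Z ⊆ Y) (hYR : Y ⊆ R) (hβ : ∀ z ∈ Z, β z = ζ z)
    (hloc : ∀ w ∈ Y, Loc G S R Z Y β D g w (D' w) (g' w))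
    (hinter : ∀ v ∈ R, v ∉ Y → (∃ u ∈ R, u ∉ Z ∧ G.Adj v u) → (∀ u ∈ R, G.Adj v u → u ∈ Y) →
      ∃ c, Ach G S β Y v c)
    (h : ExtOut G S T R Y β D' g' φ) : ExtOut G S T R Z ζ D g φ := by
  classical
  refine ⟨h.col, fun z hz => (h.ext z (hZY hz)).trans (hβ z hz), h.prop, ?_, ?_, ?_⟩
  · intro z hz hg u huR huZ hzu
    obtain ⟨hb, hd, hY⟩ := (hloc z (hZY hz)).zf hz hg
    by_cases huY : u ∈ Y
    · rw [h.ext u huY]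
      exact hY u huY huZ hzu
    · intro hm
      exact h.fa z (hZY hz) hb u huR huY hzu (hd hm)
  · intro z hz hg hex
    rcases (hloc z (hZY hz)).zt hz hg hex with ⟨hb, c, hc, hcD, A, hA, hach⟩ | ⟨hb, hd, hY⟩
    · refine ⟨c, hcD, R \ Z, fun u => by simp, hach.congr ?_⟩
      intro u
      rw [hA u, Finset.mem_sdiff]
      constructor
      · rintro ⟨⟨a, a'⟩, b, e⟩
        exact ⟨⟨hYR a, a'⟩, b, by rw [h.ext u a]; exact e⟩
      · rintro ⟨⟨a, a'⟩, b, e⟩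
        have huY : u ∈ Y := by
          by_contra huY
          exact h.fa z (hZY hz) hb u a huY b (by rw [e]; exact hc)
        exact ⟨⟨huY, a'⟩, b, by rw [← h.ext u huY]; exact e⟩
    · obtain ⟨u, huR, huZ, hu⟩ := hex
      obtain ⟨c, hc, A, hA, hach⟩ := h.tr z (hZY hz) hb ⟨u, huR, fun hy => huZ (hY u hy hu), hu⟩
      refine ⟨c, fun hm => hc (hd hm), R \ Z, fun u => by simp, hach.congr ?_⟩
      intro u
      rw [hA u, Finset.mem_sdiff]
      constructor
      · rintro ⟨⟨a, a'⟩, b⟩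
        exact ⟨⟨a, fun hz => a' (hZY hz)⟩, b⟩
      · rintro ⟨⟨a, a'⟩, b⟩
        exact ⟨⟨a, fun hy => a' (hY u hy b.1)⟩, b⟩
  · intro v hv hvZ hex
    by_cases hvY : v ∈ Y
    · rcases (hloc v hvY).y hvZ hex with ⟨hb, c, hc, hach⟩ | ⟨hb, hY⟩
      · refine ⟨c, hach.congr ?_⟩
        intro u
        constructor
        · rintro ⟨a, b, e⟩
          exact ⟨hYR a, b, by rw [h.ext u a]; exact e⟩
        · rintro ⟨a, b, e⟩
          have huY : u ∈ Y := by
            by_contra huY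
            exact h.fa v hvY hb u a huY b (by rw [e]; exact hc)
          exact ⟨huY, b, by rw [← h.ext u huY]; exact e⟩
      · obtain ⟨u, huR, huZ, hu⟩ := hex
        obtain ⟨c, hc, A, hA, hach⟩ := h.tr v hvY hb ⟨u, huR, fun hy => huZ (hY u hy hu).1, hu⟩
        refine ⟨c, hach.congr ?_⟩
        intro u
        rw [hA u]
        constructor
        · rintro ⟨⟨a, a'⟩, b⟩
          exact ⟨a, b⟩
        · rintro ⟨a, b, e⟩
          refine ⟨⟨a, fun hy => hc ?_⟩, b, e⟩
          rw [← e, h.ext u hy]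
          exact (hY u hy b).2
    · by_cases hex' : ∃ u ∈ R, u ∉ Y ∧ G.Adj v u
      · exact h.out v hv hvY hex'
      · have hall : ∀ u ∈ R, G.Adj v u → u ∈ Y := by
          intro u a b
          by_contra c
          exact hex' ⟨u, a, c, b⟩
        obtain ⟨c, hach⟩ := hinter v hv hvY hex hall
        refine ⟨c, hach.congr ?_⟩
        intro u
        constructor
        · rintro ⟨a, b, e⟩
          exact ⟨hYR a, b, by rw [h.ext u a]; exact e⟩
        · rintro ⟨a, b, e⟩
          exact ⟨hall u a b, b, by rw [← h.ext u (hall u a b)]; exact e⟩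

theorem sep_out {G : SimpleGraph V} {S : Set ℕ} {T M : ℕ} {R A B : Finset V} {β : V → ℕ}
    {D : V → Finset ℕ} {g : V → Bool}
    (hAR : A ⊆ R) (hBR : B ⊆ R) (hAB : ∀ v ∈ R, v ∈ A ∨ v ∈ B)
    (hsep : ∀ a ∈ A, ∀ b ∈ B, G.Adj a b → a ∈ B ∨ b ∈ A)
    (hB : Ext G S T M B) (I : Finset V) (hI : ∀ v, v ∈ I ↔ v ∈ A ∧ v ∈ B) (hcard : I.card ≤ M)
    (hcol : ∀ v ∈ A, 1 ≤ β v ∧ β v ≤ T) (hprop : ∀ a ∈ A, ∀ b ∈ A, G.Adj a b → β a ≠ β b)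
    (hD : ∀ w ∈ I, (D w).card ≤ M) :
    ∃ φ, ExtOut G S T R A β D g φ := by
  classical
  have hIA : ∀ v ∈ I, v ∈ A := fun v hv => ((hI v).1 hv).1
  obtain ⟨ψ, h⟩ := hB I β D g (fun v hv => ((hI v).1 hv).2) hcard (fun z hz => hcol z (hIA z hz))
    (fun a ha b hb => hprop a (hIA a ha) b (hIA b hb)) hD
  set φ : V → ℕ := fun v => if v ∈ A then β v else ψ v with hφ
  have eA : ∀ v ∈ A, φ v = β v := fun v hv => if_pos hv
  have eB : ∀ v ∈ B, φ v = ψ v := by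
    intro v hv
    by_cases hA : v ∈ A
    · rw [eA v hA, h.ext v ((hI v).2 ⟨hA, hv⟩)]
    · exact if_neg hA
  have hnA : ∀ v ∈ R, v ∉ A → v ∈ B ∧ v ∉ I := fun v hv hA =>
    ⟨(hAB v hv).resolve_left hA, fun hi => hA (hIA v hi)⟩
  have hnI : ∀ v ∈ B, v ∉ I → v ∉ A := fun v hv hi hA => hi ((hI v).2 ⟨hA, hv⟩)
  have hZ : ∀ z ∈ A, ∀ u ∈ R, u ∉ A → G.Adj z u → z ∈ I := by
    intro z hz u hu huA hzu
    exact (hI z).2 ⟨hz, (hsep z hz u (hnA u hu huA).1 hzu).resolve_right huA⟩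
  refine ⟨φ, ?_, eA, ?_, ?_, ?_, ?_⟩
  · intro v hv
    by_cases hA : v ∈ A
    · rw [eA v hA]; exact hcol v hA
    · rw [eB v (hnA v hv hA).1]; exact h.col v (hnA v hv hA).1
  · have key : ∀ a ∈ A, ∀ b ∈ R, b ∉ A → G.Adj a b → φ a ≠ φ b := by
      intro a ha b hb hbA hab
      have hi := hZ a ha b hb hbA hab
      have haB := ((hI a).1 hi).2
      rw [eB a haB, eB b (hnA b hb hbA).1]
      exact h.prop a haB b (hnA b hb hbA).1 hab
    intro a ha b hb hab
    by_cases haA : a ∈ A <;> by_cases hbA : b ∈ A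
    · rw [eA a haA, eA b hbA]; exact hprop a haA b hbA hab
    · exact key a haA b hb hbA hab
    · exact (key b hbA a ha haA hab.symm).symm
    · rw [eB a (hnA a ha haA).1, eB b (hnA b hb hbA).1]
      exact h.prop a (hnA a ha haA).1 b (hnA b hb hbA).1 hab
  · intro z hz hg u hu huA hzu
    rw [eB u (hnA u hu huA).1]
    exact h.fa z (hZ z hz u hu huA hzu) hg u (hnA u hu huA).1 (hnA u hu huA).2 hzu
  · rintro z hz hg ⟨u, hu, huA, hzu⟩
    obtain ⟨c, hc, A', hA', hach⟩ := h.tr z (hZ z hz u hu huA hzu) hg ⟨u, (hnA u hu huA).1, (hnA u hu huA).2, hzu⟩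
    refine ⟨c, hc, R \ A, fun u => by simp, hach.congr ?_⟩
    intro u
    rw [hA' u, Finset.mem_sdiff]
    constructor
    · rintro ⟨⟨a, a'⟩, b, e⟩
      exact ⟨⟨hBR a, hnI u a a'⟩, b, by rw [eB u a]; exact e⟩
    · rintro ⟨⟨a, a'⟩, b, e⟩
      exact ⟨hnA u a a', b, by rw [← eB u (hnA u a a').1]; exact e⟩
  · rintro v hv hvA ⟨u, hu, huA, hvu⟩
    obtain ⟨c, hach⟩ := h.out v (hnA v hv hvA).1 (hnA v hv hvA).2 ⟨u, (hnA u hu huA).1, (hnA u hu huA).2, hvu⟩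
    refine ⟨c, hach.congr ?_⟩
    intro u
    constructor
    · rintro ⟨a, b, e⟩
      exact ⟨hBR a, b, by rw [eB u a]; exact e⟩
    · rintro ⟨a, b, e⟩
      have huB : u ∈ B := by
        rcases hAB u a with h' | h'
        · exact (hsep u h' v (hnA v hv hvA).1 b.symm).resolve_right hvA
        · exact h'
      exact ⟨huB, b, by rw [← eB u huB]; exact e⟩

theorem star_out {G : SimpleGraph V} {S : Set ℕ} {T M : ℕ} {R X U : Finset V} {ρ : V → V} {c : V → Bool}
    (hS : Struct G R X U ρ c) {Y K : Finset V} {β : V → ℕ} {D : V → Finset ℕ} {g : V → Bool}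
    (hU : U.Nonempty)
    (hYR : Y ⊆ R) (hUY : U ⊆ Y) (hXK : X ⊆ K) (hKY : K ⊆ Y)
    (hcol : ∀ v ∈ Y, 1 ≤ β v ∧ β v ≤ T) (hprop : ∀ a ∈ Y, ∀ b ∈ Y, G.Adj a b → β a ≠ β b)
    (hD : ∀ w ∈ Y, (D w).card ≤ M) (hg : ∀ w ∈ K, g w = false)
    (hext : ∀ u ∈ U, ∃ Ru Zu : Finset V, (∀ v, v ∈ Ru ↔ (v ∈ R ∧ v ∉ X ∧ ρ v = u) ∨ v ∈ K) ∧
      (∀ v, v ∈ Zu ↔ v ∈ Ru ∧ v ∈ Y) ∧ Zu.card ≤ M ∧ Ext G S T M Ru) :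
    ∃ φ, ExtOut G S T R Y β D g φ := by
  classical
  have h1 : ∀ u, ∃ (Ru Zu : Finset V) (φ : V → ℕ), u ∈ U → (∀ v, v ∈ Ru ↔ (v ∈ R ∧ v ∉ X ∧ ρ v = u) ∨ v ∈ K) ∧
      (∀ v, v ∈ Zu ↔ v ∈ Ru ∧ v ∈ Y) ∧ ExtOut G S T Ru Zu β D g φ := by
    intro u
    by_cases hu : u ∈ U
    · obtain ⟨Ru, Zu, a, b, e, f⟩ := hext u hu
      have hZY : ∀ v ∈ Zu, v ∈ Y := fun v hv => ((b v).1 hv).2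
      obtain ⟨φ, hφ⟩ := f Zu β D g (fun v hv => ((b v).1 hv).1) e (fun z hz => hcol z (hZY z hz))
        (fun a ha b hb => hprop a (hZY a ha) b (hZY b hb)) (fun z hz => hD z (hZY z hz))
      exact ⟨Ru, Zu, φ, fun _ => ⟨a, b, hφ⟩⟩
    · exact ⟨∅, ∅, fun _ => 0, fun h => absurd h hu⟩
  choose Ru Zu ψ h using h1
  set φ : V → ℕ := fun v => if v ∈ Y then β v else ψ (ρ v) v with hφ
  have eY : ∀ v ∈ Y, φ v = β v := fun v hv => if_pos hv
  have mR : ∀ u ∈ U, ∀ v, v ∈ Ru u ↔ (v ∈ R ∧ v ∉ X ∧ ρ v = u) ∨ v ∈ K := fun u hu => (h u hu).1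
  have mZ : ∀ u ∈ U, ∀ v, v ∈ Zu u ↔ v ∈ Ru u ∧ v ∈ Y := fun u hu => (h u hu).2.1
  have hE : ∀ u ∈ U, ExtOut G S T (Ru u) (Zu u) β D g (ψ u) := fun u hu => (h u hu).2.2
  have RuR : ∀ u ∈ U, ∀ v ∈ Ru u, v ∈ R := by
    intro u hu v hv
    rcases (mR u hu v).1 hv with h' | h'
    · exact h'.1
    · exact hYR (hKY h')
  have eU : ∀ u ∈ U, ∀ v ∈ Ru u, φ v = ψ u v := by
    intro u hu v hv
    by_cases hY : v ∈ Y
    · rw [eY v hY, (hE u hu).ext v ((mZ u hu v).2 ⟨hv, hY⟩)]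
    · rcases (mR u hu v).1 hv with h' | h'
      · rw [← h'.2.2]; exact if_neg hY
      · exact absurd (hKY h') hY
  -- non-Y vertices
  have nY : ∀ v ∈ R, v ∉ Y → ρ v ∈ U ∧ v ∉ X ∧ v ∈ Ru (ρ v) ∧ v ∉ Zu (ρ v) := by
    intro v hv hY
    have hX : v ∉ X := fun hx => hY (hKY (hXK hx))
    have hu := hS.rho_mem v hv hX
    exact ⟨hu, hX, (mR _ hu v).2 (Or.inl ⟨hv, hX, rfl⟩), fun hz => hY ((mZ _ hu v).1 hz).2⟩
  -- neighbours of a non-Y vertex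
  have nbY : ∀ v ∈ R, v ∉ Y → ∀ u ∈ R, G.Adj v u → u ∈ Ru (ρ v) := by
    intro v hv hY u hu hvu
    obtain ⟨hr, hX, _, _⟩ := nY v hv hY
    by_cases huX : u ∈ X
    · exact (mR _ hr u).2 (Or.inr (hXK huX))
    · rcases hS.rho_adj v u hv hu hX huX hvu with e | e
      · exact (mR _ hr u).2 (Or.inl ⟨hu, huX, e.symm⟩)
      · exact absurd (hUY e.1) hY
  refine ⟨φ, ?_, eY, ?_, ?_, ?_, ?_⟩
  · intro v hv
    by_cases hA : v ∈ Y
    · rw [eY v hA]; exact hcol v hA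
    · obtain ⟨a, _, b, _⟩ := nY v hv hA
      rw [eU _ a v b]; exact (hE _ a).col v b
  · have key : ∀ a ∈ R, a ∉ Y → ∀ b ∈ R, G.Adj a b → φ a ≠ φ b := by
      intro a ha haY b hb hab
      obtain ⟨hr, _, hm, _⟩ := nY a ha haY
      have hm' := nbY a ha haY b hb hab
      rw [eU _ hr a hm, eU _ hr b hm']
      exact (hE _ hr).prop a hm b hm' hab
    intro a ha b hb hab
    by_cases haA : a ∈ Y
    · by_cases hbA : b ∈ Y
      · rw [eY a haA, eY b hbA]; exact hprop a haA b hbA hab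
      · exact (key b hb hbA a ha hab.symm).symm
    · exact key a ha haA b hb hab
  · intro z hz hg u hu huA hzu
    obtain ⟨hr, _, hm, hn⟩ := nY u hu huA
    have hm' := nbY u hu huA z (hYR hz) hzu.symm
    rw [eU _ hr u hm]
    exact (hE _ hr).fa z ((mZ _ hr z).2 ⟨hm', hz⟩) hg u hm hn hzu
  · rintro z hz hgz ⟨u, hu, huA, hzu⟩
    have hzK : z ∉ K := fun hk => by rw [hg z hk] at hgz; cases hgz
    have hzX : z ∉ X := fun hx => hzK (hXK hx)
    have same : ∀ v ∈ R, v ∉ Y → G.Adj z v → ρ v = ρ z := by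
      intro v hv hvY hzv
      rcases hS.rho_adj z v (hYR hz) hv hzX (nY v hv hvY).2.1 hzv with e | e
      · exact e.symm
      · exact absurd (hUY e.2) hvY
    obtain ⟨hr, _, hm, hn⟩ := nY u hu huA
    have hm' := nbY u hu huA z (hYR hz) hzu.symm
    obtain ⟨c, hc, A', hA', hach⟩ := (hE _ hr).tr z ((mZ _ hr z).2 ⟨hm', hz⟩) hgz ⟨u, hm, hn, hzu⟩
    refine ⟨c, hc, R \ Y, fun u => by simp, hach.congr ?_⟩
    intro v
    rw [hA' v, Finset.mem_sdiff]
    constructor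
    · rintro ⟨⟨a, a'⟩, b, e⟩
      exact ⟨⟨RuR _ hr v a, fun hy => a' ((mZ _ hr v).2 ⟨a, hy⟩)⟩, b, by rw [eU _ hr v a]; exact e⟩
    · rintro ⟨⟨a, a'⟩, b, e⟩
      obtain ⟨_, _, hm2, hn2⟩ := nY v a a'
      have : ρ v = ρ u := (same v a a' b).trans (same u hu huA hzu).symm
      rw [this] at hm2 hn2
      exact ⟨⟨hm2, hn2⟩, b, by rw [← eU _ hr v hm2]; exact e⟩
  · rintro v hv hvA ⟨u, hu, huA, hvu⟩
    obtain ⟨hr, _, hm, hn⟩ := nY v hv hvA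
    have hm' := nbY v hv hvA u hu hvu
    obtain ⟨c, hach⟩ := (hE _ hr).out v hm hn ⟨u, hm', fun hz => huA ((mZ _ hr u).1 hz).2, hvu⟩
    refine ⟨c, hach.congr ?_⟩
    intro w
    constructor
    · rintro ⟨a, b, e⟩
      exact ⟨RuR _ hr w a, b, by rw [eU _ hr w a]; exact e⟩
    · rintro ⟨a, b, e⟩
      have huB := nbY v hv hvA w a b
      exact ⟨huB, b, by rw [← eU _ hr w huB]; exact e⟩

theorem fresh {α : Type*} (A : Finset α) (P : Finset ℕ) (T : ℕ) (h : P.card + A.card ≤ T) :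
    ∃ f : α → ℕ, (∀ a ∈ A, (1 ≤ f a ∧ f a ≤ T) ∧ f a ∉ P) ∧ ∀ a ∈ A, ∀ b ∈ A, f a = f b → a = b := by
  classical
  have hc : Fintype.card A ≤ Fintype.card (Finset.Icc 1 T \ P : Finset ℕ) := by
    rw [Fintype.card_coe, Fintype.card_coe]
    have h1 := Finset.le_card_sdiff P (Finset.Icc 1 T)
    rw [Nat.card_Icc] at h1
    omega
  obtain ⟨e⟩ := Function.Embedding.nonempty_of_card_le hc
  refine ⟨fun a => if h : a ∈ A then (e ⟨a, h⟩ : ℕ) else 0, ?_, ?_⟩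
  · intro a ha
    simp only [ha, dif_pos]
    have := (e ⟨a, ha⟩).2
    rw [Finset.mem_sdiff, Finset.mem_Icc] at this
    exact this
  · intro a ha b hb hab
    simp only [ha, hb, dif_pos] at hab
    have := e.injective (Subtype.ext hab)
    exact congrArg Subtype.val this

theorem closure_set (G : SimpleGraph V) (X Q : Finset V) :
    ∃ A : Finset V, A ⊆ Q ∧ A.card ≤ 2 * X.card ∧ (∀ x ∈ X, x ∈ Q → x ∈ A) ∧
      ∀ z, z ∈ X ∨ z ∈ A → (∃ u ∈ Q, G.Adj z u) → ∃ x ∈ A, G.Adj z x := by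
  classical
  have h1 : ∀ z, ∃ w, (w = z ∧ ¬ ∃ u ∈ Q, G.Adj z u) ∨ (w ∈ Q ∧ G.Adj z w) := by
    intro z
    by_cases h : ∃ u ∈ Q, G.Adj z u
    · obtain ⟨u, a, b⟩ := h
      exact ⟨u, Or.inr ⟨a, b⟩⟩
    · exact ⟨z, Or.inl ⟨rfl, h⟩⟩
  choose w hw using h1
  have hw' : ∀ z, (∃ u ∈ Q, G.Adj z u) → w z ∈ Q ∧ G.Adj z (w z) := fun z hz =>
    (hw z).resolve_left (fun h => h.2 hz)
  set X0 : Finset V := (X.image (fun x => if x ∈ Q then x else w x)).filter (· ∈ Q) with hX0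
  set A : Finset V := X0 ∪ (X0.image w).filter (· ∈ Q) with hA
  have c0 : X0.card ≤ X.card := (Finset.card_filter_le _ _).trans Finset.card_image_le
  have c1 : ((X0.image w).filter (· ∈ Q)).card ≤ X0.card := (Finset.card_filter_le _ _).trans Finset.card_image_le
  have hX0' : ∀ x ∈ X, x ∈ Q → x ∈ X0 := by
    intro x hx hq
    refine Finset.mem_filter.2 ⟨Finset.mem_image.2 ⟨x, hx, if_pos hq⟩, hq⟩
  have hX0A : ∀ z ∈ X0, (∃ u ∈ Q, G.Adj z u) → ∃ x ∈ A, G.Adj z x := by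
    intro z hz h
    obtain ⟨a, b⟩ := hw' z h
    exact ⟨w z, Finset.mem_union_right _ (Finset.mem_filter.2 ⟨Finset.mem_image_of_mem _ hz, a⟩), b⟩
  refine ⟨A, ?_, ?_, ?_, ?_⟩
  · intro v hv
    rcases Finset.mem_union.1 hv with h | h
    · exact (Finset.mem_filter.1 h).2
    · exact (Finset.mem_filter.1 h).2
  · have := Finset.card_union_le X0 ((X0.image w).filter (· ∈ Q))
    rw [← hA] at this
    omega
  · intro x hx hq
    exact Finset.mem_union_left _ (hX0' x hx hq)
  · rintro z hz hex
    rcases hz with hz | hz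
    · by_cases hq : z ∈ Q
      · exact hX0A z (hX0' z hz hq) hex
      · obtain ⟨a, b⟩ := hw' z hex
        exact ⟨w z, Finset.mem_union_left _ (Finset.mem_filter.2 ⟨Finset.mem_image.2 ⟨z, hz, if_neg hq⟩, a⟩), b⟩
    · rcases Finset.mem_union.1 hz with h | h
      · exact hX0A z h hex
      · obtain ⟨y, hy, rfl⟩ := Finset.mem_image.1 (Finset.mem_filter.1 h).1
        rcases hw y with ⟨e, _⟩ | ⟨_, b⟩
        · rw [e] at hex ⊢
          exact hX0A y hy hex
        · exact ⟨y, Finset.mem_union_left _ hy, b.symm⟩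

theorem avoid_card (Z : Finset V) (ζ : V → ℕ) (D : V → Finset ℕ) (M : ℕ) (hZ : Z.card ≤ M)
    (hD : ∀ z ∈ Z, (D z).card ≤ M) :
    ∃ P : Finset ℕ, P.card ≤ M + M * M ∧ (∀ z ∈ Z, ζ z ∈ P) ∧ ∀ z ∈ Z, ∀ c ∈ D z, c ∈ P := by
  classical
  refine ⟨Z.image ζ ∪ Z.biUnion D, ?_, ?_, ?_⟩
  · refine (Finset.card_union_le _ _).trans (Nat.add_le_add (Finset.card_image_le.trans hZ) ?_)
    exact (Finset.card_biUnion_le_card_mul Z D M hD).trans (Nat.mul_le_mul_right M hZ)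
  · intro z hz
    exact Finset.mem_union_left _ (Finset.mem_image_of_mem _ hz)
  · intro z hz c hc
    exact Finset.mem_union_right _ (Finset.mem_biUnion.2 ⟨z, hz, hc⟩)

theorem ext_case3 {G : SimpleGraph V} {S : Set ℕ} (h1 : 1 ∈ S) {T M L : ℕ} {R Z : Finset V} {ζ : V → ℕ}
    {D : V → Finset ℕ} {g : V → Bool} (hZR : Z ⊆ R) (hZM : Z.card ≤ M)
    (hcol : ∀ z ∈ Z, 1 ≤ ζ z ∧ ζ z ≤ T) (hprop : ∀ a ∈ Z, ∀ b ∈ Z, G.Adj a b → ζ a ≠ ζ b)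
    (hD : ∀ z ∈ Z, (D z).card ≤ M) (hT : M + M * M + 2 * M + L ≤ T)
    (Q : Finset V) (hQ : ∀ v, v ∈ Q ↔ v ∈ R ∧ v ∉ Z)
    (hpcf : ∃ φ : V → ℕ, (∀ v, φ v < L) ∧ (∀ a b, (restr G Q).Adj a b → φ a ≠ φ b) ∧
      ∀ v w₀, (restr G Q).Adj v w₀ → ∃ w, (restr G Q).Adj v w ∧
        ∀ u, (restr G Q).Adj v u → φ u = φ w → u = w) :
    ∃ φ, ExtOut G S T R Z ζ D g φ := by
  classical
  obtain ⟨χ, hχL, hχp, hχc⟩ := hpcf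
  obtain ⟨P, hPc, hPζ, hPD⟩ := avoid_card Z ζ D M hZM hD
  obtain ⟨A, hAQ, hAc, _, hA⟩ := closure_set G Z Q
  obtain ⟨f, hf, hfi⟩ := fresh A P T (by omega)
  obtain ⟨e, he, hei⟩ := fresh (Finset.range L) (P ∪ A.image f) T (by
    have a1 := Finset.card_union_le P (A.image f)
    have a2 : (A.image f).card ≤ A.card := Finset.card_image_le
    rw [Finset.card_range]
    omega)
  set φ : V → ℕ := fun v => if v ∈ Z then ζ v else if v ∈ A then f v else e (χ v) with hφ
  have bZ : ∀ v ∈ Z, φ v = ζ v := fun v hv => if_pos hv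
  have bA : ∀ v ∈ A, φ v = f v := by
    intro v hv
    have : v ∉ Z := ((hQ v).1 (hAQ hv)).2
    simp only [hφ]; rw [if_neg this, if_pos hv]
  have bE : ∀ v, v ∉ Z → v ∉ A → φ v = e (χ v) := by
    intro v h h'
    simp only [hφ]; rw [if_neg h, if_neg h']
  have he' : ∀ v, (1 ≤ e (χ v) ∧ e (χ v) ≤ T) ∧ e (χ v) ∉ P ∧ e (χ v) ∉ A.image f := by
    intro v
    have := he (χ v) (Finset.mem_range.2 (hχL v))
    rw [Finset.mem_union, not_or] at this
    exact this
  have fP : ∀ v, v ∉ Z → φ v ∉ P := by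
    intro v hv
    by_cases hA' : v ∈ A
    · rw [bA v hA']; exact (hf v hA').2
    · rw [bE v hv hA']; exact (he' v).2.1
  have uniq : ∀ q ∈ A, ∀ v, φ v = φ q → v = q := by
    intro q hq v hv
    by_cases hz : v ∈ Z
    · exfalso
      apply fP q ((hQ q).1 (hAQ hq)).2
      rw [← hv, bZ v hz]; exact hPζ v hz
    · by_cases hA' : v ∈ A
      · rw [bA v hA', bA q hq] at hv
        exact hfi v hA' q hq hv
      · exfalso
        rw [bE v hz hA', bA q hq] at hv
        apply (he' v).2.2
        rw [hv]
        exact Finset.mem_image_of_mem _ hq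
  have hE : ∀ a b, a ∉ Z → a ∉ A → b ∉ Z → b ∉ A → φ a = φ b → χ a = χ b := by
    intro a b h1 h2 h3 h4 h5
    rw [bE a h1 h2, bE b h3 h4] at h5
    exact hei _ (Finset.mem_range.2 (hχL a)) _ (Finset.mem_range.2 (hχL b)) h5
  refine ⟨φ, ?_, bZ, ?_, ?_, ?_, ?_⟩
  · intro v hv
    by_cases hz : v ∈ Z
    · rw [bZ v hz]; exact hcol v hz
    · by_cases hA' : v ∈ A
      · rw [bA v hA']; exact (hf v hA').1
      · rw [bE v hz hA']; exact (he' v).1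
  · intro a ha b hb hab hc
    by_cases haA : a ∈ A
    · have := uniq a haA b hc.symm
      exact hab.ne this.symm
    by_cases hbA : b ∈ A
    · exact hab.ne (uniq b hbA a hc)
    by_cases haZ : a ∈ Z
    · by_cases hbZ : b ∈ Z
      · rw [bZ a haZ, bZ b hbZ] at hc; exact hprop a haZ b hbZ hab hc
      · apply fP b hbZ; rw [← hc, bZ a haZ]; exact hPζ a haZ
    · by_cases hbZ : b ∈ Z
      · apply fP a haZ; rw [hc, bZ b hbZ]; exact hPζ b hbZ
      · exact hχp a b ⟨hab, (hQ a).2 ⟨ha, haZ⟩, (hQ b).2 ⟨hb, hbZ⟩⟩ (hE a b haZ haA hbZ hbA hc)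
  · intro z hz _ u _ huZ _ hm
    exact fP u huZ (hPD z hz _ hm)
  · rintro z hz _ ⟨u, hu, huZ, hzu⟩
    obtain ⟨q, hq, hzq⟩ := hA z (Or.inl hz) ⟨u, (hQ u).2 ⟨hu, huZ⟩, hzu⟩
    refine ⟨φ q, fun hm => fP q ((hQ q).1 (hAQ hq)).2 (hPD z hz _ hm), Q, hQ, Ach.single h1 (hAQ hq) hzq ?_⟩
    intro v _ _ hv
    exact uniq q hq v hv
  · rintro v hv hvZ ⟨u, hu, huZ, hvu⟩
    by_cases hq : ∃ q ∈ A, G.Adj v q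
    · obtain ⟨q, hq, hvq⟩ := hq
      exact ⟨φ q, Ach.single h1 ((hQ q).1 (hAQ hq)).1 hvq (fun v _ _ hv => uniq q hq v hv)⟩
    · obtain ⟨w, hw, hwu⟩ := hχc v u ⟨hvu, (hQ v).2 ⟨hv, hvZ⟩, (hQ u).2 ⟨hu, huZ⟩⟩
      obtain ⟨hvw, hvQ, hwQ⟩ := hw
      have hnA : ∀ x, G.Adj v x → x ∉ A := fun x hx hxA => hq ⟨x, hxA, hx⟩
      refine ⟨φ w, Ach.single h1 ((hQ w).1 hwQ).1 hvw ?_⟩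
      intro x hx hvx hxw
      by_cases hxZ : x ∈ Z
      · exfalso
        apply fP w ((hQ w).1 hwQ).2
        rw [← hxw, bZ x hxZ]; exact hPζ x hxZ
      · exact hwu x ⟨hvx, hvQ, (hQ x).2 ⟨hx, hxZ⟩⟩
          (hE x w hxZ (hnA x hvx) ((hQ w).1 hwQ).2 (hnA w hvw) hxw)

theorem ext_case1 {G : SimpleGraph V} {S : Set ℕ} {T M p : ℕ} {R Z : Finset V} {ζ : V → ℕ}
    {D : V → Finset ℕ} {g : V → Bool} (hZR : Z ⊆ R) (hZM : Z.card ≤ M)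
    (hcol : ∀ z ∈ Z, 1 ≤ ζ z ∧ ζ z ≤ T) (hprop : ∀ a ∈ Z, ∀ b ∈ Z, G.Adj a b → ζ a ≠ ζ b)
    (hD : ∀ z ∈ Z, (D z).card ≤ M)
    (hM : 4 * p + 2 + 2 ^ (4 * p + 1) ≤ M)
    (IH : ∀ R' : Finset V, R' ⊂ R → Ext G S T M R')
    {X U : Finset V} {ρ : V → V} {c : V → Bool} (hS : Struct G R X U ρ c) (hX : X.card ≤ p)
    (hU : 1 + M + 2 ^ (4 * p + 1) < U.card) (u : V) (hu : u ∈ U)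
    (F : Finset V) (hF : ∀ v, v ∈ F ↔ v ∈ R ∧ v ∉ X ∧ ρ v = u)
    (ZF : Finset V) (hZF : ∀ v, v ∈ ZF ↔ v ∈ Z ∧ v ∈ F)
    (hbig : M < ZF.card + 3 * p + 1) :
    ∃ φ, ExtOut G S T R Z ζ D g φ := by
  classical
  set K0 : Finset V := insert u (X ∪ (Z \ F)) with hK0
  have hZFc : (Z \ F).card + ZF.card ≤ Z.card := by
    have e : ZF = Z ∩ F := by
      ext v; rw [hZF v, Finset.mem_inter]
    rw [e]
    exact (Finset.card_sdiff_add_card_inter Z F).le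
  have hK0c : K0.card ≤ 4 * p + 1 := by
    have a1 := Finset.card_insert_le u (X ∪ (Z \ F))
    have a2 := Finset.card_union_le X (Z \ F)
    rw [← hK0] at a1
    omega
  set A0 : Finset V := F ∪ X ∪ Z with hA0
  set B : Finset V := insert u (R \ F) with hB
  -- neighbourhoods
  set nb : V → Finset V := fun v => R.filter (fun x => G.Adj v x) with hnb
  have htw : ∀ Q : Finset V, ∃ w : V, (∃ v ∈ R, v ∉ A0 ∧ nb v = Q) → w ∈ R ∧ w ∉ A0 ∧ nb w = Q := by
    intro Q
    by_cases h : ∃ v ∈ R, v ∉ A0 ∧ nb v = Q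
    · obtain ⟨v, a, b⟩ := h
      exact ⟨v, fun _ => ⟨a, b⟩⟩
    · exact ⟨u, fun h' => absurd h' h⟩
  choose tw htw using htw
  set Tw : Finset V := (K0.powerset.image tw).filter (fun w => w ∈ R ∧ w ∉ A0 ∧ nb w ⊆ K0) with hTw
  have hTwc : Tw.card ≤ 2 ^ (4 * p + 1) := by
    refine (Finset.card_filter_le _ _).trans (Finset.card_image_le.trans ?_)
    rw [Finset.card_powerset]
    exact Nat.pow_le_pow_right (by norm_num) hK0c
  have hTw' : ∀ w ∈ Tw, w ∈ R ∧ w ∉ A0 ∧ nb w ⊆ K0 := fun w hw => (Finset.mem_filter.1 hw).2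
  set A : Finset V := A0 ∪ Tw with hA
  have uR : u ∈ R := hS.UR hu
  have uX : u ∉ X := fun h => hS.disj u h hu
  have uF : u ∈ F := (hF u).2 ⟨uR, uX, hS.rho_fix u hu⟩
  have hFX : ∀ v ∈ F, v ∉ X := fun v hv => ((hF v).1 hv).2.1
  have hFR : ∀ v ∈ F, v ∈ R := fun v hv => ((hF v).1 hv).1
  have hXR := hS.XR
  have mA : ∀ v, v ∈ A ↔ v ∈ F ∨ v ∈ X ∨ v ∈ Z ∨ v ∈ Tw := by
    intro v; simp only [hA, hA0, Finset.mem_union]; tauto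
  have mB : ∀ v, v ∈ B ↔ v = u ∨ (v ∈ R ∧ v ∉ F) := by
    intro v; simp only [hB, Finset.mem_insert, Finset.mem_sdiff]
  have mK : ∀ v, v ∈ K0 ↔ v = u ∨ v ∈ X ∨ (v ∈ Z ∧ v ∉ F) := by
    intro v; simp only [hK0, Finset.mem_insert, Finset.mem_sdiff, Finset.mem_union]
  have hAR : A ⊆ R := by
    intro v hv
    rcases (mA v).1 hv with h | h | h | h
    · exact hFR v h
    · exact hXR h
    · exact hZR h
    · exact (hTw' v h).1
  have hBR : B ⊆ R := by
    intro v hv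
    rcases (mB v).1 hv with rfl | h
    · exact uR
    · exact h.1
  have hAne : A ⊂ R := by
    refine Finset.ssubset_iff_subset_ne.2 ⟨hAR, fun he => ?_⟩
    have hsub : U ⊆ insert u (Z ∪ Tw) := by
      intro v hv
      have hvA : v ∈ A := by rw [he]; exact hS.UR hv
      rw [Finset.mem_insert, Finset.mem_union]
      rcases (mA v).1 hvA with h | h | h | h
      · left
        have := ((hF v).1 h).2.2
        rw [hS.rho_fix v hv] at this
        exact this
      · exact (hS.disj v h hv).elim
      · exact Or.inr (Or.inl h)
      · exact Or.inr (Or.inr h)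
    have a1 := Finset.card_le_card hsub
    have a2 := Finset.card_insert_le u (Z ∪ Tw)
    have a3 := Finset.card_union_le Z Tw
    omega
  have hBne : B ⊂ R := by
    refine Finset.ssubset_iff_subset_ne.2 ⟨hBR, fun he => ?_⟩
    have hsub : ZF ⊆ {u} := by
      intro v hv
      have hvF := ((hZF v).1 hv).2
      have hvB : v ∈ B := by rw [he]; exact hFR v hvF
      rw [Finset.mem_singleton]
      rcases (mB v).1 hvB with h | h
      · exact h
      · exact absurd hvF h.2
    have a1 := Finset.card_le_card hsub
    rw [Finset.card_singleton] at a1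
    omega
  have hIsub : A ∩ B ⊆ K0 ∪ Tw := by
    intro v hv
    obtain ⟨hvA, hvB⟩ := Finset.mem_inter.1 hv
    rw [Finset.mem_union, mK]
    rcases (mB v).1 hvB with h | h
    · exact Or.inl (Or.inl h)
    · rcases (mA v).1 hvA with h' | h' | h' | h'
      · exact absurd h' h.2
      · exact Or.inl (Or.inr (Or.inl h'))
      · exact Or.inl (Or.inr (Or.inr ⟨h', h.2⟩))
      · exact Or.inr h'
  have hIc : (A ∩ B).card ≤ M := by
    have a1 := Finset.card_le_card hIsub
    have a2 := Finset.card_union_le K0 Tw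
    omega
  -- neighbours of a vertex of `F`
  have hFnb : ∀ x ∈ F, x ≠ u → ∀ y ∈ R, G.Adj x y → y ∈ F ∨ y ∈ X := by
    intro x hx hxu y hy hxy
    by_cases hyX : y ∈ X
    · exact Or.inr hyX
    · left
      obtain ⟨a, b, e⟩ := (hF x).1 hx
      rcases hS.rho_adj x y a hy b hyX hxy with h | h
      · exact (hF y).2 ⟨hy, hyX, h ▸ e⟩
      · exfalso; apply hxu
        rw [← hS.rho_fix x h.1]; exact e
  obtain ⟨β, h⟩ := IH A hAne Z ζ D g (fun v hv => (mA v).2 (Or.inr (Or.inr (Or.inl hv)))) hZM hcol hprop hD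
  have hZA : Z ⊆ A := fun v hv => (mA v).2 (Or.inr (Or.inr (Or.inl hv)))
  have hloc : ∀ w, ∃ (d : Finset ℕ) (b : Bool), w ∈ A → d.card ≤ M ∧ Loc G S R Z A β D g w d b := by
    intro w
    by_cases hwA : w ∈ A
    swap
    · exact ⟨∅, false, fun h => absurd h hwA⟩
    by_cases hwZ : w ∈ Z
    · by_cases hg : g w = false
      · refine ⟨D w, false, fun _ => ⟨hD w hwZ, ?_, ?_, ?_⟩⟩
        · intro _ _
          exact ⟨rfl, fun _ h => h, fun x hx hxZ hwx => h.fa w hwZ hg x hx hxZ hwx⟩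
        · intro _ hg'; rw [hg] at hg'; cases hg'
        · intro h'; exact absurd hwZ h'
      · have hg' : g w = true := by simpa using hg
        by_cases hex : ∃ x ∈ A, x ∉ Z ∧ G.Adj w x
        · obtain ⟨cc, hcc, A', hA', hach⟩ := h.tr w hwZ hg' hex
          refine ⟨{cc}, false, fun _ => ⟨by rw [Finset.card_singleton]; omega, ?_, ?_, ?_⟩⟩
          · intro _ h'; exact absurd h' hg
          · intro _ _ _
            exact Or.inl ⟨rfl, cc, Finset.mem_singleton_self _, hcc, A', hA', hach⟩
          · intro h'; exact absurd hwZ h'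
        · refine ⟨D w, true, fun _ => ⟨hD w hwZ, ?_, ?_, ?_⟩⟩
          · intro _ h'; exact absurd h' hg
          · intro _ _ _
            refine Or.inr ⟨rfl, fun _ h => h, fun x hx hwx => ?_⟩
            by_contra hxZ
            exact hex ⟨x, hx, hxZ, hwx⟩
          · intro h'; exact absurd hwZ h'
    · by_cases hex : ∃ x ∈ A, x ∉ Z ∧ G.Adj w x
      · obtain ⟨cc, hach⟩ := h.out w hwA hwZ hex
        refine ⟨{cc}, false, fun _ => ⟨by rw [Finset.card_singleton]; omega, fun h' => absurd h' hwZ,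
          fun h' => absurd h' hwZ, fun _ _ => Or.inl ⟨rfl, cc, Finset.mem_singleton_self _, hach⟩⟩⟩
      · refine ⟨Z.image β, true, fun _ => ⟨Finset.card_image_le.trans hZM, fun h' => absurd h' hwZ,
          fun h' => absurd h' hwZ, fun _ _ => Or.inr ⟨rfl, fun x hx hwx => ?_⟩⟩⟩
        have hxZ : x ∈ Z := by
          by_contra hxZ
          exact hex ⟨x, hx, hxZ, hwx⟩
        exact ⟨hxZ, Finset.mem_image_of_mem _ hxZ⟩
  choose D' g' hloc using hloc
  obtain ⟨φ, hφ⟩ := sep_out (G := G) (S := S) (T := T) (M := M) (R := R) (A := A) (B := B) (β := β) (D := D') (g := g')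
    hAR hBR (by
      intro v hv
      by_cases hvF : v ∈ F
      · exact Or.inl ((mA v).2 (Or.inl hvF))
      · exact Or.inr ((mB v).2 (Or.inr ⟨hv, hvF⟩)))
    (by
      intro a ha b hb hab
      by_cases haB : a ∈ B
      · exact Or.inl haB
      · right
        have haF : a ∈ F := by
          by_contra haF
          exact haB ((mB a).2 (Or.inr ⟨hAR ha, haF⟩))
        have hau : a ≠ u := fun e => haB ((mB a).2 (Or.inl e))
        rcases hFnb a haF hau b (hBR hb) hab with h' | h'
        · exact (mA b).2 (Or.inl h')
        · exact (mA b).2 (Or.inr (Or.inl h')))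
    (IH B hBne) (A ∩ B) (fun v => Finset.mem_inter) hIc h.col h.prop
    (fun w hw => (hloc w (Finset.mem_inter.1 hw).1).1)
  refine ⟨φ, transfer hZA hAR h.ext (fun w hw => (hloc w hw).2) ?_ hφ⟩
  rintro v hv hvA ⟨y, hy, hyZ, hvy⟩ hall
  have hvF : v ∉ F := fun h' => hvA ((mA v).2 (Or.inl h'))
  have hvX : v ∉ X := fun h' => hvA ((mA v).2 (Or.inr (Or.inl h')))
  have hvu : v ≠ u := fun h' => hvF (h' ▸ uF)
  have hnbv : nb v ⊆ K0 := by
    intro x hx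
    obtain ⟨hxR, hvx⟩ := Finset.mem_filter.1 hx
    rw [mK]
    by_cases hxF : x ∈ F
    · left
      by_contra hxu
      rcases hFnb x hxF hxu v hv hvx.symm with h' | h'
      · exact hvF h'
      · exact hvX h'
    · rcases (mA x).1 (hall x hxR hvx) with h' | h' | h' | h'
      · exact absurd h' hxF
      · exact Or.inr (Or.inl h')
      · exact Or.inr (Or.inr ⟨h', hxF⟩)
      · exfalso
        have hm : v ∈ K0 := (hTw' x h').2.2 (Finset.mem_filter.2 ⟨hv, hvx.symm⟩)
        rcases (mK v).1 hm with e | e | e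
        · exact hvu e
        · exact hvX e
        · exact hvA (hZA e.1)
  have hvA0 : v ∉ A0 := fun h' => hvA (Finset.mem_union_left _ h')
  obtain ⟨t1, t2, t3⟩ := htw (nb v) ⟨v, hv, hvA0, rfl⟩
  have hadj : ∀ x ∈ R, (G.Adj (tw (nb v)) x ↔ G.Adj v x) := by
    intro x hx
    have := congrArg (fun s => x ∈ s) t3
    simp only [hnb, Finset.mem_filter, hx, true_and, eq_iff_iff] at this
    exact this
  have hm : tw (nb v) ∈ Tw := Finset.mem_filter.2 ⟨Finset.mem_image_of_mem _ (Finset.mem_powerset.2 hnbv), t1, t2, by rw [t3]; exact hnbv⟩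
  obtain ⟨cc, hach⟩ := h.out (tw (nb v)) ((mA _).2 (Or.inr (Or.inr (Or.inr hm))))
    (fun h' => t2 (Finset.mem_union_right _ h')) ⟨y, hall y hy hvy, hyZ, (hadj y hy).2 hvy⟩
  refine ⟨cc, hach.congr ?_⟩
  intro x
  constructor
  · rintro ⟨a, b, e⟩
    exact ⟨a, (hadj x (hAR a)).1 b, e⟩
  · rintro ⟨a, b, e⟩
    exact ⟨a, (hadj x (hAR a)).2 b, e⟩

theorem bip_color {G : SimpleGraph V} {S : Set ℕ} (hpos : ∀ s ∈ S, 0 < s) {k : ℕ}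
    (hyp : ∀ s : Set V, (G.induce s).Colorable 2 → SColorable S (G.induce s) k)
    (U : Finset V) (c : V → Bool) (hc : ∀ x ∈ U, ∀ y ∈ U, G.Adj x y → c x ≠ c y) :
    ∃ ψ : V → ℕ, (∀ v ∈ U, ψ v ∈ Finset.Icc 1 k) ∧ (∀ a ∈ U, ∀ b ∈ U, G.Adj a b → ψ a ≠ ψ b) ∧
      ∀ v ∈ U, (∃ u ∈ U, G.Adj v u) → ∃ cc ∈ Finset.Icc 1 k, Ach G S ψ U v cc := by
  classical
  have h2 : (G.induce (U : Set V)).Colorable 2 := by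
    have C : (G.induce (U : Set V)).Coloring Bool := Coloring.mk (fun v => c v.1) (by
      intro a b hab
      exact hc a.1 a.2 b.1 b.2 hab)
    have := C.colorable
    simpa using this
  obtain ⟨φ, h1, hp, hs⟩ := hyp _ h2
  have hval : ∀ v (hv : v ∈ U), (if h : v ∈ U then φ ⟨v, h⟩ else 0) = φ ⟨v, hv⟩ := fun v hv => dif_pos hv
  refine ⟨fun v => if h : v ∈ U then φ ⟨v, h⟩ else 0, ?_, ?_, ?_⟩
  · intro v hv
    have := h1 ⟨v, hv⟩
    rw [← hval v hv] at this
    exact this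
  · intro a ha b hb hab
    have := hp (u := ⟨a, ha⟩) (w := ⟨b, hb⟩) hab
    rw [← hval a ha, ← hval b hb] at this
    exact this
  · rintro v hv ⟨u, hu, hvu⟩
    obtain ⟨s, hsS, cc, hcc⟩ := hs ⟨v, hv⟩ ⟨⟨u, hu⟩, hvu⟩
    have hne : {x : (U : Set V) | (G.induce (U : Set V)).Adj ⟨v, hv⟩ x ∧ φ x = cc}.Nonempty := by
      apply Set.nonempty_of_ncard_ne_zero
      rw [hcc]
      exact (hpos s hsS).ne'
    obtain ⟨x, _, hx⟩ := hne
    refine ⟨cc, hx ▸ h1 x, ?_⟩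
    unfold Ach
    rw [← Set.ncard_coe_finset]
    rw [← hcc, ← Set.ncard_image_of_injective _ Subtype.val_injective] at hsS
    convert hsS using 2
    ext y
    simp only [Finset.coe_filter, Set.mem_setOf_eq, Set.mem_image]
    constructor
    · rintro ⟨a, b, e⟩
      rw [hval y a] at e
      exact ⟨⟨y, a⟩, ⟨b, e⟩, rfl⟩
    · rintro ⟨⟨y', a⟩, ⟨b, e⟩, rfl⟩
      exact ⟨a, b, by rw [hval y' a]; exact e⟩

theorem ext_case2 {G : SimpleGraph V} {S : Set ℕ} (h1 : 1 ∈ S) (hpos : ∀ s ∈ S, 0 < s) {k : ℕ}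
    (hyp : ∀ s : Set V, (G.induce s).Colorable 2 → SColorable S (G.induce s) k)
    {T M p : ℕ} {R Z : Finset V} {ζ : V → ℕ}
    {D : V → Finset ℕ} {g : V → Bool} (hZR : Z ⊆ R) (hZM : Z.card ≤ M)
    (hcol : ∀ z ∈ Z, 1 ≤ ζ z ∧ ζ z ≤ T) (hprop : ∀ a ∈ Z, ∀ b ∈ Z, G.Adj a b → ζ a ≠ ζ b)
    (hD : ∀ z ∈ Z, (D z).card ≤ M)
    (hM : 1 ≤ M) (hT : M + M * M + 2 * p + 2 * M + k ≤ T)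
    (IH : ∀ R' : Finset V, R' ⊂ R → Ext G S T M R')
    {X U : Finset V} {ρ : V → V} {c : V → Bool} (hS : Struct G R X U ρ c) (hX : X.card ≤ p)
    (hU : 3 * p + 1 < U.card)
    (hsmall : ∀ u ∈ U, ∃ ZF : Finset V, (∀ v, v ∈ ZF ↔ v ∈ Z ∧ (v ∈ R ∧ v ∉ X ∧ ρ v = u)) ∧
      ZF.card + 3 * p + 1 ≤ M) :
    ∃ φ, ExtOut G S T R Z ζ D g φ := by
  classical
  obtain ⟨P, hPc, hPζ, hPD⟩ := avoid_card Z ζ D M hZM hD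
  obtain ⟨A, hAQ, hAc, hXA, hA⟩ := closure_set G X (R \ Z)
  obtain ⟨W, hWQ, hWc, _, hW⟩ := closure_set G (Z ∩ U) ((U \ Z) \ A)
  have hWc' : W.card ≤ 2 * M := by
    have := Finset.card_le_card (Finset.inter_subset_left (s₁ := Z) (s₂ := U))
    omega
  have hAR : ∀ v ∈ A, v ∈ R ∧ v ∉ Z := fun v hv => Finset.mem_sdiff.1 (hAQ hv)
  have hWU : ∀ v ∈ W, v ∈ U ∧ v ∉ Z ∧ v ∉ A := by
    intro v hv
    have := hWQ hv
    rw [Finset.mem_sdiff, Finset.mem_sdiff] at this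
    exact ⟨this.1.1, this.1.2, this.2⟩
  set Q : Finset V := A ∪ W with hQ
  have hQc : Q.card ≤ 2 * p + 2 * M := by
    have := Finset.card_union_le A W
    rw [← hQ] at this
    omega
  have mQ : ∀ v, v ∈ Q ↔ v ∈ A ∨ v ∈ W := fun v => Finset.mem_union
  have hQZ : ∀ v ∈ Q, v ∉ Z := by
    intro v hv
    rcases (mQ v).1 hv with h | h
    · exact (hAR v h).2
    · exact (hWU v h).2.1
  set U2 : Finset V := (U \ Z) \ Q with hU2
  have mU2 : ∀ v, v ∈ U2 ↔ v ∈ U ∧ v ∉ Z ∧ v ∉ Q := by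
    intro v; rw [hU2, Finset.mem_sdiff, Finset.mem_sdiff]; tauto
  obtain ⟨f, hf, hfi⟩ := fresh Q P T (by omega)
  obtain ⟨e, he, hei⟩ := fresh (Finset.Icc 1 k) (P ∪ Q.image f) T (by
    have a1 := Finset.card_union_le P (Q.image f)
    have a2 : (Q.image f).card ≤ Q.card := Finset.card_image_le
    rw [Nat.card_Icc]
    omega)
  obtain ⟨ψ, hψc, hψp, hψs⟩ := bip_color hpos hyp U2 c (fun x hx y hy =>
    hS.col x ((mU2 x).1 hx).1 y ((mU2 y).1 hy).1)
  set Y : Finset V := Z ∪ A ∪ U with hY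
  have mY : ∀ v, v ∈ Y ↔ v ∈ Z ∨ v ∈ A ∨ v ∈ U := by
    intro v; simp only [hY, Finset.mem_union]; tauto
  have hQY : ∀ v ∈ Q, v ∈ Y := by
    intro v hv
    rcases (mQ v).1 hv with h | h
    · exact (mY v).2 (Or.inr (Or.inl h))
    · exact (mY v).2 (Or.inr (Or.inr (hWU v h).1))
  have hYR : Y ⊆ R := by
    intro v hv
    rcases (mY v).1 hv with h | h | h
    · exact hZR h
    · exact (hAR v h).1
    · exact hS.UR h
  have hZY : Z ⊆ Y := fun v hv => (mY v).2 (Or.inl hv)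
  have hUY : U ⊆ Y := fun v hv => (mY v).2 (Or.inr (Or.inr hv))
  have hYU : ∀ v ∈ Y, v ∉ Z → v ∉ Q → v ∈ U := by
    intro v hv h h'
    rcases (mY v).1 hv with a | a | a
    · exact absurd a h
    · exact absurd ((mQ v).2 (Or.inl a)) h'
    · exact a
  set β : V → ℕ := fun v => if v ∈ Z then ζ v else if v ∈ Q then f v else e (ψ v) with hβ
  have bZ : ∀ v ∈ Z, β v = ζ v := fun v hv => if_pos hv
  have bQ : ∀ v ∈ Q, β v = f v := by
    intro v hv
    simp only [hβ]; rw [if_neg (hQZ v hv), if_pos hv]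
  have bE : ∀ v, v ∉ Z → v ∉ Q → β v = e (ψ v) := by
    intro v h h'
    simp only [hβ]; rw [if_neg h, if_neg h']
  have he' : ∀ i ∈ Finset.Icc 1 k, (1 ≤ e i ∧ e i ≤ T) ∧ e i ∉ P ∧ e i ∉ Q.image f := by
    intro i hi
    have := he i hi
    rw [Finset.mem_union, not_or] at this
    exact this
  have mU2' : ∀ v ∈ Y, v ∉ Z → v ∉ Q → v ∈ U2 := fun v hv h h' => (mU2 v).2 ⟨hYU v hv h h', h, h'⟩
  have bP : ∀ v ∈ Z, β v ∈ P := fun v hv => by rw [bZ v hv]; exact hPζ v hv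
  have fP : ∀ v ∈ Y, v ∉ Z → β v ∉ P := by
    intro v hv hz
    by_cases hq : v ∈ Q
    · rw [bQ v hq]; exact (hf v hq).2
    · rw [bE v hz hq]; exact (he' _ (hψc v (mU2' v hv hz hq))).2.1
  have uniq : ∀ q ∈ Q, ∀ v ∈ Y, β v = β q → v = q := by
    intro q hq v hv hvq
    by_cases hz : v ∈ Z
    · exact absurd (hvq ▸ bP v hz) (fP q (hQY q hq) (hQZ q hq))
    · by_cases hvQ : v ∈ Q
      · rw [bQ v hvQ, bQ q hq] at hvq
        exact hfi v hvQ q hq hvq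
      · exfalso
        rw [bE v hz hvQ, bQ q hq] at hvq
        apply (he' _ (hψc v (mU2' v hv hz hvQ))).2.2
        rw [hvq]
        exact Finset.mem_image_of_mem _ hq
  have hYcol : ∀ v ∈ Y, 1 ≤ β v ∧ β v ≤ T := by
    intro v hv
    by_cases hz : v ∈ Z
    · rw [bZ v hz]; exact hcol v hz
    · by_cases hq : v ∈ Q
      · rw [bQ v hq]; exact (hf v hq).1
      · rw [bE v hz hq]; exact (he' _ (hψc v (mU2' v hv hz hq))).1
  have hYprop : ∀ a ∈ Y, ∀ b ∈ Y, G.Adj a b → β a ≠ β b := by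
    intro a ha b hb hab hc
    by_cases haA : a ∈ Q
    · exact hab.ne (uniq a haA b hb hc.symm).symm
    by_cases hbA : b ∈ Q
    · exact hab.ne (uniq b hbA a ha hc)
    by_cases haZ : a ∈ Z
    · by_cases hbZ : b ∈ Z
      · rw [bZ a haZ, bZ b hbZ] at hc; exact hprop a haZ b hbZ hab hc
      · exact fP b hb hbZ (hc ▸ bP a haZ)
    · by_cases hbZ : b ∈ Z
      · exact fP a ha haZ (hc ▸ bP b hbZ)
      · have h2 := mU2' a ha haZ haA
        have h3 := mU2' b hb hbZ hbA
        rw [bE a haZ haA, bE b hbZ hbA] at hc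
        exact hψp a h2 b h3 hab (hei _ (hψc a h2) _ (hψc b h3) hc)
  have hXQ : ∀ x ∈ X, x ∉ Z → x ∈ Q := fun x hx hz =>
    (mQ x).2 (Or.inl (hXA x hx (Finset.mem_sdiff.2 ⟨hS.XR hx, hz⟩)))
  -- a non-`U`, non-`X` vertex without neighbours in `Q` has at most one neighbour in `Y \ Z`
  have hone : ∀ w ∈ R, w ∉ X → w ∉ U → (¬ ∃ q ∈ Q, G.Adj w q) → ∀ y ∈ Y, y ∉ Z → G.Adj w y → y = ρ w := by
    intro w hw hwX hwU hq y hy hyZ hwy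
    have hyQ : y ∉ Q := fun h => hq ⟨y, h, hwy⟩
    have hyX : y ∉ X := fun h => hyQ (hXQ y h hyZ)
    have hyU := hYU y hy hyZ hyQ
    rcases hS.rho_adj w y hw (hYR hy) hwX hyX hwy with h | h
    · rw [h, hS.rho_fix y hyU]
    · exact absurd h.1 hwU
  have hXex : ∀ w, w ∈ X ∨ w ∈ A → (∃ u ∈ R, u ∉ Z ∧ G.Adj w u) → ∃ q ∈ Q, G.Adj w q := by
    rintro w hw ⟨u, hu, huZ, hwu⟩
    obtain ⟨x, hx, hwx⟩ := hA w hw ⟨u, Finset.mem_sdiff.2 ⟨hu, huZ⟩, hwu⟩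
    exact ⟨x, (mQ x).2 (Or.inl hx), hwx⟩
  have hWex : ∀ w, (w ∈ Z ∧ w ∈ U) ∨ w ∈ W → (¬ ∃ q ∈ Q, G.Adj w q) → ∀ y ∈ Y, G.Adj w y → y ∈ Z := by
    intro w hw hq y hy hwy
    by_contra hyZ
    have hyQ : y ∉ Q := fun h => hq ⟨y, h, hwy⟩
    have hyU := hYU y hy hyZ hyQ
    obtain ⟨x, hx, hwx⟩ := hW w (by rw [Finset.mem_inter]; exact hw) ⟨y, by
      rw [Finset.mem_sdiff, Finset.mem_sdiff]
      exact ⟨⟨hyU, hyZ⟩, fun h => hyQ ((mQ y).2 (Or.inl h))⟩, hwy⟩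
    exact hq ⟨x, (mQ x).2 (Or.inr hx), hwx⟩
  have hloc : ∀ w, ∃ (d : Finset ℕ) (b : Bool), w ∈ Y → d.card ≤ M ∧ Loc G S R Z Y β D g w d b ∧
      (w ∈ A ∪ X → b = false) := by
    intro w
    by_cases hwY : w ∈ Y
    swap
    · exact ⟨∅, false, fun h => absurd h hwY⟩
    by_cases hgz : w ∈ Z ∧ g w = false
    · obtain ⟨hwZ, hg⟩ := hgz
      refine ⟨D w, false, fun _ => ⟨hD w hwZ, ⟨?_, ?_, ?_⟩, fun _ => rfl⟩⟩
      · intro _ _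
        exact ⟨rfl, fun _ h => h, fun x hx hxZ _ hm => fP x hx hxZ (hPD w hwZ _ hm)⟩
      · intro _ hg'; rw [hg] at hg'; cases hg'
      · intro h'; exact absurd hwZ h'
    by_cases hex : ∃ u ∈ R, u ∉ Z ∧ G.Adj w u
    swap
    · refine ⟨∅, false, fun _ => ⟨by simp, ⟨?_, ?_, ?_⟩, fun _ => rfl⟩⟩
      · intro a b; exact absurd ⟨a, b⟩ hgz
      · intro _ _ h; exact absurd h hex
      · intro _ h; exact absurd h hex
    -- a single vertex witness
    have hsing : ∀ q ∈ Y, q ∉ Z → G.Adj w q → (∀ v ∈ Y, G.Adj w v → β v = β q → v = q) →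
        ∃ (d : Finset ℕ) (b : Bool), w ∈ Y → d.card ≤ M ∧ Loc G S R Z Y β D g w d b ∧
      (w ∈ A ∪ X → b = false) := by
      intro q hq hqZ hwq hun
      refine ⟨{β q}, false, fun _ => ⟨by rw [Finset.card_singleton]; exact hM, ⟨?_, ?_, ?_⟩, fun _ => rfl⟩⟩
      · intro a b; exact absurd ⟨a, b⟩ hgz
      · intro hwZ _ _
        refine Or.inl ⟨rfl, β q, Finset.mem_singleton_self _, fun hm => fP q hq hqZ (hPD w hwZ _ hm),
          Y \ Z, fun u => by simp, Ach.single h1 (Finset.mem_sdiff.2 ⟨hq, hqZ⟩) hwq ?_⟩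
        intro v hv
        exact hun v (Finset.mem_sdiff.1 hv).1
      · intro _ _
        exact Or.inl ⟨rfl, β q, Finset.mem_singleton_self _, Ach.single h1 hq hwq hun⟩
    by_cases hq : ∃ q ∈ Q, G.Adj w q
    · obtain ⟨q, hq, hwq⟩ := hq
      exact hsing q (hQY q hq) (hQZ q hq) hwq (fun v hv _ h => uniq q hq v hv h)
    have hwX : w ∉ X := fun h => hq (hXex w (Or.inl h) hex)
    have hwA : w ∉ A := fun h => hq (hXex w (Or.inr h) hex)
    have hwAX : ∀ b : Bool, w ∈ A ∪ X → b = false := by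
      intro b h
      rcases Finset.mem_union.1 h with h | h
      · exact absurd h hwA
      · exact absurd h hwX
    by_cases hwZ : w ∈ Z
    · by_cases hy : ∃ y ∈ Y, y ∉ Z ∧ G.Adj w y
      · obtain ⟨y, hyY, hyZ, hwy⟩ := hy
        have hwU : w ∉ U := fun h => hyZ (hWex w (Or.inl ⟨hwZ, h⟩) hq y hyY hwy)
        have hyr := hone w (hZR hwZ) hwX hwU hq y hyY hyZ hwy
        refine hsing y hyY hyZ hwy (fun v hv hwv hvy => ?_)
        by_cases hvZ : v ∈ Z
        · exact absurd (hvy ▸ bP v hvZ) (fP y hyY hyZ)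
        · rw [hyr]; exact hone w (hZR hwZ) hwX hwU hq v hv hvZ hwv
      · refine ⟨D w, true, fun _ => ⟨hD w hwZ, ⟨?_, ?_, ?_⟩, hwAX _⟩⟩
        · intro a b; exact absurd ⟨a, b⟩ hgz
        · intro _ _ _
          refine Or.inr ⟨rfl, fun _ h => h, fun x hx hwx => ?_⟩
          by_contra hxZ
          exact hy ⟨x, hx, hxZ, hwx⟩
        · intro h'; exact absurd hwZ h'
    · by_cases hy : ∃ y ∈ Y, y ∉ Z ∧ G.Adj w y
      · obtain ⟨y, hyY, hyZ, hwy⟩ := hy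
        have hyQ : y ∉ Q := fun h => hq ⟨y, h, hwy⟩
        have hwW : w ∉ W := fun h => hyZ (hWex w (Or.inr h) hq y hyY hwy)
        have hwU2 : w ∈ U2 := mU2' w hwY hwZ (fun h => ((mQ w).1 h).elim hwA hwW)
        obtain ⟨cc, hcc, hach⟩ := hψs w hwU2 ⟨y, mU2' y hyY hyZ hyQ, hwy⟩
        refine ⟨{e cc}, false, fun _ => ⟨by rw [Finset.card_singleton]; exact hM,
          ⟨fun h => absurd h hwZ, fun h => absurd h hwZ, fun _ _ => Or.inl ⟨rfl, e cc, Finset.mem_singleton_self _, ?_⟩⟩, fun _ => rfl⟩⟩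
        refine hach.congr ?_
        intro u
        constructor
        · rintro ⟨a, b, hu⟩
          obtain ⟨x1, x2, x3⟩ := (mU2 u).1 a
          exact ⟨hUY x1, b, by rw [bE u x2 x3, hu]⟩
        · rintro ⟨a, b, hu⟩
          have huQ : u ∉ Q := fun h => hq ⟨u, h, b⟩
          have huZ : u ∉ Z := fun h => (he' cc hcc).2.1 (hu ▸ bP u h)
          have hu2 := mU2' u a huZ huQ
          rw [bE u huZ huQ] at hu
          exact ⟨hu2, b, hei _ (hψc u hu2) _ hcc hu⟩
      · refine ⟨Z.image β, true, fun _ => ⟨Finset.card_image_le.trans hZM, ⟨fun h' => absurd h' hwZ,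
          fun h' => absurd h' hwZ, fun _ _ => Or.inr ⟨rfl, fun x hx hwx => ?_⟩⟩, hwAX _⟩⟩
        have hxZ : x ∈ Z := by
          by_contra hxZ
          exact hy ⟨x, hx, hxZ, hwx⟩
        exact ⟨hxZ, Finset.mem_image_of_mem _ hxZ⟩
  choose D' g' hloc using hloc
  have hKY : A ∪ X ⊆ Y := by
    intro v hv
    rcases Finset.mem_union.1 hv with h | h
    · exact (mY v).2 (Or.inr (Or.inl h))
    · by_cases hz : v ∈ Z
      · exact hZY hz
      · exact hQY v (hXQ v h hz)
  have hKc : (A ∪ X).card ≤ 3 * p := by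
    have := Finset.card_union_le A X
    omega
  obtain ⟨φ, hφ⟩ := star_out hS (Y := Y) (K := A ∪ X) (β := β) (D := D') (g := g') (S := S) (T := T) (M := M)
    (Finset.card_pos.1 (by omega)) hYR hUY Finset.subset_union_right hKY hYcol hYprop
    (fun w hw => (hloc w hw).1) (fun w hw => (hloc w (hKY hw)).2.2 hw) (by
      intro u hu
      obtain ⟨ZF, hZF, hZFc⟩ := hsmall u hu
      refine ⟨R.filter (fun v => v ∉ X ∧ ρ v = u) ∪ (A ∪ X),
        (R.filter (fun v => v ∉ X ∧ ρ v = u) ∪ (A ∪ X)).filter (· ∈ Y), ?_, ?_, ?_, ?_⟩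
      · intro v
        rw [Finset.mem_union, Finset.mem_filter]
      · intro v
        rw [Finset.mem_filter]
      · have hsub : (R.filter (fun v => v ∉ X ∧ ρ v = u) ∪ (A ∪ X)).filter (· ∈ Y) ⊆ insert u (ZF ∪ (A ∪ X)) := by
          intro v hv
          obtain ⟨hv, hvY⟩ := Finset.mem_filter.1 hv
          rw [Finset.mem_insert, Finset.mem_union]
          rcases Finset.mem_union.1 hv with h | h
          · obtain ⟨a, b, b'⟩ := Finset.mem_filter.1 h
            rcases (mY v).1 hvY with h' | h' | h'
            · exact Or.inr (Or.inl ((hZF v).2 ⟨h', a, b, b'⟩))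
            · exact Or.inr (Or.inr (Finset.mem_union_left _ h'))
            · left; rw [← hS.rho_fix v h']; exact b'
          · exact Or.inr (Or.inr h)
        have a1 := Finset.card_le_card hsub
        have a2 := Finset.card_insert_le u (ZF ∪ (A ∪ X))
        have a3 := Finset.card_union_le ZF (A ∪ X)
        omega
      · apply IH
        have hsubR : R.filter (fun v => v ∉ X ∧ ρ v = u) ∪ (A ∪ X) ⊆ R :=
          Finset.union_subset (Finset.filter_subset _ _) (hKY.trans hYR)
        refine Finset.ssubset_iff_subset_ne.2 ⟨hsubR, fun heq => ?_⟩
        have hsub : U ⊆ insert u (A ∪ X) := by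
          intro v hv
          have hvR := hS.UR hv
          rw [← heq] at hvR
          rw [Finset.mem_insert]
          rcases Finset.mem_union.1 hvR with h | h
          · left; rw [← hS.rho_fix v hv]; exact (Finset.mem_filter.1 h).2.2
          · exact Or.inr h
        have a1 := Finset.card_le_card hsub
        have a2 := Finset.card_insert_le u (A ∪ X)
        omega)
  refine ⟨φ, transfer hZY hYR bZ (fun w hw => (hloc w hw).2.1) ?_ hφ⟩
  rintro v hv hvY ⟨y, hy, hyZ, hvy⟩ hall
  have hyY := hall y hy hvy
  by_cases hq : ∃ q ∈ Q, G.Adj v q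
  · obtain ⟨q, hq, hvq⟩ := hq
    exact ⟨β q, Ach.single h1 (hQY q hq) hvq (fun v hv _ h => uniq q hq v hv h)⟩
  · have hvX : v ∉ X := fun h => hvY (hKY (Finset.mem_union_right _ h))
    have hvU : v ∉ U := fun h => hvY (hUY h)
    refine ⟨β y, Ach.single h1 hyY hvy ?_⟩
    intro x hx hvx hxy
    by_cases hxZ : x ∈ Z
    · exact absurd (hxy ▸ bP x hxZ) (fP y hyY hyZ)
    · rw [hone v hv hvX hvU hq y hyY hyZ hvy, hone v hv hvX hvU hq x hx hxZ hvx]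

theorem ext_main (t : ℕ) : ∃ C M : ℕ, ∀ (V : Type u) [Fintype V] (G : SimpleGraph V), ¬ OddModel G t →
    ∀ S : Set ℕ, (∀ s ∈ S, 0 < s) → 1 ∈ S → ∀ k : ℕ,
      (∀ s : Set V, (G.induce s).Colorable 2 → SColorable S (G.induce s) k) →
      ∀ R : Finset V, Ext G S (k + C) M R := by
  classical
  obtain ⟨p, hp⟩ : ∃ p, p = 2 * (4 * t + 1) := ⟨_, rfl⟩
  obtain ⟨E, hE⟩ : ∃ E, E = 2 ^ (4 * p + 1) := ⟨_, rfl⟩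
  obtain ⟨M, hM⟩ : ∃ M, M = 4 * p + 2 + E := ⟨_, rfl⟩
  obtain ⟨n, hn⟩ := structure_R.{u} t (2 + M + E + 3 * p) (by omega)
  obtain ⟨L, hL⟩ := exists_pcf_bound.{u} n
  refine ⟨M + M * M + 2 * p + 2 * M + L, M, ?_⟩
  intro V _ G hG S hpos h1 k hyp R
  induction R using Finset.strongInduction with
  | H R IH =>
    intro Z ζ D g hZR hZM hcol hprop hD
    by_cases hcm : CliqueModel (restr G R) n
    · obtain ⟨X, U, ρ, c, hX, hU, hS⟩ := hn V G R hcm hG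
      rw [← hp] at hX
      by_cases hbig : ∃ u ∈ U, M < (Z.filter (fun v => v ∈ R ∧ v ∉ X ∧ ρ v = u)).card + 3 * p + 1
      · obtain ⟨u, hu, hbig⟩ := hbig
        exact ext_case1 (p := p) hZR hZM hcol hprop hD (by rw [← hE]; omega) IH hS hX
          (by rw [← hE]; omega) u hu (R.filter (fun v => v ∉ X ∧ ρ v = u)) (fun v => by simp)
          (Z.filter (fun v => v ∈ R ∧ v ∉ X ∧ ρ v = u)) (fun v => by simp) hbig
      · refine ext_case2 (p := p) (k := k) h1 hpos hyp hZR hZM hcol hprop hD (by omega) (by omega) IH hS hX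
          (by omega) ?_
        intro u hu
        refine ⟨Z.filter (fun v => v ∈ R ∧ v ∉ X ∧ ρ v = u), fun v => by simp, ?_⟩
        by_contra h
        exact hbig ⟨u, hu, by omega⟩
    · refine ext_case3 (L := L) h1 hZR hZM hcol hprop hD (by omega) (R \ Z) (fun v => Finset.mem_sdiff) ?_
      apply hL
      intro h
      apply hcm
      obtain ⟨B, hB⟩ := h
      have hmon : ∀ a b, (restr G (R \ Z)).Adj a b → (restr G R).Adj a b := fun a b hab =>
        ⟨hab.1, (Finset.mem_sdiff.1 hab.2.1).1, (Finset.mem_sdiff.1 hab.2.2).1⟩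
      exact ⟨B, hB.mono hmon hmon⟩

theorem stmt4 (WH : Type) [Fintype WH] (H : SimpleGraph WH) :
    ∃ c : ℕ, ∀ (V : Type) [Fintype V] (G : SimpleGraph V), ¬ IsOddMinor H G →
      ∀ S : Set ℕ, (∀ s ∈ S, 0 < s) → 1 ∈ S →
      ∀ k : ℕ, 0 < k →
        (∀ s : Set V, (G.induce s).Colorable 2 → SColorable S (G.induce s) k) →
        SColorable S G (k + c) := by
  classical
  obtain ⟨C, M, h⟩ := ext_main.{0} (Fintype.card WH)
  refine ⟨C, ?_⟩
  intro V _ G hH S hpos h1 k _ hyp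
  have hG : ¬ OddModel G (Fintype.card WH) := fun hm => hH (isOddMinor_of_oddModel H G hm)
  obtain ⟨φ, hφ⟩ := h V G hG S hpos h1 k hyp Finset.univ ∅ (fun _ => 0) (fun _ => ∅) (fun _ => false)
    (by simp) (by simp) (by simp) (by simp) (by simp)
  refine ⟨φ, fun v => Finset.mem_Icc.2 (hφ.col v (Finset.mem_univ v)),
    fun a b hab => hφ.prop a (Finset.mem_univ a) b (Finset.mem_univ b) hab, ?_⟩
  rintro v ⟨w, hw⟩
  obtain ⟨c, hc⟩ := hφ.out v (Finset.mem_univ v) (by simp) ⟨w, Finset.mem_univ w, by simp, hw⟩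
  refine ⟨_, hc, c, ?_⟩
  rw [← Set.ncard_coe_finset]
  congr 1
  ext u
  simp


end CFPaper
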